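/- arXiv:1602.03039 — 2 statements merged into one kernel-verified Lean document; each statement's English description precedes it below -/
import Mathlib

section
/- Let M be a non-projective indecomposable representation of a Dynkin quiver Q with Auslander–Reiten translate τM, and let e ≠ dim M be a dimension vector such that Gr_e(M ⊕ τM) is nonempty. Then Gr_e(M ⊕ τM) is smooth of dimension ⟨e, d−e⟩ where d = dim(M ⊕ τM). -/
/-!
STATEMENT 12: Let M be a non-projective indecomposable representation of a Dynkin
quiver Q over ℂ with Auslander–Reiten translate τM (i.e. there is an almost split
sequence `0 → τM → E → M → 0`), and let `e ≠ dim M` be a dimension vector such that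
`Gr_e(M ⊕ τM)` is nonempty.  Then `Gr_e(M ⊕ τM)` is smooth of dimension `⟨e, d−e⟩`,
where `d = dim (M ⊕ τM)`.

Smoothness of dimension k means that every (scheme-theoretic) tangent space
`Hom_Q(N, (M ⊕ τM)/N)` has dimension k; the dimension of the variety (Zariski
topology of the geometric quotient, topological Krull dimension) also equals
`⟨e, d−e⟩`.  Euler-form equalities are stated additively to avoid signed
subtraction.  A quiver is Dynkin iff its Tits form is positive definite.
-/

noncomputable section
open Matrix

variable {V A : Type}

/-- A complex representation of the quiver `(V, A, s, t)` of dimension vector `d`. -/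
abbrev QRep (s t : A → V) (d : V → ℕ) : Type :=
  ∀ a : A, Matrix (Fin (d (t a))) (Fin (d (s a))) ℂ

/-- The quiver Grassmannian `Gr_e(M)`: families of subspaces `N i ⊆ ℂ^{d i}` of
dimension `e i` with `M_a (N (s a)) ⊆ N (t a)` for every arrow. -/
def SubRep (s t : A → V) {d : V → ℕ} (M : QRep s t d) (e : V → ℕ) : Type :=
  {N : ∀ i : V, Submodule ℂ (Fin (d i) → ℂ) //
    (∀ i, Module.finrank ℂ (N i) = e i) ∧
    ∀ a : A, (N (s a)).map (M a).mulVecLin ≤ N (t a)}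

/-- The Zariski topology on the affine space `σ → ℂ`, induced from the Zariski
topology on the prime spectrum of the polynomial ring via `x ↦ ker (eval x)`. -/
def zariski (σ : Type) : TopologicalSpace (σ → ℂ) :=
  TopologicalSpace.induced
    (fun x => (⟨RingHom.ker (MvPolynomial.eval x), RingHom.ker_isPrime _⟩ :
      PrimeSpectrum (MvPolynomial σ ℂ)))
    inferInstance

/-- Coordinates for a tuple of `(d i) × (e i)` matrices. -/
abbrev Coord (d e : V → ℕ) : Type := (Σ i : V, Fin (d i) × Fin (e i)) → ℂ

/-- The `i`-th matrix encoded by a coordinate vector. -/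
def matOf {d e : V → ℕ} (F : Coord (V := V) d e) (i : V) :
    Matrix (Fin (d i)) (Fin (e i)) ℂ :=
  fun p q => F ⟨i, (p, q)⟩

/-- The affine "Stiefel-type" variety of tuples of injective linear maps
`ℂ^{e i} → ℂ^{d i}` whose images form a subrepresentation of `M`. -/
def StQ (s t : A → V) {d : V → ℕ} (M : QRep s t d) (e : V → ℕ) : Type :=
  {F : Coord (V := V) d e //
    (∀ i, Function.Injective (matOf F i).mulVecLin) ∧
    ∀ a : A, (LinearMap.range (matOf F (s a)).mulVecLin).map (M a).mulVecLin ≤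
      LinearMap.range (matOf F (t a)).mulVecLin}

/-- The canonical surjection from the Stiefel-type variety onto the quiver
Grassmannian, sending a tuple of injective maps to the tuple of their images. -/
def toSub (s t : A → V) {d : V → ℕ} (M : QRep s t d) (e : V → ℕ) :
    StQ s t M e → SubRep s t M e := fun F =>
  ⟨fun i => LinearMap.range (matOf F.1 i).mulVecLin,
   fun i => by
     rw [LinearMap.finrank_range_of_inj (F.2.1 i)]
     exact Module.finrank_fin_fun ℂ,
   F.2.2⟩

/-- The Zariski topology on the quiver Grassmannian: the quotient (geometric
quotient) topology from the locally closed subset `StQ` of affine space. -/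
instance (s t : A → V) {d : V → ℕ} (M : QRep s t d) (e : V → ℕ) :
    TopologicalSpace (SubRep s t M e) :=
  TopologicalSpace.coinduced (toSub s t M e)
    (TopologicalSpace.induced Subtype.val (zariski _))

/-- The map `Φ^M_N`, whose cokernel is `Ext¹_Q(N,M)`. -/
def PhiFun (s t : A → V) {e d : V → ℕ} (N : QRep s t e) (M : QRep s t d) :
    (∀ i : V, Matrix (Fin (d i)) (Fin (e i)) ℂ) →
      (∀ a : A, Matrix (Fin (d (t a))) (Fin (e (s a))) ℂ) :=
  fun f a => M a * f (s a) - f (t a) * N a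

/-- `Ext¹_Q(N, M) = 0`, expressed as surjectivity of `Φ^M_N` (whose cokernel
computes `Ext¹` via the standard resolution over the path algebra). -/
def ExtVanish (s t : A → V) {e d : V → ℕ} (N : QRep s t e) (M : QRep s t d) : Prop :=
  Function.Surjective (PhiFun s t N M)

/-- A representation is rigid if `Ext¹_Q(M, M) = 0`. -/
def Rigid (s t : A → V) {d : V → ℕ} (M : QRep s t d) : Prop :=
  ExtVanish s t M M

/-- The Euler form `⟨x,y⟩ = Σ_i x i * y i − Σ_a x (s a) * y (t a)` of the quiver. -/
def eulerForm [Fintype V] [Fintype A] (s t : A → V) (x y : V → ℤ) : ℤ :=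
  (∑ i : V, x i * y i) - ∑ a : A, x (s a) * y (t a)

/-- The quiver is Dynkin (disjoint union of simply-laced Dynkin diagrams), i.e. its
Tits form is positive definite. -/
def IsDynkin [Fintype V] [Fintype A] (s t : A → V) : Prop :=
  ∀ x : V → ℤ, x ≠ 0 → 0 < eulerForm s t x x

/-- Morphisms of representations `X → Y`, given by matrices `φ i` with
`Y_a φ_{s a} = φ_{t a} X_a`. -/
def RHom (s t : A → V) {dX dY : V → ℕ} (X : QRep s t dX) (Y : QRep s t dY) : Type :=
  {φ : ∀ i : V, Matrix (Fin (dY i)) (Fin (dX i)) ℂ //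
    ∀ a : A, Y a * φ (s a) = φ (t a) * X a}

/-- A representation is indecomposable: nonzero, and its only idempotent
endomorphisms are 0 and 1. -/
def Indec (s t : A → V) {d : V → ℕ} (M : QRep s t d) : Prop :=
  (∃ i, 0 < d i) ∧
  ∀ φ : RHom s t M M, (∀ i, φ.1 i * φ.1 i = φ.1 i) →
    (∀ i, φ.1 i = 0) ∨ (∀ i, φ.1 i = 1)

/-- The direct sum of two representations. -/
def dsum (s t : A → V) {d e : V → ℕ} (M : QRep s t d) (N : QRep s t e) :
    QRep s t (fun i => d i + e i) :=
  fun a => Matrix.reindex finSumFinEquiv finSumFinEquiv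
    (Matrix.fromBlocks (M a) 0 0 (N a))

/-- `0 → X → Y → Z → 0` is a short exact sequence of representations. -/
def IsSES (s t : A → V) {dX dY dZ : V → ℕ}
    {X : QRep s t dX} {Y : QRep s t dY} {Z : QRep s t dZ}
    (f : RHom s t X Y) (g : RHom s t Y Z) : Prop :=
  (∀ i, Function.Injective (f.1 i).mulVecLin) ∧
  (∀ i, Function.Surjective (g.1 i).mulVecLin) ∧
  ∀ i, LinearMap.range (f.1 i).mulVecLin = LinearMap.ker (g.1 i).mulVecLin

/-- A morphism of representations is a split epimorphism. -/
def IsSplitEpi (s t : A → V) {dX dY : V → ℕ}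
    {X : QRep s t dX} {Y : QRep s t dY} (h : RHom s t X Y) : Prop :=
  ∃ r : RHom s t Y X, ∀ i, h.1 i * r.1 i = 1

/-- `0 → T → E → M → 0` is an almost split (Auslander–Reiten) sequence: it is a
non-split short exact sequence, T and M are indecomposable, and every morphism
`X → M` which is not a split epimorphism factors through `E`. -/
def IsAlmostSplit (s t : A → V) {dT dE dM : V → ℕ}
    {T : QRep s t dT} {E : QRep s t dE} {M : QRep s t dM}
    (f : RHom s t T E) (g : RHom s t E M) : Prop :=
  IsSES s t f g ∧ ¬ IsSplitEpi s t g ∧ Indec s t T ∧ Indec s t M ∧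
  ∀ (x : V → ℕ) (X : QRep s t x) (h : RHom s t X M), ¬ IsSplitEpi s t h →
    ∃ u : RHom s t X E, ∀ i, g.1 i * u.1 i = h.1 i
/-- The (scheme-theoretic) tangent space of the quiver Grassmannian at a point
`x = (N i)ᵢ`: families of linear maps `φ i : N i → ℂ^{d i}/N i` commuting with the
maps induced by `M`.  This space is canonically `Hom_Q(L, M/L)`, where `L` is the
subrepresentation corresponding to `x`. -/
def TangentSp (s t : A → V) {d : V → ℕ} (M : QRep s t d) {e : V → ℕ}
    (x : SubRep s t M e) :
    Submodule ℂ (∀ i : V, (x.1 i →ₗ[ℂ] ((Fin (d i) → ℂ) ⧸ x.1 i))) where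
  carrier := {φ | ∀ (a : A) (v : x.1 (s a)),
    φ (t a) ⟨(M a).mulVecLin v, x.2.2 a (Submodule.mem_map_of_mem v.2)⟩ =
      Submodule.mapQ (x.1 (s a)) (x.1 (t a)) (M a).mulVecLin
        (Submodule.map_le_iff_le_comap.mp (x.2.2 a)) (φ (s a) v)}
  add_mem' := by
    intro φ ψ hφ hψ a v
    simp only [Pi.add_apply, LinearMap.add_apply, hφ a v, hψ a v, map_add]
  zero_mem' := by
    intro a v
    simp
  smul_mem' := by
    intro c φ hφ a v
    simp only [Pi.smul_apply, LinearMap.smul_apply, hφ a v, LinearMap.map_smul]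

/-- A linear map vanishing on the kernel of `u` factors through `u`. -/
theorem LinearMap.exists_comp_eq_of_ker_le {X Y W : Type*} [AddCommGroup X] [Module ℂ X]
    [AddCommGroup Y] [Module ℂ Y] [AddCommGroup W] [Module ℂ W] (u : X →ₗ[ℂ] Y) (c : X →ₗ[ℂ] W)
    (h : ∀ x, u x = 0 → c x = 0) : ∃ c' : Y →ₗ[ℂ] W, ∀ x, c' (u x) = c x := by
  obtain ⟨g, hg⟩ := LinearMap.exists_extend
    (((LinearMap.ker u).liftQ c fun x hx => h x hx) ∘ₗ u.quotKerEquivRange.symm.toLinearMap)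
  refine ⟨g, fun x => ?_⟩
  have h1 := LinearMap.congr_fun hg ⟨u x, LinearMap.mem_range_self u x⟩
  have h2 : u.quotKerEquivRange.symm ⟨u x, LinearMap.mem_range_self u x⟩ =
      (LinearMap.ker u).mkQ x := by
    rw [LinearEquiv.symm_apply_eq]; rfl
  simp only [LinearMap.comp_apply, Submodule.subtype_apply, LinearEquiv.coe_coe, h2] at h1
  exact h1

/-- A linear map with values in the range of `u` lifts along `u`. -/
theorem LinearMap.exists_comp_eq_of_mem_range {X Y W : Type*} [AddCommGroup X] [Module ℂ X]
    [AddCommGroup Y] [Module ℂ Y] [AddCommGroup W] [Module ℂ W] (u : X →ₗ[ℂ] Y) (c : W →ₗ[ℂ] Y)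
    (h : ∀ w, ∃ x, u x = c w) : ∃ c' : W →ₗ[ℂ] X, ∀ w, u (c' w) = c w := by
  obtain ⟨g, hg⟩ := LinearMap.exists_rightInverse_of_surjective u.rangeRestrict
    (LinearMap.range_rangeRestrict u)
  refine ⟨g ∘ₗ c.codRestrict (LinearMap.range u) fun w => h w, fun w => ?_⟩
  have := LinearMap.congr_fun hg (c.codRestrict (LinearMap.range u) (fun w => h w) w)
  exact congrArg Subtype.val this

/-- Two nested finite families of subspaces with the same total dimension agree. -/
theorem Submodule.forall_eq_of_sum_finrank_le {ι : Type*} [Fintype ι] {X : ι → Type*}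
    [∀ i, AddCommGroup (X i)] [∀ i, Module ℂ (X i)] [∀ i, FiniteDimensional ℂ (X i)]
    {N N' : ∀ i, Submodule ℂ (X i)} (hle : ∀ i, N i ≤ N' i)
    (hsum : ∑ i, Module.finrank ℂ (N' i) ≤ ∑ i, Module.finrank ℂ (N i)) (i : ι) :
    N i = N' i := by
  have hmono : ∀ j ∈ Finset.univ, Module.finrank ℂ (N j) ≤ Module.finrank ℂ (N' j) :=
    fun j _ => Submodule.finrank_mono (hle j)
  have := (Finset.sum_eq_sum_iff_of_le hmono).1 (le_antisymm (Finset.sum_le_sum hmono) hsum) i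
    (Finset.mem_univ i)
  exact Submodule.eq_of_le_of_finrank_eq (hle i) this

/-- A finite-dimensional complex representation of the quiver `(V, A, s, t)`, without a choice
of bases. -/
structure QuiverRep (s t : A → V) where
  space : V → Type
  [addCommGroup : ∀ i, AddCommGroup (space i)]
  [module : ∀ i, Module ℂ (space i)]
  [finiteDimensional : ∀ i, FiniteDimensional ℂ (space i)]
  map : ∀ a, space (s a) →ₗ[ℂ] space (t a)

attribute [instance] QuiverRep.addCommGroup QuiverRep.module QuiverRep.finiteDimensional

namespace QuiverRep

variable {s t : A → V}

/-- Families of linear maps indexed by the vertices. -/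
abbrev Fam (X Y : QuiverRep s t) : Type := ∀ i, X.space i →ₗ[ℂ] Y.space i

/-- Families of linear maps indexed by the arrows; they represent classes in `Ext¹(X, Y)`. -/
abbrev Cocycle (X Y : QuiverRep s t) : Type := ∀ a, X.space (s a) →ₗ[ℂ] Y.space (t a)

/-- The family `φ` is a morphism of representations. -/
def IsHom (X Y : QuiverRep s t) (φ : Fam X Y) : Prop :=
  ∀ a x, Y.map a (φ (s a) x) = φ (t a) (X.map a x)

/-- The class of the cocycle `ξ` in `Ext¹(X, Y)` vanishes. -/
def IsCoboundary (X Y : QuiverRep s t) (ξ : Cocycle X Y) : Prop :=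
  ∃ g : Fam X Y, ∀ a x, ξ a x = Y.map a (g (s a) x) - g (t a) (X.map a x)

/-- `Ext¹(X, Y) = 0`. -/
def ExtZero (X Y : QuiverRep s t) : Prop := ∀ ξ : Cocycle X Y, IsCoboundary X Y ξ

/-- Indecomposability, in terms of idempotent endomorphisms. -/
def IsIndec (X : QuiverRep s t) : Prop :=
  (∃ i, ∃ x : X.space i, x ≠ 0) ∧
  ∀ φ : Fam X X, IsHom X X φ → (∀ i x, φ i (φ i x) = φ i x) →
    (∀ i x, φ i x = 0) ∨ (∀ i x, φ i x = x)

/-- All endomorphisms are scalar. -/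
def IsBrick (X : QuiverRep s t) : Prop :=
  ∀ φ : Fam X X, IsHom X X φ → ∃ c : ℂ, ∀ i x, φ i x = c • x

theorem IsHom.comp {X Y Z : QuiverRep s t} {φ : Fam X Y} {ψ : Fam Y Z} (hψ : IsHom Y Z ψ)
    (hφ : IsHom X Y φ) : IsHom X Z (fun i => ψ i ∘ₗ φ i) := fun a x => by
  simp [hψ a, hφ a]

/-- The subrepresentation carried by a stable family of subspaces. -/
@[simps]
def subrep (X : QuiverRep s t) (N : ∀ i, Submodule ℂ (X.space i))
    (h : ∀ a, ∀ x ∈ N (s a), X.map a x ∈ N (t a)) : QuiverRep s t where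
  space i := N i
  map a := (X.map a).restrict (h a)

/-- The quotient by a stable family of subspaces. -/
def quotient (X : QuiverRep s t) (N : ∀ i, Submodule ℂ (X.space i))
    (h : ∀ a, ∀ x ∈ N (s a), X.map a x ∈ N (t a)) : QuiverRep s t where
  space i := X.space i ⧸ N i
  map a := (N (s a)).mapQ (N (t a)) (X.map a) (h a)

/-- The kernel of a morphism. -/
abbrev kernel {X Y : QuiverRep s t} {u : Fam X Y} (hu : IsHom X Y u) : QuiverRep s t :=
  X.subrep (fun i => LinearMap.ker (u i)) fun a x hx => by
    rw [LinearMap.mem_ker] at hx ⊢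
    rw [← hu a, hx, map_zero]

/-- The range of a morphism. -/
abbrev range {X Y : QuiverRep s t} {u : Fam X Y} (hu : IsHom X Y u) : QuiverRep s t :=
  Y.subrep (fun i => LinearMap.range (u i)) fun a x hx => by
    obtain ⟨y, rfl⟩ := hx
    exact ⟨X.map a y, (hu a y).symm⟩

/-- The extension of `X` by `Y` defined by a cocycle. -/
def extension (X Y : QuiverRep s t) (ξ : Cocycle X Y) : QuiverRep s t where
  space i := Y.space i × X.space i
  map a := (Y.map a ∘ₗ LinearMap.fst ℂ _ _ + ξ a ∘ₗ LinearMap.snd ℂ _ _).prod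
    (X.map a ∘ₗ LinearMap.snd ℂ _ _)

theorem ExtZero.of_surjective {X Y Z : QuiverRep s t} (h : ExtZero X Y) {p : Fam Y Z}
    (hp : IsHom Y Z p) (hs : ∀ i, Function.Surjective (p i)) : ExtZero X Z := fun ξ => by
  have (a : A) := LinearMap.exists_comp_eq_of_mem_range (p (t a)) (ξ a) fun w => hs _ _
  choose ξ' hξ' using this
  obtain ⟨g, hg⟩ := h ξ'
  refine ⟨fun i => p i ∘ₗ g i, fun a x => ?_⟩
  simp [← hξ', hg, hp a]

/-- `Ext¹(Y, W) = 0` and `Ext¹(ker u, W) = 0` imply `Ext¹(X, W) = 0` for `u : X → Y`. -/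
theorem ExtZero.of_kernel {X Y W : QuiverRep s t} {u : Fam X Y} (hu : IsHom X Y u)
    (hY : ExtZero Y W) (hK : ExtZero (kernel hu) W) : ExtZero X W := fun ξ => by
  obtain ⟨g, hg⟩ := hK fun a => ξ a ∘ₗ (LinearMap.ker (u (s a))).subtype
  choose g' hg' using fun i => LinearMap.exists_extend (g i)
  have hg'' : ∀ i (x : X.space i) (hx : x ∈ LinearMap.ker (u i)), g' i x = g i ⟨x, hx⟩ :=
    fun i x hx => LinearMap.congr_fun (hg' i) ⟨x, hx⟩
  have (a : A) := LinearMap.exists_comp_eq_of_ker_le (u (s a))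
    (ξ a - (W.map a ∘ₗ g' (s a) - g' (t a) ∘ₗ X.map a)) fun x hx => by
      have h1 := hg a ⟨x, hx⟩
      have hx' : X.map a x ∈ LinearMap.ker (u (t a)) := by
        rw [LinearMap.mem_ker, ← hu a, hx, map_zero]
      simp only [LinearMap.sub_apply, LinearMap.comp_apply, hg'' _ x hx, hg'' _ _ hx']
      exact sub_eq_zero.2 h1
  choose c hc using this
  obtain ⟨k, hk⟩ := hY c
  refine ⟨fun i => g' i + k i ∘ₗ u i, fun a x => ?_⟩
  have h1 := hc a x
  rw [hk, hu a] at h1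
  simp only [LinearMap.sub_apply, LinearMap.comp_apply] at h1
  simp only [LinearMap.add_apply, LinearMap.comp_apply, map_add]
  linear_combination (norm := module) -h1

theorem ExtZero.of_injective {X Y W : QuiverRep s t} {u : Fam X Y} (hu : IsHom X Y u)
    (hinj : ∀ i, Function.Injective (u i)) (hY : ExtZero Y W) : ExtZero X W := by
  refine ExtZero.of_kernel hu hY fun ξ => ⟨fun i => 0, fun a x => ?_⟩
  have hx : x = 0 := Subtype.ext (hinj _ (Eq.trans x.2 (map_zero _).symm))
  subst hx
  simp

/-- If `Ext¹(Y, W) = 0`, morphisms `ker u → W` extend along `ker u ⊆ X`, for `u : X → Y`. -/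
theorem ExtZero.exists_extend {X Y W : QuiverRep s t} {u : Fam X Y} (hu : IsHom X Y u)
    (hY : ExtZero Y W) {p : Fam (kernel hu) W} (hp : IsHom (kernel hu) W p) :
    ∃ q : Fam X W, IsHom X W q ∧ ∀ i (x : LinearMap.ker (u i)), q i x = p i x := by
  choose g' hg' using fun i => LinearMap.exists_extend (p i)
  have hg'' : ∀ i (x : X.space i) (hx : x ∈ LinearMap.ker (u i)), g' i x = p i ⟨x, hx⟩ :=
    fun i x hx => LinearMap.congr_fun (hg' i) ⟨x, hx⟩
  have (a : A) := LinearMap.exists_comp_eq_of_ker_le (u (s a))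
    (W.map a ∘ₗ g' (s a) - g' (t a) ∘ₗ X.map a) fun x hx => by
      have h1 := hp a ⟨x, hx⟩
      have hx' : X.map a x ∈ LinearMap.ker (u (t a)) := by
        rw [LinearMap.mem_ker, ← hu a, hx, map_zero]
      simp only [LinearMap.sub_apply, LinearMap.comp_apply, hg'' _ x hx, hg'' _ _ hx']
      exact sub_eq_zero.2 h1
  choose c hc using this
  obtain ⟨k, hk⟩ := hY c
  refine ⟨fun i => g' i - k i ∘ₗ u i, fun a x => ?_, fun i x => ?_⟩
  · have h1 := hc a x
    rw [hk, hu a] at h1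
    simp only [LinearMap.sub_apply, LinearMap.comp_apply] at h1
    simp only [LinearMap.sub_apply, LinearMap.comp_apply, map_sub]
    linear_combination (norm := module) -h1
  · have : u i x = 0 := x.2
    simp [this, hg'' i x x.2]

/-- A property of idempotent endomorphisms which is inherited by a summand holds for an
indecomposable direct summand. -/
theorem exists_indec_summand [Fintype V] (L : QuiverRep s t) (P : Fam L L → Prop)
    (h1 : P fun _ => LinearMap.id) (h0 : ¬ P fun _ => 0)
    (hadd : ∀ e₁ e₂ e : Fam L L, IsHom L L e₁ → IsHom L L e₂ → (∀ i x, e i x = e₁ i x + e₂ i x) →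
      P e → P e₁ ∨ P e₂) :
    ∃ (K : QuiverRep s t) (ι : Fam K L) (π : Fam L K), IsIndec K ∧ IsHom K L ι ∧ IsHom L K π ∧
      (∀ i x, π i (ι i x) = x) ∧ P fun i => ι i ∘ₗ π i := by
  classical
  let S : Set (Fam L L) := {e | IsHom L L e ∧ (∀ i x, e i (e i x) = e i x) ∧ P e}
  let rk : Fam L L → ℕ := fun e => ∑ i, Module.finrank ℂ (LinearMap.range (e i))
  have hS : S.Nonempty := ⟨fun _ => LinearMap.id, fun a x => rfl, fun i x => rfl, h1⟩
  obtain ⟨e, ⟨heh, hei, heP⟩, hmin⟩ := (measure rk).wf.has_min S hS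
  replace hmin : ∀ e' ∈ S, rk e ≤ rk e' := fun e' he' => not_lt.1 (hmin e' he')
  let K := range heh
  let ι : Fam K L := fun i => (LinearMap.range (e i)).subtype
  let π : Fam L K := fun i => (e i).rangeRestrict
  have hι : IsHom K L ι := fun a x => rfl
  have hπ : IsHom L K π := fun a x => Subtype.ext (heh a x)
  have hπι : ∀ i x, π i (ι i x) = x := by
    rintro i ⟨x, y, rfl⟩
    exact Subtype.ext (hei i y)
  have hιπ : ∀ i x, ι i (π i x) = e i x := fun i x => rfl
  have full : ∀ φ : Fam K K, IsHom K K φ → (∀ i x, φ i (φ i x) = φ i x) →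
      P (fun i => ι i ∘ₗ φ i ∘ₗ π i) → ∀ i x, φ i x = x := by
    intro φ hφ hφi hP i x
    have hmem := hmin (fun i => ι i ∘ₗ φ i ∘ₗ π i)
      ⟨hι.comp (hφ.comp hπ), fun i x => by simp [hπι, hφi], hP⟩
    have hle : ∀ i, LinearMap.range (ι i ∘ₗ φ i ∘ₗ π i) ≤ LinearMap.range (e i) := by
      rintro i _ ⟨y, rfl⟩
      exact (φ i (π i y)).2
    have heq := Submodule.forall_eq_of_sum_finrank_le hle hmem i
    have hx : (ι i x) ∈ LinearMap.range (ι i ∘ₗ φ i ∘ₗ π i) := by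
      rw [heq]; exact x.2
    obtain ⟨y, hy⟩ := hx
    have hy' : φ i (π i y) = x := Subtype.ext hy
    rw [← hy', hφi]
  refine ⟨K, ι, π, ⟨?_, ?_⟩, hι, hπ, hπι, heP⟩
  · by_contra! hz
    refine h0 ?_
    have : e = fun _ => 0 := by
      funext i
      ext x
      exact congrArg Subtype.val (hz i (π i x))
    rwa [this] at heP
  · intro φ hφ hφi
    have hφ' : IsHom K K fun i => LinearMap.id - φ i := fun a x => by simp [hφ a]
    rcases hadd (fun i => ι i ∘ₗ φ i ∘ₗ π i) (fun i => ι i ∘ₗ (LinearMap.id - φ i) ∘ₗ π i) e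
      (hι.comp (hφ.comp hπ)) (hι.comp (hφ'.comp hπ)) (fun i x => by simp [hιπ]) heP with h | h
    · exact Or.inr (full φ hφ hφi h)
    · refine Or.inl fun i x => ?_
      have := full (fun i => LinearMap.id - φ i) hφ'
        (fun i x => by simp [hφi]) h i x
      simpa using this

/-- A nonzero retract of an indecomposable representation is everything. -/
theorem IsIndec.injective_of_retract {X K : QuiverRep s t} (hX : IsIndec X)
    (hK : ∃ i, ∃ x : K.space i, x ≠ 0)
    {ι : Fam K X} {q : Fam X K} (hι : IsHom K X ι) (hq : IsHom X K q)
    (h : ∀ i x, q i (ι i x) = x) (i : V) : Function.Injective (q i) := by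
  rcases hX.2 (fun i => ι i ∘ₗ q i) (hι.comp hq) (fun i x => by simp [h]) with h0 | h1
  · exfalso
    obtain ⟨i, x, hx⟩ := hK
    apply hx
    have := h0 i (ι i x)
    rw [LinearMap.comp_apply, h] at this
    rw [← h i x, this, map_zero]
  · exact fun x y hxy => by rw [← h1 i x, ← h1 i y, LinearMap.comp_apply, LinearMap.comp_apply, hxy]

/-- The differential whose kernel is `Hom(X, Y)` and whose cokernel is `Ext¹(X, Y)`. -/
@[simps]
def differential (X Y : QuiverRep s t) : Fam X Y →ₗ[ℂ] Cocycle X Y where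
  toFun g a := Y.map a ∘ₗ g (s a) - g (t a) ∘ₗ X.map a
  map_add' g g' := by
    funext a; ext x; simp only [Pi.add_apply, LinearMap.sub_apply, LinearMap.comp_apply,
      LinearMap.add_apply, map_add]; abel
  map_smul' c g := by
    funext a; ext x; simp [smul_sub]

theorem mem_ker_differential {X Y : QuiverRep s t} {φ : Fam X Y} :
    φ ∈ LinearMap.ker (differential X Y) ↔ IsHom X Y φ := by
  simp only [LinearMap.mem_ker, funext_iff, LinearMap.ext_iff]
  exact forall₂_congr fun a x => by simp [sub_eq_zero]

theorem extZero_iff_surjective {X Y : QuiverRep s t} :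
    ExtZero X Y ↔ Function.Surjective (differential X Y) := by
  refine forall_congr' fun ξ => exists_congr fun g => ?_
  simp only [funext_iff, LinearMap.ext_iff]
  exact forall₂_congr fun a x => by simp [eq_comm]

/-- The dimension vector. -/
def dimVec (X : QuiverRep s t) (i : V) : ℕ := Module.finrank ℂ (X.space i)

/-- The total dimension. -/
def totalDim [Fintype V] (X : QuiverRep s t) : ℕ := ∑ i, X.dimVec i

theorem totalDim_kernel_lt [Fintype V] {X Y : QuiverRep s t} {u : Fam X Y} (hu : IsHom X Y u)
    (h : ∃ i x, u i x ≠ 0) : (kernel hu).totalDim < X.totalDim := by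
  obtain ⟨i, x, hx⟩ := h
  refine Finset.sum_lt_sum (fun i _ => Submodule.finrank_le _) ⟨i, Finset.mem_univ i, ?_⟩
  refine Submodule.finrank_lt (fun htop => hx ?_)
  exact (SetLike.ext_iff.1 htop x).2 Submodule.mem_top

theorem totalDim_le_of_injective [Fintype V] {X Y : QuiverRep s t} {u : Fam X Y}
    (h : ∀ i, Function.Injective (u i)) : X.totalDim ≤ Y.totalDim :=
  Finset.sum_le_sum fun i _ => LinearMap.finrank_le_finrank_of_injective (h i)

theorem finrank_fam [Fintype V] (X Y : QuiverRep s t) :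
    Module.finrank ℂ (Fam X Y) = ∑ i, X.dimVec i * Y.dimVec i := by
  rw [Module.finrank_pi_fintype]
  exact Finset.sum_congr rfl fun i _ => Module.finrank_linearMap ..

theorem finrank_cocycle [Fintype A] (X Y : QuiverRep s t) :
    Module.finrank ℂ (Cocycle X Y) = ∑ a, X.dimVec (s a) * Y.dimVec (t a) := by
  rw [Module.finrank_pi_fintype]
  exact Finset.sum_congr rfl fun a _ => Module.finrank_linearMap ..

/-- `⟨dim X, dim Y⟩ ≤ dim Hom(X, Y)`, strictly unless `Ext¹(X, Y) = 0`. -/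
theorem eulerForm_add_le [Fintype V] [Fintype A] (X Y : QuiverRep s t) :
    eulerForm s t (fun i => X.dimVec i) (fun i => Y.dimVec i) ≤
      Module.finrank ℂ (LinearMap.ker (differential X Y)) ∧
    (¬ ExtZero X Y → eulerForm s t (fun i => X.dimVec i) (fun i => Y.dimVec i) + 1 ≤
      Module.finrank ℂ (LinearMap.ker (differential X Y))) := by
  have h1 := LinearMap.finrank_range_add_finrank_ker (differential X Y)
  have h2 := Submodule.finrank_le (LinearMap.range (differential X Y))
  have h3 : ¬ ExtZero X Y → Module.finrank ℂ (LinearMap.range (differential X Y)) <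
      Module.finrank ℂ (Cocycle X Y) := fun h => Submodule.finrank_lt fun htop =>
    h (extZero_iff_surjective.2 (LinearMap.range_eq_top.1 htop))
  have h4 : eulerForm s t (fun i => X.dimVec i) (fun i => Y.dimVec i) =
      (Module.finrank ℂ (Fam X Y) : ℤ) - Module.finrank ℂ (Cocycle X Y) := by
    rw [finrank_fam, finrank_cocycle, eulerForm]
    push_cast
    rfl
  refine ⟨by omega, fun h => ?_⟩
  have := h3 h
  omega

end QuiverRep

namespace QuiverRep

variable {s t : A → V}

theorem IsBrick.eq_zero_of_not_injective {X : QuiverRep s t} (hX : IsBrick X) {φ : Fam X X}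
    (hφ : IsHom X X φ) (h : ∃ i x, x ≠ 0 ∧ φ i x = 0) (i : V) (x : X.space i) : φ i x = 0 := by
  obtain ⟨c, hc⟩ := hX φ hφ
  obtain ⟨j, y, hy, hy0⟩ := h
  rw [hc, smul_eq_zero] at hy0
  rw [hc, hy0.resolve_right hy, zero_smul]

theorem isBrick_of_forall_eq_zero {X : QuiverRep s t} (hX : ∃ i, ∃ x : X.space i, x ≠ 0)
    (h : ∀ φ : Fam X X, IsHom X X φ → (∃ i x, x ≠ 0 ∧ φ i x = 0) → ∀ i x, φ i x = 0) :
    IsBrick X := fun φ hφ => by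
  obtain ⟨i, x, hx⟩ := hX
  have : Nontrivial (X.space i) := ⟨⟨x, 0, hx⟩⟩
  obtain ⟨c, hc⟩ := Module.End.exists_eigenvalue (φ i)
  obtain ⟨v, hv⟩ := hc.exists_hasEigenvector
  refine ⟨c, fun j y => ?_⟩
  have := h (fun i => φ i - c • LinearMap.id) (fun a x => by simp [hφ a])
    ⟨i, v, hv.2, by simpa [sub_eq_zero] using hv.apply_eq_smul⟩ j y
  simpa [sub_eq_zero] using this

theorem IsHom.symm {X Y : QuiverRep s t} {φ : ∀ i, X.space i ≃ₗ[ℂ] Y.space i}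
    (hφ : IsHom X Y fun i => φ i) : IsHom Y X fun i => (φ i).symm := fun a y => by
  have := hφ a ((φ (s a)).symm y)
  apply (φ (t a)).injective
  simpa using this.symm

theorem dimVec_ne_zero {X : QuiverRep s t} (hX : ∃ i, ∃ x : X.space i, x ≠ 0) :
    (fun i => (X.dimVec i : ℤ)) ≠ 0 := by
  obtain ⟨i, x, hx⟩ := hX
  have : Nontrivial (X.space i) := ⟨⟨x, 0, hx⟩⟩
  intro h
  have h1 := congrFun h i
  have h2 : 0 < X.dimVec i := Module.finrank_pos
  simp only [Pi.zero_apply] at h1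
  omega

theorem sum_finrank_range_add_ker [Fintype V] {X Y : QuiverRep s t} (φ : Fam X Y) :
    ∑ i, Module.finrank ℂ (LinearMap.range (φ i)) + ∑ i, Module.finrank ℂ (LinearMap.ker (φ i)) =
      X.totalDim := by
  rw [← Finset.sum_add_distrib]
  exact Finset.sum_congr rfl fun i _ => LinearMap.finrank_range_add_finrank_ker (φ i)

theorem IsIndec.eq_zero_of_range_comp_self {X : QuiverRep s t} (hX : IsIndec X) {θ : Fam X X}
    (hθ : IsHom X X θ) (hinj : ∃ i x, x ≠ 0 ∧ θ i x = 0)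
    (h : ∀ i, LinearMap.range (θ i ∘ₗ θ i) = LinearMap.range (θ i)) (i : V) (x : X.space i) :
    θ i x = 0 := by
  by_contra hx
  let R := QuiverRep.range hθ
  let ι : Fam R X := fun i => (LinearMap.range (θ i)).subtype
  let p : Fam X R := fun i => (θ i).rangeRestrict
  have hι : IsHom R X ι := fun a x => rfl
  have hp : IsHom X R p := fun a x => Subtype.ext (hθ a x)
  have hsurj : ∀ i, Function.Surjective (p i ∘ₗ ι i) := by
    rintro i ⟨y, hy⟩
    obtain ⟨z, hz⟩ := (h i).ge hy
    exact ⟨⟨θ i z, LinearMap.mem_range_self _ _⟩, Subtype.ext hz⟩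
  let β : ∀ i, R.space i ≃ₗ[ℂ] R.space i := fun i => LinearEquiv.ofBijective (p i ∘ₗ ι i)
    ⟨LinearMap.injective_iff_surjective.2 (hsurj i), hsurj i⟩
  have hβ : IsHom R R fun i => β i := hp.comp hι
  have hret := hX.injective_of_retract (K := R) ⟨i, p i x, fun h0 => hx (congrArg Subtype.val h0)⟩
    hι (hβ.symm.comp hp) fun i x => (β i).symm_apply_apply x
  obtain ⟨j, y, hy, hy0⟩ := hinj
  refine hy (hret j ?_)
  have : p j y = 0 := Subtype.ext hy0
  simp [this]

/-- Ringel's lemma: a non-invertible endomorphism of an indecomposable representation vanishes if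
the smaller indecomposable representations have no self-extensions. -/
theorem IsIndec.eq_zero_of_not_injective [Fintype V] {X : QuiverRep s t} (hX : IsIndec X)
    (hsmall : ∀ K : QuiverRep s t, IsIndec K → K.totalDim < X.totalDim → ExtZero K K)
    {φ : Fam X X} (hφ : IsHom X X φ) (hinj : ∃ i x, x ≠ 0 ∧ φ i x = 0) (i : V) (x : X.space i) :
    φ i x = 0 := by
  classical
  by_contra hx
  let S : Set (Fam X X) :=
    {θ | IsHom X X θ ∧ (∃ i x, x ≠ 0 ∧ θ i x = 0) ∧ ∃ i x, θ i x ≠ 0}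
  let rk : Fam X X → ℕ := fun e => ∑ i, Module.finrank ℂ (LinearMap.range (e i))
  obtain ⟨θ, ⟨hθ, ⟨j, y, hy, hy0⟩, hne⟩, hmin⟩ :=
    (measure rk).wf.has_min S ⟨φ, hφ, hinj, i, x, hx⟩
  replace hmin : ∀ e' ∈ S, rk θ ≤ rk e' := fun e' he' => not_lt.1 (hmin e' he')
  have hsq : ∀ i x, θ i (θ i x) = 0 := by
    by_contra! hsq
    obtain ⟨k, z, hz⟩ := hsq
    have h1 := hmin (fun i => θ i ∘ₗ θ i) ⟨hθ.comp hθ, ⟨j, y, hy, by simp [hy0]⟩, k, z, hz⟩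
    have h2 := hX.eq_zero_of_range_comp_self hθ ⟨j, y, hy, hy0⟩
      (Submodule.forall_eq_of_sum_finrank_le (fun i => LinearMap.range_comp_le_range _ _) h1)
    exact hz (h2 k _)
  let L := kernel hθ
  let j : Fam L X := fun i => (LinearMap.ker (θ i)).subtype
  have hj : IsHom L X j := fun a x => rfl
  let u : Fam X L := fun i => (θ i).codRestrict _ (hsq i)
  have hu : IsHom X L u := fun a x => Subtype.ext (hθ a x)
  obtain ⟨K, ι, π, hK, hι, hπ, hπι, k, z, hz⟩ := exists_indec_summand L
    (fun e => ∃ i x, e i (u i x) ≠ 0) (by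
      obtain ⟨k, z, hz⟩ := hne
      exact ⟨k, z, fun h => hz (congrArg Subtype.val h)⟩)
    (by simp) (by
      rintro e₁ e₂ e - - he ⟨k, z, hz⟩
      by_contra! h
      exact hz (by rw [he, h.1, h.2, add_zero]))
  have hv : IsHom X K fun i => π i ∘ₗ u i := hπ.comp hu
  have hker : ∀ i, LinearMap.ker (θ i) ≤ LinearMap.ker (π i ∘ₗ u i) := fun i x hx => by
    have : u i x = 0 := Subtype.ext hx
    rw [LinearMap.mem_ker, LinearMap.comp_apply, this, map_zero]
  have hinjv : ∀ i x, (j i) (ι i x) = 0 → x = 0 := fun i x h0 => by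
    have h1 : ι i x = 0 := Subtype.ext h0
    rw [← hπι i x, h1, map_zero]
  have hker' : ∀ i, LinearMap.ker (θ i) = LinearMap.ker (π i ∘ₗ u i) := by
    refine Submodule.forall_eq_of_sum_finrank_le hker ?_
    have h1 := hmin (fun i => j i ∘ₗ ι i ∘ₗ π i ∘ₗ u i) ⟨hj.comp (hι.comp hv),
      ⟨_, y, hy, by rw [LinearMap.comp_apply, LinearMap.comp_apply, hker _ hy0, map_zero,
        map_zero]⟩,
      k, z, fun h0 => hz (Subtype.ext h0)⟩
    have h2 := sum_finrank_range_add_ker θ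
    have h3 := sum_finrank_range_add_ker fun i => j i ∘ₗ ι i ∘ₗ π i ∘ₗ u i
    have h4 : ∀ i, LinearMap.ker (j i ∘ₗ ι i ∘ₗ π i ∘ₗ u i) = LinearMap.ker (π i ∘ₗ u i) := by
      intro i
      ext x
      exact ⟨fun h => hinjv _ _ h, fun h => by
        rw [LinearMap.mem_ker, LinearMap.comp_apply, LinearMap.comp_apply, h, map_zero, map_zero]⟩
    have h5 : ∑ i, Module.finrank ℂ (LinearMap.ker (π i ∘ₗ u i)) =
        ∑ i, Module.finrank ℂ (LinearMap.ker (j i ∘ₗ ι i ∘ₗ π i ∘ₗ u i)) :=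
      Finset.sum_congr rfl fun i _ => (LinearEquiv.ofEq _ _ (h4 i)).symm.finrank_eq
    change ∑ i, Module.finrank ℂ (LinearMap.range (θ i)) ≤
      ∑ i, Module.finrank ℂ (LinearMap.range (j i ∘ₗ ι i ∘ₗ π i ∘ₗ u i)) at h1
    omega
  have hKL : K.totalDim < X.totalDim :=
    (totalDim_le_of_injective fun i => Function.LeftInverse.injective (hπι i)).trans_lt
      (totalDim_kernel_lt hθ hne)
  let p : Fam (kernel hv) K := fun i => π i ∘ₗ Submodule.inclusion (hker' i).ge
  have hp : IsHom (kernel hv) K p := fun a x => hπ a ⟨x.1, (hker' _).ge x.2⟩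
  obtain ⟨q, hq, hqp⟩ := ExtZero.exists_extend hv (hsmall K hK hKL) hp
  have hret := hX.injective_of_retract hK.1 (hj.comp hι) hq fun i x =>
    (hqp i ⟨j i (ι i x), hker i (ι i x).2⟩).trans (hπι i x)
  exact hKL.not_ge (totalDim_le_of_injective hret)

theorem IsBrick.finrank_le_one [Fintype V] {X : QuiverRep s t} (hX : IsBrick X) :
    Module.finrank ℂ (LinearMap.ker (differential X X)) ≤ 1 := by
  refine _root_.finrank_le_one ⟨fun _ => LinearMap.id, mem_ker_differential.2 fun a x => rfl⟩ ?_
  rintro ⟨φ, hφ⟩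
  obtain ⟨c, hc⟩ := hX φ (mem_ker_differential.1 hφ)
  refine ⟨c, Subtype.ext ?_⟩
  funext i
  ext x
  simp [hc i x]

theorem IsBrick.extZero [Fintype V] [Fintype A] {X : QuiverRep s t} (hQ : IsDynkin s t)
    (hX : IsBrick X) (h0 : ∃ i, ∃ x : X.space i, x ≠ 0) : ExtZero X X := by
  by_contra h
  have h1 := (eulerForm_add_le X X).2 h
  have h2 := hQ _ (dimVec_ne_zero h0)
  have h3 := hX.finrank_le_one
  omega

/-- Indecomposable representations of Dynkin quivers are bricks. -/
theorem IsIndec.isBrick [Fintype V] [Fintype A] (hQ : IsDynkin s t)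
    {X : QuiverRep s t} (hX : IsIndec X) : IsBrick X := by
  induction h : X.totalDim using Nat.strong_induction_on generalizing X with
  | _ n ih =>
    subst h
    exact isBrick_of_forall_eq_zero hX.1 fun φ hφ hinj => hX.eq_zero_of_not_injective
      (fun K hK hlt => (ih _ hlt hK rfl).extZero hQ hK.1) hφ hinj

/-- For a Dynkin quiver, there are no nontrivial extensions in both directions between two
indecomposable representations. -/
theorem IsIndec.extZero_or_extZero [Fintype V] [Fintype A] (hQ : IsDynkin s t)
    {X Y : QuiverRep s t} (hX : IsIndec X) (hY : IsIndec Y) : ExtZero X Y ∨ ExtZero Y X := by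
  induction h : X.totalDim + Y.totalDim using Nat.strong_induction_on generalizing X Y with
  | _ n ih =>
  subst h
  have key : ∀ {X Y : QuiverRep s t}, IsIndec X → IsIndec Y →
      (∀ K : QuiverRep s t, IsIndec K → K.totalDim < X.totalDim → ExtZero K Y ∨ ExtZero Y K) →
      ∀ u : Fam X Y, IsHom X Y u → (∃ i x, u i x ≠ 0) → ExtZero X Y := by
    intro X Y hX hY ih u hu hne
    by_contra hXY
    have hYY := (hY.isBrick hQ).extZero hQ hY.1
    have hL : ¬ ExtZero (kernel hu) Y := fun h => hXY (ExtZero.of_kernel hu hYY h)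
    obtain ⟨K, ι, π, hK, hι, hπ, hπι, hP⟩ := exists_indec_summand (kernel hu)
      (fun e => ¬ ∀ ξ : Cocycle (kernel hu) Y,
        IsCoboundary (kernel hu) Y fun a => ξ a ∘ₗ e (s a)) hL
      (fun h => h fun ξ => ⟨fun _ => 0, fun a x => by simp⟩) (by
        intro e₁ e₂ e h₁ h₂ he h
        by_contra! h'
        refine h fun ξ => ?_
        obtain ⟨g₁, hg₁⟩ := h'.1 ξ
        obtain ⟨g₂, hg₂⟩ := h'.2 ξ
        refine ⟨fun i => g₁ i + g₂ i, fun a x => ?_⟩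
        have h3 := hg₁ a x
        have h4 := hg₂ a x
        simp only [LinearMap.comp_apply] at h3 h4
        simp only [LinearMap.comp_apply, he, map_add, h3, h4, LinearMap.add_apply]
        abel)
    have hKY : ¬ ExtZero K Y := by
      intro h
      refine hP fun ξ => ?_
      obtain ⟨g, hg⟩ := h fun a => ξ a ∘ₗ ι (s a)
      refine ⟨fun i => g i ∘ₗ π i, fun a x => ?_⟩
      have := hg a (π (s a) x)
      simp only [LinearMap.comp_apply] at this
      simp only [LinearMap.comp_apply, this, hπ a]
    have hlt : K.totalDim < X.totalDim :=
      (totalDim_le_of_injective fun i => Function.LeftInverse.injective (hπι i)).trans_lt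
        (totalDim_kernel_lt hu hne)
    obtain ⟨q, hq, hqπ⟩ := ExtZero.exists_extend hu ((ih K hK hlt).resolve_left hKY) hπ
    have hj : IsHom (kernel hu) X fun i => (LinearMap.ker (u i)).subtype := fun a x => rfl
    have hret := hX.injective_of_retract hK.1 (hj.comp hι) hq fun i x =>
      (hqπ i (ι i x)).trans (hπι i x)
    exact hlt.not_ge (totalDim_le_of_injective hret)
  by_cases h1 : ∃ u : Fam X Y, IsHom X Y u ∧ ∃ i x, u i x ≠ 0
  · obtain ⟨u, hu, hne⟩ := h1
    exact Or.inl (key hX hY (fun K hK hlt => ih _ (by omega) hK hY rfl) u hu hne)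
  by_cases h2 : ∃ u : Fam Y X, IsHom Y X u ∧ ∃ i x, u i x ≠ 0
  · obtain ⟨u, hu, hne⟩ := h2
    exact Or.inr (key hY hX (fun K hK hlt => (ih _ (by omega) hK hX rfl)) u hu hne)
  by_contra! h
  have hzero : ∀ {X Y : QuiverRep s t}, (¬ ∃ u : Fam X Y, IsHom X Y u ∧ ∃ i x, u i x ≠ 0) →
      Module.finrank ℂ (LinearMap.ker (differential X Y)) = 0 := by
    intro X Y h
    rw [Submodule.finrank_eq_zero, Submodule.eq_bot_iff]
    intro u hu
    by_contra hne
    refine h ⟨u, mem_ker_differential.1 hu, ?_⟩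
    by_contra! h0
    exact hne (funext fun i => LinearMap.ext (h0 i))
  have e1 := (eulerForm_add_le X X).1
  have e2 := (eulerForm_add_le Y Y).1
  have e3 := (eulerForm_add_le X Y).2 h.1
  have e4 := (eulerForm_add_le Y X).2 h.2
  rw [hzero h1] at e3
  rw [hzero h2] at e4
  have e5 := (hX.isBrick hQ).finrank_le_one
  have e6 := (hY.isBrick hQ).finrank_le_one
  have e7 := hQ ((fun i => (X.dimVec i : ℤ)) + fun i => (Y.dimVec i : ℤ)) (by
    intro h0
    refine dimVec_ne_zero hX.1 (funext fun i => ?_)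
    have := congrFun h0 i
    simp only [Pi.add_apply, Pi.zero_apply] at this ⊢
    omega)
  have e8 : eulerForm s t ((fun i => (X.dimVec i : ℤ)) + fun i => (Y.dimVec i : ℤ))
      ((fun i => (X.dimVec i : ℤ)) + fun i => (Y.dimVec i : ℤ)) =
      eulerForm s t (fun i => X.dimVec i) (fun i => X.dimVec i) +
      eulerForm s t (fun i => X.dimVec i) (fun i => Y.dimVec i) +
      eulerForm s t (fun i => Y.dimVec i) (fun i => X.dimVec i) +
      eulerForm s t (fun i => Y.dimVec i) (fun i => Y.dimVec i) := by
    simp only [eulerForm, Pi.add_apply, add_mul, mul_add, Finset.sum_add_distrib]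
    ring
  omega

end QuiverRep

namespace QuiverRep

variable {s t : A → V} {M T : QuiverRep s t} {ε : Cocycle M T}

/-- The cocycle `ε` defines an almost split sequence `0 → T → E → M → 0`. -/
structure IsAlmostSplitCocycle (M T : QuiverRep s t) (ε : Cocycle M T) : Prop where
  not_isCoboundary : ¬ IsCoboundary M T ε
  split_or_isCoboundary : ∀ (X : QuiverRep s t) (h : Fam X M), IsHom X M h →
    (∃ r : Fam M X, IsHom M X r ∧ ∀ i x, h i (r i x) = x) ∨
      IsCoboundary X T fun a => ε a ∘ₗ h (s a)

theorem isHom_extension_snd (X Y : QuiverRep s t) (ξ : Cocycle X Y) :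
    IsHom (extension X Y ξ) X fun _ => LinearMap.snd ℂ _ _ := fun _ _ => rfl

/-- Families of maps out of an extension, in components. -/
theorem exists_extension_components {X Y Z : QuiverRep s t} {ξ : Cocycle X Y}
    (w : Fam (extension X Y ξ) Z) : ∃ (u : Fam Y Z) (v : Fam X Z),
      (∀ i y x, w i (y, x) = u i y + v i x) ∧ ∀ a y x,
        Z.map a (w (s a) (y, x)) - w (t a) ((extension X Y ξ).map a (y, x)) =
        (Z.map a (u (s a) y) - u (t a) (Y.map a y)) +
          (Z.map a (v (s a) x) - v (t a) (X.map a x) - u (t a) (ξ a x)) := by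
  have hw : ∀ i, ∃ (u : Y.space i →ₗ[ℂ] Z.space i) (v : X.space i →ₗ[ℂ] Z.space i),
      ∀ y x, w i (y, x) = u y + v x := fun i =>
    ⟨w i ∘ₗ LinearMap.inl ℂ _ _, w i ∘ₗ LinearMap.inr ℂ _ _, fun y x => by
      change w i (y, x) = w i (y, 0) + w i (0, x)
      refine Eq.trans (congrArg (w i) ?_) ((w i).map_add (y, 0) (0, x))
      exact Prod.ext (add_zero y).symm (zero_add x).symm⟩
  choose u v huv using hw
  refine ⟨u, v, huv, fun a y x => ?_⟩
  have h1 : w (t a) ((extension X Y ξ).map a (y, x)) =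
    u (t a) (Y.map a y + ξ a x) + v (t a) (X.map a x) := huv _ _ _
  rw [h1, huv, map_add, map_add]
  abel

namespace IsAlmostSplitCocycle

/-- The almost split property applied to the extension of `M` defined by `ξ`. -/
theorem isCoboundary_or_exists (hε : IsAlmostSplitCocycle M T ε) {Y : QuiverRep s t}
    (ξ : Cocycle M Y) : IsCoboundary M Y ξ ∨ ∃ (u : Fam Y T) (v : Fam M T), IsHom Y T u ∧
      ∀ a x, ε a x = T.map a (v (s a) x) - v (t a) (M.map a x) - u (t a) (ξ a x) := by
  rcases hε.split_or_isCoboundary (extension M Y ξ) _ (isHom_extension_snd M Y ξ) with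
    ⟨r, hr, hr1⟩ | ⟨w, hw⟩
  · refine Or.inl ⟨fun i => -(LinearMap.fst ℂ _ _ ∘ₗ r i), fun a x => ?_⟩
    have h1 : Y.map a (r (s a) x).1 + ξ a (r (s a) x).2 = (r (t a) (M.map a x)).1 :=
      congrArg Prod.fst (hr a x)
    have h2 : (r (s a) x).2 = x := hr1 _ _
    rw [h2] at h1
    change ξ a x = Y.map a (-(r (s a) x).1) - (-(r (t a) (M.map a x)).1)
    rw [← h1, map_neg]
    abel
  · obtain ⟨u, v, -, huv⟩ := exists_extension_components w
    have hw' : ∀ a y x, ε a x = (T.map a (u (s a) y) - u (t a) (Y.map a y)) +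
          (T.map a (v (s a) x) - v (t a) (M.map a x) - u (t a) (ξ a x)) := fun a y x =>
      (hw a (y, x)).trans (huv a y x)
    refine Or.inr ⟨u, v, fun a y => ?_, fun a x => ?_⟩
    · have := hw' a y 0
      simp only [map_zero, sub_zero, add_zero] at this
      exact sub_eq_zero.1 this.symm
    · have := hw' a 0 x
      simpa only [map_zero, sub_zero, zero_add] using this

theorem exists_hom_right (hε : IsAlmostSplitCocycle M T ε) {Y : QuiverRep s t}
    (hY : ¬ ExtZero M Y) : ∃ w : Fam Y T, IsHom Y T w ∧ ∃ i y, w i y ≠ 0 := by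
  simp only [ExtZero, not_forall] at hY
  obtain ⟨ξ, hξ⟩ := hY
  obtain ⟨u, v, hu, h⟩ := (hε.isCoboundary_or_exists ξ).resolve_left hξ
  refine ⟨u, hu, ?_⟩
  by_contra! h0
  exact hε.not_isCoboundary ⟨v, fun a x => by rw [h, h0, sub_zero]⟩

theorem exists_hom_left (hε : IsAlmostSplitCocycle M T ε) (hT : IsBrick T) {N : QuiverRep s t}
    (hN : ¬ ExtZero N T) : ∃ w : Fam M N, IsHom M N w ∧ ∃ i x, w i x ≠ 0 := by
  simp only [ExtZero, not_forall] at hN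
  obtain ⟨ξ, hξ⟩ := hN
  rcases hε.isCoboundary_or_exists (Y := extension N T ξ) fun a =>
    LinearMap.inl ℂ (T.space (t a)) (N.space (t a)) ∘ₗ ε a with ⟨g, hg⟩ | ⟨w, v, hw, h⟩
  · have h1 : ∀ a x, ε a x = (T.map a (g (s a) x).1 + ξ a (g (s a) x).2) -
        (g (t a) (M.map a x)).1 := fun a x => congrArg Prod.fst (hg a x)
    have h2 : ∀ a x, 0 = N.map a (g (s a) x).2 - (g (t a) (M.map a x)).2 :=
      fun a x => congrArg Prod.snd (hg a x)
    refine ⟨fun i => LinearMap.snd ℂ _ _ ∘ₗ g i, fun a x => sub_eq_zero.1 (h2 a x).symm, ?_⟩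
    by_contra! h0
    refine hε.not_isCoboundary ⟨fun i => LinearMap.fst ℂ _ _ ∘ₗ g i, fun a x => ?_⟩
    have h3 : (g (s a) x).2 = 0 := h0 _ _
    rw [h1, h3, map_zero, add_zero]
    rfl
  · exfalso
    obtain ⟨u, v', hw1, huv⟩ := exists_extension_components w
    have hw' : ∀ a y x, (T.map a (u (s a) y) - u (t a) (T.map a y)) +
          (T.map a (v' (s a) x) - v' (t a) (N.map a x) - u (t a) (ξ a x)) = 0 := fun a y x =>
      (huv a y x).symm.trans (sub_eq_zero.2 (hw a (y, x)))
    obtain ⟨c, hc⟩ := hT u fun a y => by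
      have := hw' a y 0
      simp only [map_zero, sub_zero, add_zero] at this
      exact sub_eq_zero.1 this
    have hcξ : ∀ a x, c • ξ a x = T.map a (v' (s a) x) - v' (t a) (N.map a x) := fun a x => by
      have := hw' a 0 x
      simp only [map_zero, sub_zero, zero_add] at this
      rw [hc] at this
      exact (sub_eq_zero.1 this).symm
    have hc0 : c = 0 := by
      by_contra hc0
      refine hξ ⟨fun i => c⁻¹ • v' i, fun a x => ?_⟩
      simp only [LinearMap.smul_apply, map_smul]
      rw [← smul_sub, ← hcξ, smul_smul, inv_mul_cancel₀ hc0, one_smul]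
    refine hε.not_isCoboundary ⟨v, fun a x => ?_⟩
    have h1 : w (t a) (ε a x, 0) = 0 := by
      rw [hw1, hc, hc0, zero_smul, map_zero, add_zero]
    exact (h a x).trans ((congrArg _ h1).trans (sub_zero _))

theorem hom_eq_zero (hε : IsAlmostSplitCocycle M T ε) (hT : IsBrick T) (hM : ExtZero M M)
    {h : Fam M T} (hh : IsHom M T h) (i : V) (x : M.space i) : h i x = 0 := by
  by_contra hx
  have hstable : ∀ a, ∀ x ∈ LinearMap.range (h (s a)), T.map a x ∈ LinearMap.range (h (t a)) := by
    rintro a _ ⟨x, rfl⟩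
    exact ⟨M.map a x, (hh a x).symm⟩
  let Y := T.quotient (fun i => LinearMap.range (h i)) hstable
  let k : Fam T Y := fun i => (LinearMap.range (h i)).mkQ
  have hk : IsHom T Y k := fun a x => rfl
  have hkcob : IsCoboundary M Y fun a => k (t a) ∘ₗ ε a := by
    refine (hε.isCoboundary_or_exists _).resolve_right ?_
    rintro ⟨u, v, hu, huv⟩
    have h0 := hT.eq_zero_of_not_injective (hu.comp hk) ⟨i, h i x, hx, by
      have : k i (h i x) = 0 := (Submodule.Quotient.mk_eq_zero _).2 ⟨x, rfl⟩
      rw [LinearMap.comp_apply, this, map_zero]⟩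
    exact hε.not_isCoboundary ⟨v, fun a x =>
      (huv a x).trans ((congrArg _ (h0 (t a) (ε a x))).trans (sub_zero _))⟩
  obtain ⟨v, hv⟩ := hkcob
  have (i : V) := LinearMap.exists_comp_eq_of_mem_range (k i) (v i)
    fun w => Submodule.mkQ_surjective _ _
  choose v' hv' using this
  have (a : A) := LinearMap.exists_comp_eq_of_mem_range (h (t a))
    (ε a - (T.map a ∘ₗ v' (s a) - v' (t a) ∘ₗ M.map a)) fun w => by
      refine (Submodule.Quotient.mk_eq_zero (LinearMap.range (h (t a)))).1 ?_
      change k (t a) _ = 0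
      have := hv a w
      simp only [LinearMap.comp_apply] at this
      simp only [LinearMap.sub_apply, LinearMap.comp_apply, map_sub, this, ← hk a, hv', sub_self]
  choose c hc using this
  obtain ⟨g, hg⟩ := hM c
  refine hε.not_isCoboundary ⟨fun i => v' i + h i ∘ₗ g i, fun a x => ?_⟩
  have h1 := hc a x
  rw [hg, map_sub, ← hh] at h1
  simp only [LinearMap.sub_apply, LinearMap.comp_apply] at h1
  simp only [LinearMap.add_apply, LinearMap.comp_apply, map_add]
  linear_combination (norm := module) -h1

/-- If `0 → T → E → M → 0` is almost split over a Dynkin quiver, then `Ext¹(N, (M ⊕ T) / N) = 0`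
for every subrepresentation `N` of `M ⊕ T` whose dimension vector differs from that of `M`. -/
theorem extZero_subrep_quotient [Fintype V] [Fintype A] (hQ : IsDynkin s t)
    (hε : IsAlmostSplitCocycle M T ε) (hM : IsIndec M) (hT : IsIndec T) {D : QuiverRep s t}
    {iM : Fam M D} {iT : Fam T D} {pM : Fam D M} {pT : Fam D T} (hiM : IsHom M D iM)
    (hiT : IsHom T D iT) (hpM : IsHom D M pM) (hpT : IsHom D T pT)
    (hMM : ∀ i x, pM i (iM i x) = x) (hsum : ∀ i x, iM i (pM i x) + iT i (pT i x) = x)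
    (N : ∀ i, Submodule ℂ (D.space i)) (hN : ∀ a, ∀ x ∈ N (s a), D.map a x ∈ N (t a))
    (hdim : ∃ i, Module.finrank ℂ (N i) ≠ Module.finrank ℂ (M.space i)) :
    ExtZero (D.subrep N hN) (D.quotient N hN) := by
  have hMb := hM.isBrick hQ
  have hTb := hT.isBrick hQ
  have hMrig := hMb.extZero hQ hM.1
  let j : Fam (D.subrep N hN) D := fun i => (N i).subtype
  have hj : IsHom (D.subrep N hN) D j := fun a x => rfl
  let k : Fam D (D.quotient N hN) := fun i => (N i).mkQ
  have hk : IsHom D (D.quotient N hN) k := fun a x => rfl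
  by_cases hex : ∃ w : Fam M (D.subrep N hN), IsHom M (D.subrep N hN) w ∧ ∃ i x, w i x ≠ 0
  · obtain ⟨w, hw, i₀, x₀, hx₀⟩ := hex
    obtain ⟨c, hc⟩ := hMb _ (hpM.comp (hj.comp hw))
    have hz := hε.hom_eq_zero hTb hMrig (hpT.comp (hj.comp hw))
    have hwc : ∀ i x, j i (w i x) = c • iM i x := fun i x => by
      have h1 := hc i x
      have h2 := hz i x
      simp only [LinearMap.comp_apply] at h1 h2
      rw [← hsum i (j i (w i x)), h1, h2, map_zero, add_zero, map_smul]
    have hc0 : c ≠ 0 := by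
      rintro rfl
      exact hx₀ (Subtype.ext ((hwc i₀ x₀).trans (zero_smul _ _)))
    have hMN : ∀ i x, iM i x ∈ N i := fun i x => by
      have : iM i x = c⁻¹ • j i (w i x) := by
        rw [hwc, smul_smul, inv_mul_cancel₀ hc0, one_smul]
      rw [this]
      exact (N i).smul_mem _ (w i x).2
    have hq := hk.comp hiT
    have hqs : ∀ i, Function.Surjective (k i ∘ₗ iT i) := fun i y => by
      obtain ⟨x, rfl⟩ := Submodule.mkQ_surjective _ y
      refine ⟨pT i x, ?_⟩
      have : k i (iM i (pM i x)) = 0 := (Submodule.Quotient.mk_eq_zero _).2 (hMN i _)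
      change k i (iT i (pT i x)) = k i x
      conv_rhs => rw [← hsum i x]
      rw [map_add, this, zero_add]
    refine ExtZero.of_kernel (hpM.comp hj) ?_ (ExtZero.of_surjective ?_ hq hqs)
    · by_contra hMQ
      obtain ⟨v, hv, i₁, y₁, hy₁⟩ := hε.exists_hom_right hMQ
      have hinj : ∀ i x, k i (iT i x) = 0 → x = 0 := fun i x hx => by
        by_contra hx0
        obtain ⟨z, rfl⟩ := hqs i₁ y₁
        exact hy₁ (hTb.eq_zero_of_not_injective (hv.comp hq) ⟨i, x, hx0, by
          simp only [LinearMap.comp_apply, hx, map_zero]⟩ i₁ z)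
      obtain ⟨i, hi⟩ := hdim
      refine hi (LinearEquiv.finrank_eq (LinearEquiv.ofBijective (pM i ∘ₗ j i) ⟨?_, ?_⟩))
      · refine (injective_iff_map_eq_zero _).2 fun x hx => Subtype.ext ?_
        have hx' : pM i x.1 = 0 := hx
        have h1 := hsum i x.1
        rw [hx', map_zero, zero_add] at h1
        have h2 : k i (iT i (pT i x.1)) = 0 := by
          rw [h1]
          exact (Submodule.Quotient.mk_eq_zero _).2 x.2
        rw [← h1, hinj i _ h2, map_zero]
        rfl
      · exact fun x => ⟨⟨iM i x, hMN i x⟩, hMM i x⟩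
    · by_contra hKT
      obtain ⟨v, hv, i₁, x₁, hx₁⟩ := hε.exists_hom_left hTb hKT
      have hl : IsHom (kernel (hpM.comp hj)) (D.subrep N hN)
        fun i => (LinearMap.ker (pM i ∘ₗ j i)).subtype := fun a x => rfl
      have h0 := hε.hom_eq_zero hTb hMrig (hpT.comp (hj.comp (hl.comp hv))) i₁ x₁
      refine hx₁ (Subtype.ext (Subtype.ext ?_))
      have h1 := hsum i₁ (v i₁ x₁).1.1
      have h2 : pM i₁ (v i₁ x₁).1.1 = 0 := (v i₁ x₁).2
      have h3 : pT i₁ (v i₁ x₁).1.1 = 0 := h0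
      rw [h2, h3, map_zero, map_zero, add_zero] at h1
      exact h1.symm
  · have hNT : ExtZero (D.subrep N hN) T := by
      by_contra h
      exact hex (hε.exists_hom_left hTb h)
    have hTM : ExtZero T M := (hM.extZero_or_extZero hQ hT).resolve_left
      fun h => hε.not_isCoboundary (h ε)
    have hl : IsHom (kernel hpM) D fun i => (LinearMap.ker (pM i)).subtype := fun a x => rfl
    have hDM : ExtZero D M := ExtZero.of_kernel hpM hMrig <|
      ExtZero.of_injective (hpT.comp hl) (fun i => (injective_iff_map_eq_zero _).2 fun x hx => by
        have h1 := hsum i x.1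
        have h2 : pM i x.1 = 0 := x.2
        have h3 : pT i x.1 = 0 := hx
        rw [h2, h3, map_zero, map_zero, add_zero] at h1
        exact Subtype.ext h1.symm) hTM
    have hNM : ExtZero (D.subrep N hN) M :=
      ExtZero.of_injective hj (fun i => Subtype.val_injective) hDM
    refine ExtZero.of_surjective (Y := D) (fun ξ => ?_) hk fun i => Submodule.mkQ_surjective _
    obtain ⟨g, hg⟩ := hNM fun a => pM (t a) ∘ₗ ξ a
    obtain ⟨g', hg'⟩ := hNT fun a => pT (t a) ∘ₗ ξ a
    refine ⟨fun i => iM i ∘ₗ g i + iT i ∘ₗ g' i, fun a x => ?_⟩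
    have h1 := hg a x
    have h2 := hg' a x
    simp only [LinearMap.comp_apply] at h1 h2
    rw [← hsum _ (ξ a x), h1, h2]
    simp only [LinearMap.add_apply, LinearMap.comp_apply, map_add, map_sub, ← hiM a, ← hiT a]
    have h3 : ∀ y, D.map a (iM (s a) y) = iM (t a) (M.map a y) := hiM a
    have h4 : ∀ y, D.map a (iT (s a) y) = iT (t a) (T.map a y) := hiT a
    abel

end IsAlmostSplitCocycle

end QuiverRep

namespace QuiverRep

variable {s t : A → V}

/-- The representation on coordinate spaces given by matrices. -/
abbrev ofMatrix {d : V → ℕ} (X : QRep s t d) : QuiverRep s t where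
  space i := Fin (d i) → ℂ
  map a := (X a).mulVecLin

theorem isHom_ofMatrix {d d' : V → ℕ} {X : QRep s t d} {Y : QRep s t d'}
    {φ : ∀ i, Matrix (Fin (d' i)) (Fin (d i)) ℂ} (h : ∀ a, Y a * φ (s a) = φ (t a) * X a) :
    IsHom (ofMatrix X) (ofMatrix Y) fun i => (φ i).mulVecLin := fun a x => by
  change Y a *ᵥ (φ (s a) *ᵥ x) = φ (t a) *ᵥ (X a *ᵥ x)
  rw [Matrix.mulVec_mulVec, Matrix.mulVec_mulVec, h]

theorem IsHom.toMatrix_comm {d d' : V → ℕ} {X : QRep s t d} {Y : QRep s t d'}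
    {φ : Fam (ofMatrix X) (ofMatrix Y)} (hφ : IsHom (ofMatrix X) (ofMatrix Y) φ) (a : A) :
    Y a * LinearMap.toMatrix' (φ (s a)) = LinearMap.toMatrix' (φ (t a)) * X a :=
  Matrix.mulVec_injective (funext fun x => by
    rw [← Matrix.mulVec_mulVec, ← Matrix.mulVec_mulVec, LinearMap.toMatrix'_mulVec,
      LinearMap.toMatrix'_mulVec]
    exact hφ a x)

theorem isIndec_ofMatrix {d : V → ℕ} {X : QRep s t d} (hX : Indec s t X) :
    IsIndec (ofMatrix X) := by
  refine ⟨?_, fun φ hφ hidem => ?_⟩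
  · obtain ⟨i, hi⟩ := hX.1
    exact ⟨i, (fun _ => 1 : Fin (d i) → ℂ), fun h => one_ne_zero (congrFun h ⟨0, hi⟩)⟩
  · have h1 : (∀ i, LinearMap.toMatrix' (φ i) = 0) ∨ ∀ i, LinearMap.toMatrix' (φ i) = 1 :=
      hX.2 ⟨fun i => LinearMap.toMatrix' (φ i), hφ.toMatrix_comm⟩ fun i =>
        Matrix.mulVec_injective (funext fun x => by
          simpa only [← Matrix.mulVec_mulVec, LinearMap.toMatrix'_mulVec] using hidem i x)
    refine h1.imp (fun h i x => ?_) (fun h i x => ?_)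
    · rw [← LinearMap.toMatrix'_mulVec, h, Matrix.zero_mulVec]
    · rw [← LinearMap.toMatrix'_mulVec, h, Matrix.one_mulVec]

theorem exists_equiv_ofMatrix (X : QuiverRep s t) :
    ∃ (d : V → ℕ) (Y : QRep s t d) (φ : ∀ i, X.space i ≃ₗ[ℂ] (ofMatrix Y).space i),
      IsHom X (ofMatrix Y) fun i => φ i := by
  let φ : ∀ i, X.space i ≃ₗ[ℂ] (Fin (X.dimVec i) → ℂ) := fun i =>
    (Module.finBasis ℂ (X.space i)).equivFun
  refine ⟨X.dimVec, fun a => LinearMap.toMatrix' ((φ (t a)).toLinearMap ∘ₗ X.map a ∘ₗ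
    (φ (s a)).symm.toLinearMap), φ, fun a x => ?_⟩
  change LinearMap.toMatrix' _ *ᵥ (φ (s a) x) = φ (t a) (X.map a x)
  rw [LinearMap.toMatrix'_mulVec]
  simp

theorem exists_isAlmostSplitCocycle_of_exact {T E M : QuiverRep s t} {F : Fam T E} {G : Fam E M}
    (hF : IsHom T E F) (hG : IsHom E M G) (hinj : ∀ i, Function.Injective (F i))
    (hsurj : ∀ i, Function.Surjective (G i))
    (hFG : ∀ i, LinearMap.range (F i) = LinearMap.ker (G i))
    (hns : ¬ ∃ r : Fam M E, IsHom M E r ∧ ∀ i x, G i (r i x) = x)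
    (huniv : ∀ (X : QuiverRep s t) (h : Fam X M), IsHom X M h →
      (∃ r : Fam M X, IsHom M X r ∧ ∀ i x, h i (r i x) = x) ∨
        ∃ u : Fam X E, IsHom X E u ∧ ∀ i x, G i (u i x) = h i x) :
    ∃ ε, IsAlmostSplitCocycle M T ε := by
  have hGF : ∀ i x, G i (F i x) = 0 := fun i x => (hFG i).le ⟨x, rfl⟩
  have hsec (i : V) := LinearMap.exists_comp_eq_of_mem_range (G i) LinearMap.id fun x => hsurj i x
  choose σ hσ using hsec
  have hεex (a : A) := LinearMap.exists_comp_eq_of_mem_range (F (t a))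
    (E.map a ∘ₗ σ (s a) - σ (t a) ∘ₗ M.map a) fun x => (hFG _).ge (by
      simp only [LinearMap.mem_ker, LinearMap.sub_apply, LinearMap.comp_apply, map_sub, ← hG a, hσ,
        LinearMap.id_apply, sub_self])
  choose ε hε using hεex
  simp only [LinearMap.sub_apply, LinearMap.comp_apply] at hε
  refine ⟨ε, fun ⟨v, hv⟩ => hns ⟨fun i => σ i - F i ∘ₗ v i, fun a x => ?_, fun i x => ?_⟩,
    fun X h hh => (huniv X h hh).imp_right ?_⟩
  · have h1 := hε a x
    rw [hv, map_sub, ← hF a] at h1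
    simp only [LinearMap.sub_apply, LinearMap.comp_apply, map_sub]
    linear_combination (norm := module) -h1
  · rw [LinearMap.sub_apply, map_sub, hσ, LinearMap.comp_apply, hGF, sub_zero, LinearMap.id_apply]
  · rintro ⟨u, hu, hGu⟩
    have hvex (i : V) := LinearMap.exists_comp_eq_of_mem_range (F i) (u i - σ i ∘ₗ h i) fun x =>
      (hFG i).ge (by
        rw [LinearMap.mem_ker, LinearMap.sub_apply, map_sub, sub_eq_zero, LinearMap.comp_apply, hσ,
          hGu, LinearMap.id_apply])
    choose v hv using hvex
    refine ⟨fun i => -v i, fun a x => hinj (t a) ?_⟩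
    have h1 := hε a (h (s a) x)
    have h3 := congrArg (E.map a) (hv (s a) x)
    have h4 := hv (t a) (X.map a x)
    rw [hF a] at h3
    rw [hh a] at h1
    simp only [LinearMap.sub_apply, LinearMap.comp_apply, map_sub, hu a] at h3 h4
    simp only [LinearMap.neg_apply, map_sub, map_neg, LinearMap.comp_apply, h1, h3, h4]
    abel

theorem exists_isAlmostSplitCocycle {dT dE dM : V → ℕ} {T : QRep s t dT} {E : QRep s t dE}
    {M : QRep s t dM} {f : RHom s t T E} {g : RHom s t E M} (h : IsAlmostSplit s t f g) :
    ∃ ε, IsAlmostSplitCocycle (ofMatrix M) (ofMatrix T) ε := by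
  obtain ⟨f, hfc⟩ := f
  obtain ⟨g, hgc⟩ := g
  obtain ⟨⟨hf, hg, hfg⟩, hns, -, -, huniv⟩ := h
  refine exists_isAlmostSplitCocycle_of_exact (isHom_ofMatrix hfc) (isHom_ofMatrix hgc) hf hg hfg
    (fun ⟨r, hr, hr1⟩ => hns ⟨⟨fun i => LinearMap.toMatrix' (r i), hr.toMatrix_comm⟩,
      fun i => Matrix.mulVec_injective (funext fun x => ?_)⟩) fun X h hh => ?_
  · change (g i * LinearMap.toMatrix' (r i)) *ᵥ x = (1 : Matrix _ _ ℂ) *ᵥ x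
    rw [← Matrix.mulVec_mulVec, LinearMap.toMatrix'_mulVec, Matrix.one_mulVec]
    exact hr1 i x
  · obtain ⟨d, Y, φ, hφ⟩ := exists_equiv_ofMatrix X
    have hh' := hh.comp hφ.symm
    by_cases hs : IsSplitEpi s t (⟨fun i =>
        LinearMap.toMatrix' (h i ∘ₗ (φ i).symm.toLinearMap), hh'.toMatrix_comm⟩ : RHom s t Y M)
    · obtain ⟨⟨r, hrc⟩, hr⟩ := hs
      refine Or.inl ⟨_, hφ.symm.comp (isHom_ofMatrix hrc), fun i x => ?_⟩
      have h1 : (LinearMap.toMatrix' (h i ∘ₗ (φ i).symm.toLinearMap) * r i) *ᵥ x =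
        (1 : Matrix _ _ ℂ) *ᵥ x := congrArg (fun B => B *ᵥ x) (hr i)
      rw [← Matrix.mulVec_mulVec, LinearMap.toMatrix'_mulVec, Matrix.one_mulVec] at h1
      exact h1
    · obtain ⟨⟨u, huc⟩, hu⟩ := huniv d Y _ hs
      refine Or.inr ⟨_, (isHom_ofMatrix huc).comp hφ, fun i x => ?_⟩
      have h1 : (g i * u i) *ᵥ (φ i x) =
          LinearMap.toMatrix' (h i ∘ₗ (φ i).symm.toLinearMap) *ᵥ (φ i x) :=
        congrArg (fun B => B *ᵥ (φ i x)) (hu i)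
      rw [← Matrix.mulVec_mulVec, LinearMap.toMatrix'_mulVec] at h1
      refine h1.trans ?_
      simp

/-- The subrepresentation carried by a stable family of subspaces of coordinate spaces. -/
abbrev subOf {d : V → ℕ} {X : QRep s t d} {N : ∀ i, Submodule ℂ (Fin (d i) → ℂ)}
    (hN : ∀ a, (N (s a)).map (X a).mulVecLin ≤ N (t a)) : QuiverRep s t :=
  (ofMatrix X).subrep N fun a _ hv => hN a (Submodule.mem_map_of_mem hv)

/-- The quotient by a stable family of subspaces of coordinate spaces. -/
abbrev quotOf {d : V → ℕ} {X : QRep s t d} {N : ∀ i, Submodule ℂ (Fin (d i) → ℂ)}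
    (hN : ∀ a, (N (s a)).map (X a).mulVecLin ≤ N (t a)) : QuiverRep s t :=
  (ofMatrix X).quotient N fun a _ hv => hN a (Submodule.mem_map_of_mem hv)

/-- The decomposition of the coordinate space of a direct sum. -/
def dsumEquiv (m n : ℕ) : (Fin (m + n) → ℂ) ≃ₗ[ℂ] (Fin m → ℂ) × (Fin n → ℂ) :=
  LinearEquiv.funCongrLeft ℂ ℂ finSumFinEquiv ≪≫ₗ LinearEquiv.sumArrowLequivProdArrow _ _ ℂ ℂ

theorem dsumEquiv_mulVec {dM dT : V → ℕ} (M : QRep s t dM) (T : QRep s t dT) (a : A)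
    (x : Fin (dM (s a) + dT (s a)) → ℂ) : dsumEquiv _ _ (dsum s t M T a *ᵥ x) =
      (M a *ᵥ (dsumEquiv _ _ x).1, T a *ᵥ (dsumEquiv _ _ x).2) := by
  have h1 : (dsum s t M T a *ᵥ x) ∘ finSumFinEquiv =
      Matrix.fromBlocks (M a) 0 0 (T a) *ᵥ (x ∘ finSumFinEquiv) := by
    rw [dsum, Matrix.reindex_apply, Matrix.submatrix_mulVec_equiv]
    ext k
    simp
  rw [Matrix.fromBlocks_mulVec, Matrix.zero_mulVec, Matrix.zero_mulVec, add_zero, zero_add] at h1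
  refine Prod.ext (funext fun k => ?_) (funext fun k => ?_)
  · exact congrFun h1 (Sum.inl k)
  · exact congrFun h1 (Sum.inr k)

theorem extZero_subOf_quotOf [Fintype V] [Fintype A] (hQ : IsDynkin s t) {dT dE dM : V → ℕ}
    {T : QRep s t dT} {E : QRep s t dE} {M : QRep s t dM} {f : RHom s t T E} {g : RHom s t E M}
    (h : IsAlmostSplit s t f g) 
    {N : ∀ i, Submodule ℂ (Fin (dM i + dT i) → ℂ)}
    (hN : ∀ a, (N (s a)).map (dsum s t M T a).mulVecLin ≤ N (t a))
    (hne : (fun i => Module.finrank ℂ (N i)) ≠ dM) : ExtZero (subOf hN) (quotOf hN) := by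
  obtain ⟨ε, hε⟩ := exists_isAlmostSplitCocycle h
  let Θ : ∀ i, (Fin (dM i + dT i) → ℂ) ≃ₗ[ℂ] (Fin (dM i) → ℂ) × (Fin (dT i) → ℂ) :=
    fun i => dsumEquiv _ _
  refine hε.extZero_subrep_quotient hQ (isIndec_ofMatrix h.2.2.2.1) (isIndec_ofMatrix h.2.2.1)
    (D := ofMatrix (dsum s t M T))
    (iM := fun i => (Θ i).symm.toLinearMap ∘ₗ LinearMap.inl ℂ _ _)
    (iT := fun i => (Θ i).symm.toLinearMap ∘ₗ LinearMap.inr ℂ _ _)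
    (pM := fun i => LinearMap.fst ℂ _ _ ∘ₗ (Θ i).toLinearMap)
    (pT := fun i => LinearMap.snd ℂ _ _ ∘ₗ (Θ i).toLinearMap)
    (fun a x => ?_) (fun a x => ?_) (fun a x => ?_) (fun a x => ?_) (fun i x => ?_)
    (fun i x => ?_) N _ ?_
  · refine (Θ (t a)).injective (Eq.trans (dsumEquiv_mulVec M T a _) ?_)
    change _ = Θ (t a) ((Θ (t a)).symm (M a *ᵥ x, 0))
    change (M a *ᵥ (Θ (s a) ((Θ (s a)).symm (x, 0))).1,
      T a *ᵥ (Θ (s a) ((Θ (s a)).symm (x, 0))).2) = _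
    simp
  · refine (Θ (t a)).injective (Eq.trans (dsumEquiv_mulVec M T a _) ?_)
    change _ = Θ (t a) ((Θ (t a)).symm (0, T a *ᵥ x))
    change (M a *ᵥ (Θ (s a) ((Θ (s a)).symm (0, x))).1,
      T a *ᵥ (Θ (s a) ((Θ (s a)).symm (0, x))).2) = _
    simp
  · exact (congrArg Prod.fst (dsumEquiv_mulVec M T a x)).symm
  · exact (congrArg Prod.snd (dsumEquiv_mulVec M T a x)).symm
  · change (Θ i ((Θ i).symm (x, 0))).1 = x
    simp
  · refine (Θ i).injective ?_
    change Θ i ((Θ i).symm ((Θ i x).1, 0) + (Θ i).symm (0, (Θ i x).2)) = Θ i x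
    rw [map_add, LinearEquiv.apply_symm_apply, LinearEquiv.apply_symm_apply]
    simp
  · by_contra! h0
    exact hne (funext fun i => (h0 i).trans (Module.finrank_fin_fun ℂ))

theorem finrank_tangentSp_add [Fintype V] [Fintype A] {d e : V → ℕ} {X : QRep s t d}
    (x : SubRep s t X e) (h : ExtZero (subOf x.2.2) (quotOf x.2.2)) :
    Module.finrank ℂ (TangentSp s t X x) + ∑ a, e (s a) * (d (t a) - e (t a)) =
      ∑ i, e i * (d i - e i) := by
  obtain ⟨N, hdim, hN⟩ := x
  change ExtZero (subOf hN) (quotOf hN) at h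
  have h1 : TangentSp s t X ⟨N, hdim, hN⟩ =
      LinearMap.ker (differential (subOf hN) (quotOf hN)) := by
    ext φ
    refine Iff.trans ?_ mem_ker_differential.symm
    exact forall₂_congr fun a v => eq_comm
  have h2 := LinearMap.finrank_range_add_finrank_ker (differential (subOf hN) (quotOf hN))
  rw [LinearMap.range_eq_top.2 (extZero_iff_surjective.1 h), finrank_top, finrank_fam,
    finrank_cocycle] at h2
  have h3 : ∀ i, (subOf hN).dimVec i = e i := hdim
  have h4 : ∀ i, (quotOf hN).dimVec i = d i - e i := fun i => by
    refine (Submodule.finrank_quotient (N i)).trans ?_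
    rw [hdim, Module.finrank_fin_fun]
  simp only [h3, h4] at h2
  rw [h1, add_comm]
  exact h2

end QuiverRep

section Jacobian

open MvPolynomial

variable {σ ρ : Type}

/-- The maximal ideal of polynomials vanishing at a point. -/
def pointIdeal (p : σ → ℂ) : Ideal (MvPolynomial σ ℂ) := RingHom.ker (eval p)

instance (p : σ → ℂ) : (pointIdeal p).IsMaximal :=
  RingHom.ker_isMaximal_of_surjective _ fun c => ⟨C c, eval_C c⟩

theorem X_sub_C_mem_pointIdeal (p : σ → ℂ) (i : σ) : X i - C (p i) ∈ pointIdeal p := by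
  simp [pointIdeal, RingHom.mem_ker]

/-- The derivative of a polynomial at a point in the direction of a tangent vector. -/
def dirDeriv (p v : σ → ℂ) (g : MvPolynomial σ ℂ) : ℂ :=
  eval p (mkDerivation ℂ (fun i => C (v i) : σ → MvPolynomial σ ℂ) g)

theorem dirDeriv_mul (p v : σ → ℂ) (g h : MvPolynomial σ ℂ) :
    dirDeriv p v (g * h) = eval p g * dirDeriv p v h + eval p h * dirDeriv p v g := by
  simp [dirDeriv]

theorem dirDeriv_add (p v : σ → ℂ) (g h : MvPolynomial σ ℂ) :
    dirDeriv p v (g + h) = dirDeriv p v g + dirDeriv p v h := by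
  simp [dirDeriv]

@[simp] theorem dirDeriv_X (p v : σ → ℂ) (i : σ) : dirDeriv p v (X i) = v i := by
  simp [dirDeriv, mkDerivation_X]

@[simp] theorem dirDeriv_C (p v : σ → ℂ) (c : ℂ) : dirDeriv p v (C c) = 0 := by
  simp [dirDeriv]

/-- The differential of a polynomial at a point. -/
def differentialAt (p : σ → ℂ) (g : MvPolynomial σ ℂ) : (σ → ℂ) →ₗ[ℂ] ℂ where
  toFun v := dirDeriv p v g
  map_add' v w := by
    induction g using MvPolynomial.induction_on with
    | C a => simp
    | add g h hg hh => rw [dirDeriv_add, dirDeriv_add, dirDeriv_add, hg, hh]; ring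
    | mul_X g i hg => rw [dirDeriv_mul, dirDeriv_mul, dirDeriv_mul, hg]; simp; ring
  map_smul' c v := by
    induction g using MvPolynomial.induction_on with
    | C a => simp
    | add g h hg hh => rw [dirDeriv_add, dirDeriv_add, hg, hh]; simp; ring
    | mul_X g i hg => rw [dirDeriv_mul, dirDeriv_mul, hg]; simp; ring

/-- The linear polynomial vanishing at `p` with given differential. -/
def linearAt [Fintype σ] (p : σ → ℂ) (l : (σ → ℂ) →ₗ[ℂ] ℂ) : MvPolynomial σ ℂ :=
  by classical exact ∑ i, C (l (Pi.single i 1)) * (X i - C (p i))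

theorem linearAt_mem [Fintype σ] (p : σ → ℂ) (l : (σ → ℂ) →ₗ[ℂ] ℂ) :
    linearAt p l ∈ pointIdeal p :=
  Ideal.sum_mem _ fun i _ => Ideal.mul_mem_left _ _ (X_sub_C_mem_pointIdeal p i)

theorem linearAt_add [Fintype σ] (p : σ → ℂ) (l m : (σ → ℂ) →ₗ[ℂ] ℂ) :
    linearAt p (l + m) = linearAt p l + linearAt p m := by
  simp [linearAt, add_mul, Finset.sum_add_distrib]

theorem linearAt_smul [Fintype σ] (p : σ → ℂ) (c : ℂ) (l : (σ → ℂ) →ₗ[ℂ] ℂ) :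
    linearAt p (c • l) = C c * linearAt p l := by
  simp [linearAt, Finset.mul_sum, mul_assoc]

theorem linearAt_proj [Fintype σ] (p : σ → ℂ) (i : σ) :
    linearAt p (LinearMap.proj i) = X i - C (p i) := by
  classical
  rw [linearAt, Finset.sum_eq_single i]
  · simp
  · intro j _ hj
    simp [hj.symm]
  · simp

/-- `linearAt p` as a linear map. -/
def linearAtₗ [Fintype σ] (p : σ → ℂ) : ((σ → ℂ) →ₗ[ℂ] ℂ) →ₗ[ℂ] MvPolynomial σ ℂ where
  toFun := linearAt p
  map_add' := linearAt_add p
  map_smul' c l := by rw [linearAt_smul, C_mul']; rfl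

theorem sub_linearAt_mem_sq [Fintype σ] (p : σ → ℂ) (g : MvPolynomial σ ℂ) :
    g - C (eval p g) - linearAt p (differentialAt p g) ∈ pointIdeal p ^ 2 := by
  induction g using MvPolynomial.induction_on with
  | C a =>
    have h : differentialAt p (C a) = 0 := LinearMap.ext fun v => dirDeriv_C p v a
    have h0 : linearAt p 0 = 0 := map_zero (linearAtₗ p)
    simp [h, h0]
  | add g h hg hh =>
    have h1 : differentialAt p (g + h) = differentialAt p g + differentialAt p h :=
      LinearMap.ext fun v => dirDeriv_add p v g h
    rw [h1, linearAt_add]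
    convert Ideal.add_mem _ hg hh using 1
    simp only [map_add]
    ring
  | mul_X g i hg =>
    have h1 : differentialAt p (g * X i) =
        eval p g • LinearMap.proj i + p i • differentialAt p g :=
      LinearMap.ext fun v => by
        change dirDeriv p v (g * X i) = eval p g * v i + p i * dirDeriv p v g
        rw [dirDeriv_mul]
        simp
    have h2 : g - C (eval p g) ∈ pointIdeal p := by simp [pointIdeal, RingHom.mem_ker]
    have h3 := Ideal.mul_mem_mul h2 (X_sub_C_mem_pointIdeal p i)
    rw [← pow_two] at h3
    rw [h1, linearAt_add, linearAt_smul, linearAt_smul, linearAt_proj]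
    convert Ideal.add_mem _ h3 (Ideal.mul_mem_left _ (C (p i)) hg) using 1
    simp only [map_mul, eval_X]
    ring

theorem pointIdeal_eq_span [Fintype σ] (p : σ → ℂ) :
    pointIdeal p = Ideal.span (Set.range fun i => X i - C (p i)) := by
  refine le_antisymm (fun g hg => ?_) (Ideal.span_le.2 ?_)
  · have key : ∀ g : MvPolynomial σ ℂ,
        g - C (eval p g) ∈ Ideal.span (Set.range fun i => X i - C (p i)) := fun g => by
      induction g using MvPolynomial.induction_on with
      | C a => simp
      | add g h hg hh =>
        convert Ideal.add_mem _ hg hh using 1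
        simp only [map_add]
        ring
      | mul_X g i hg =>
        convert Ideal.add_mem _ (Ideal.mul_mem_right (X i) _ hg)
          (Ideal.mul_mem_left _ (C (eval p g)) (Ideal.subset_span ⟨i, rfl⟩)) using 1
        simp only [map_mul, eval_X]
        ring
    have h := key g
    rwa [show eval p g = 0 from hg, map_zero, sub_zero] at h
  · rintro _ ⟨i, rfl⟩
    exact X_sub_C_mem_pointIdeal p i

theorem exists_eq_pointIdeal [Finite σ] (m : Ideal (MvPolynomial σ ℂ)) [m.IsMaximal] :
    ∃ p, m = pointIdeal p := by
  obtain ⟨p, rfl⟩ := (MvPolynomial.isMaximal_iff_eq_vanishingIdeal_singleton (K := ℂ) (I := m)).1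
    inferInstance
  refine ⟨p, Ideal.ext fun g => ?_⟩
  simp [pointIdeal, RingHom.mem_ker]

theorem height_pointIdeal [Fintype σ] (p : σ → ℂ) :
    (pointIdeal p).height = Fintype.card σ := by
  have hdim : ringKrullDim (MvPolynomial σ ℂ) = Fintype.card σ := by
    rw [MvPolynomial.ringKrullDim_of_isNoetherianRing, ringKrullDim_eq_zero_of_field, zero_add]
    simp
  have : FiniteRingKrullDim (MvPolynomial σ ℂ) :=
    finiteRingKrullDim_iff_ne_bot_and_top.2 (by rw [hdim]; exact ⟨WithBot.coe_ne_bot, 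
      WithBot.coe_injective.ne (ENat.natCast_ne_top (Fintype.card σ))⟩)
  obtain ⟨m, hm, hmh⟩ := Ideal.exists_isMaximal_height (R := MvPolynomial σ ℂ)
  obtain ⟨q, rfl⟩ := exists_eq_pointIdeal m
  let u (c : σ → ℂ) : MvPolynomial σ ℂ →ₐ[ℂ] MvPolynomial σ ℂ := aeval fun i => X i + C (c i)
  have huu : ∀ c, (u c).comp (u (-c)) = AlgHom.id ℂ _ := fun c => by
    ext i
    simp [u]
  let w : MvPolynomial σ ℂ ≃ₐ[ℂ] MvPolynomial σ ℂ := AlgEquiv.ofAlgHom (u (q - p)) (u (p - q))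
    (by simpa using huu (q - p)) (by simpa using huu (p - q))
  have hw : (pointIdeal p).comap w.toRingEquiv = pointIdeal q := by
    ext g
    have h1 : (eval p).comp w.toRingEquiv.toRingHom = eval q := by
      refine MvPolynomial.ringHom_ext (fun r => ?_) fun i => ?_
      · simp [w, u]
      · simp [w, u]
    change eval p (w.toRingEquiv g) = 0 ↔ eval q g = 0
    rw [← h1]
    rfl
  have h2 := w.toRingEquiv.height_comap (pointIdeal p)
  rw [hw] at h2
  rw [hdim] at hmh
  rw [← h2]
  exact_mod_cast hmh

theorem Ideal.height_le_ncard_of_le_span_sup_sq {R : Type*} [CommRing R] [IsNoetherianRing R]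
    {m : Ideal R} [m.IsPrime] {s : Set R} (hs : s.Finite) (hsm : s ⊆ m)
    (h : m ≤ Ideal.span s ⊔ m ^ 2) : m.height ≤ s.ncard := by
  refine Ideal.height_le_card_of_mem_minimalPrimes_span hs
    ⟨⟨inferInstance, Ideal.span_le.2 hsm⟩, fun q ⟨hq, hsq⟩ hqm => ?_⟩
  have h1 : m.map (Ideal.Quotient.mk q) ≤ m.map (Ideal.Quotient.mk q) ^ 2 := by
    refine (Ideal.map_mono (h.trans (sup_le_sup_right hsq _))).trans ?_
    rw [Ideal.map_sup, Ideal.map_quotient_self, bot_sup_eq, Ideal.map_pow]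
  have h2 : IsIdempotentElem (m.map (Ideal.Quotient.mk q)) :=
    le_antisymm Ideal.mul_le_right (by rwa [← pow_two])
  rcases (Ideal.isIdempotentElem_iff_eq_bot_or_top _ (IsNoetherian.noetherian _)).1 h2 with h3 | h3
  · rwa [Ideal.map_eq_bot_iff_le_ker, Ideal.mk_ker] at h3
  · have h4 := congrArg (Ideal.comap (Ideal.Quotient.mk q)) h3
    rw [Ideal.comap_map_of_surjective _ Ideal.Quotient.mk_surjective, Ideal.comap_top,
      ← RingHom.ker_eq_comap_bot, Ideal.mk_ker, sup_eq_left.2 hqm] at h4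
    exact absurd h4 (Ideal.IsPrime.ne_top inferInstance)

theorem exists_pointIdeal_le_sup [Fintype σ] [Fintype ρ] (f : ρ → MvPolynomial σ ℂ) (p : σ → ℂ)
    (hp : ∀ r, eval p (f r) = 0) (hJ : Function.Surjective fun v r => dirDeriv p v (f r)) :
    ∃ l : Fin (Fintype.card σ - Fintype.card ρ) → MvPolynomial σ ℂ,
      (∀ j, l j ∈ pointIdeal p) ∧ pointIdeal p ≤
        Ideal.span (Set.range f) ⊔ Ideal.span (Set.range l) ⊔ pointIdeal p ^ 2 := by
  let J : (σ → ℂ) →ₗ[ℂ] ρ → ℂ := LinearMap.pi fun r => differentialAt p (f r)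
  have hJs : LinearMap.range J = ⊤ := LinearMap.range_eq_top.2 hJ
  have hn : Module.finrank ℂ (LinearMap.ker J) = Fintype.card σ - Fintype.card ρ := by
    have := LinearMap.finrank_range_add_finrank_ker J
    rw [hJs, finrank_top, Module.finrank_fintype_fun_eq_card,
      Module.finrank_fintype_fun_eq_card] at this
    omega
  obtain ⟨π, hπ⟩ := (LinearMap.ker J).subtype.exists_leftInverse_of_injective
    (Submodule.ker_subtype _)
  let b := (LinearEquiv.ofFinrankEq (LinearMap.ker J)
    (Fin (Fintype.card σ - Fintype.card ρ) → ℂ) (hn.trans (Module.finrank_fin_fun ℂ).symm))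
  let L : (σ → ℂ) →ₗ[ℂ] Fin (Fintype.card σ - Fintype.card ρ) → ℂ := b.toLinearMap ∘ₗ π
  have hker : LinearMap.ker (J.prod L) = ⊥ := by
    refine LinearMap.ker_eq_bot'.2 fun v hv => ?_
    have h1 : J v = 0 := congrArg Prod.fst hv
    have h2 : b (π v) = 0 := congrArg Prod.snd hv
    have h3 := LinearMap.congr_fun hπ ⟨v, h1⟩
    rw [LinearMap.comp_apply, Submodule.subtype_apply, b.map_eq_zero_iff.1 h2] at h3
    exact (congrArg Subtype.val h3).symm
  obtain ⟨G, hG⟩ := (J.prod L).exists_leftInverse_of_injective hker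
  refine ⟨fun j => linearAt p (LinearMap.proj j ∘ₗ L), fun j => linearAt_mem p _, ?_⟩
  set Q := Ideal.span (Set.range f) ⊔
    Ideal.span (Set.range fun j => linearAt p (LinearMap.proj j ∘ₗ L)) ⊔ pointIdeal p ^ 2 with hQ
  have hf : ∀ r, linearAt p (differentialAt p (f r)) ∈ Q := fun r => by
    have h1 := sub_linearAt_mem_sq p (f r)
    rw [hp, map_zero, sub_zero] at h1
    have h2 : f r ∈ Q := Ideal.mem_sup_left (Ideal.mem_sup_left
      (Ideal.subset_span ⟨r, rfl⟩))
    simpa using Q.sub_mem h2 (Ideal.mem_sup_right h1)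
  have hl : ∀ j, linearAt p (LinearMap.proj j ∘ₗ L) ∈ Q := fun j =>
    Ideal.mem_sup_left (Ideal.mem_sup_right (Ideal.subset_span ⟨j, rfl⟩))
  classical
  have key : ∀ l : (σ → ℂ) →ₗ[ℂ] ℂ, linearAt p l ∈ Q := fun l => by
    have h1 : l = (∑ r, (l (G (Pi.single r 1, 0))) • differentialAt p (f r)) +
        ∑ j, (l (G (0, Pi.single j 1))) • (LinearMap.proj j ∘ₗ L) := by
      refine LinearMap.ext fun v => ?_
      have h2 : G (J v, L v) = v := LinearMap.congr_fun hG v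
      have h3 : (J v, L v) = (∑ r, J v r • (Pi.single r 1, 0)) +
          ∑ j, L v j • ((0 : ρ → ℂ), (Pi.single j 1 : Fin _ → ℂ)) := by
        refine Prod.ext ?_ ?_
        · simp only [Prod.fst_add, Prod.fst_sum, Prod.smul_fst, smul_zero, Finset.sum_const_zero,
            add_zero]
          exact pi_eq_sum_univ' (J v)
        · simp only [Prod.snd_add, Prod.snd_sum, Prod.smul_snd, smul_zero, Finset.sum_const_zero,
            zero_add]
          exact pi_eq_sum_univ' (L v)
      conv_lhs => rw [← h2, h3]
      simp only [map_add, map_sum, map_smul, LinearMap.add_apply, LinearMap.sum_apply,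
        LinearMap.smul_apply, smul_eq_mul, LinearMap.comp_apply, LinearMap.proj_apply]
      congr 1
      · exact Finset.sum_congr rfl fun r _ => mul_comm _ _
      · exact Finset.sum_congr rfl fun r _ => mul_comm _ _
    rw [h1]
    change linearAtₗ p _ ∈ Q
    rw [map_add, map_sum, map_sum]
    refine Q.add_mem (Q.sum_mem fun r _ => ?_) (Q.sum_mem fun j _ => ?_)
    · rw [map_smul, ← C_mul']
      exact Q.mul_mem_left _ (hf r)
    · rw [map_smul, ← C_mul']
      exact Q.mul_mem_left _ (hl j)
  rw [pointIdeal_eq_span, Ideal.span_le]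
  rintro _ ⟨i, rfl⟩
  have := key (LinearMap.proj i)
  rwa [linearAt_proj] at this

theorem ringKrullDim_quotient_add_card [Fintype σ] [Fintype ρ] (f : ρ → MvPolynomial σ ℂ)
    (hf : ∃ p, ∀ r, eval p (f r) = 0)
    (hJ : ∀ p, (∀ r, eval p (f r) = 0) → Function.Surjective fun v r => dirDeriv p v (f r)) :
    ringKrullDim (MvPolynomial σ ℂ ⧸ Ideal.span (Set.range f)) + Fintype.card ρ =
      Fintype.card σ := by
  obtain ⟨p, hp⟩ := hf
  have hle : Fintype.card ρ ≤ Fintype.card σ := by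
    let J : (σ → ℂ) →ₗ[ℂ] ρ → ℂ := LinearMap.pi fun r => differentialAt p (f r)
    have h1 := LinearMap.finrank_le_finrank_of_surjective (f := J) (hJ p hp)
    rwa [Module.finrank_fintype_fun_eq_card, Module.finrank_fintype_fun_eq_card] at h1
  refine le_antisymm ?_ ?_
  · have h1 : ringKrullDim (MvPolynomial σ ℂ ⧸ Ideal.span (Set.range f)) ≤
        ((Fintype.card σ - Fintype.card ρ : ℕ) : WithBot ℕ∞) := by
      refine (ringKrullDim_le_iff_isMaximal_height_le _).2 fun m hm => ?_
      have hm' := Ideal.comap_isMaximal_of_surjective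
        (Ideal.Quotient.mk (Ideal.span (Set.range f))) Ideal.Quotient.mk_surjective (K := m)
      obtain ⟨q, hq⟩ := exists_eq_pointIdeal (m.comap (Ideal.Quotient.mk _))
      have hmq : m = (pointIdeal q).map (Ideal.Quotient.mk _) := by
        rw [← hq, Ideal.map_comap_of_surjective _ Ideal.Quotient.mk_surjective]
      have hfq : ∀ r, eval q (f r) = 0 := fun r => by
        have h2 : f r ∈ m.comap (Ideal.Quotient.mk (Ideal.span (Set.range f))) := by
          rw [Ideal.mem_comap,
            Ideal.Quotient.eq_zero_iff_mem.2 (Ideal.subset_span (Set.mem_range_self r))]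
          exact m.zero_mem
        rwa [hq] at h2
      obtain ⟨l, hl, hlq⟩ := exists_pointIdeal_le_sup f q hfq (hJ q hfq)
      have h3 := Ideal.height_le_ncard_of_le_span_sup_sq (m := m)
        (Set.finite_range fun j => Ideal.Quotient.mk (Ideal.span (Set.range f)) (l j)) (by
          rintro _ ⟨j, rfl⟩
          rw [hmq]
          exact Ideal.mem_map_of_mem _ (hl j)) (by
          have h4 := Ideal.map_mono (f := Ideal.Quotient.mk (Ideal.span (Set.range f))) hlq
          rw [Ideal.map_sup, Ideal.map_sup, Ideal.map_quotient_self, bot_sup_eq, Ideal.map_pow,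
            ← hmq, Ideal.map_span, ← Set.range_comp] at h4
          exact h4)
      have h5 := Set.ncard_image_le
        (f := fun j => Ideal.Quotient.mk (Ideal.span (Set.range f)) (l j))
        Set.finite_univ
      rw [Set.ncard_univ, Nat.card_fin, Set.image_univ] at h5
      exact WithBot.coe_le_coe.2 (h3.trans (Nat.cast_le.2 h5))
    calc _ ≤ ((Fintype.card σ - Fintype.card ρ : ℕ) : WithBot ℕ∞) + Fintype.card ρ := by gcongr
      _ = _ := by exact_mod_cast Nat.sub_add_cancel hle
  · have h1 := Ideal.height_le_ringKrullDim_quotient_add_encard (p := pointIdeal p) (Set.range f)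
      (by rintro _ ⟨r, rfl⟩; exact hp r)
    rw [height_pointIdeal] at h1
    have h2 : (Set.range f).encard ≤ Fintype.card ρ := by
      rw [← Set.image_univ]
      refine (Set.encard_image_le _ _).trans ?_
      simp
    refine le_trans (by exact_mod_cast h1) (add_le_add_right (WithBot.coe_le_coe.2 h2) _)

end Jacobian

section KrullDimension

open TopologicalSpace

theorem Topology.IsInducing.topologicalKrullDim_eq_of_closedPoints {Z Y : Type*}
    [TopologicalSpace Z] [TopologicalSpace Y] [JacobsonSpace Y] {ι : Z → Y}
    (hι : Topology.IsInducing ι) (hr : closedPoints Y ⊆ Set.range ι) :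
    topologicalKrullDim Z = topologicalKrullDim Y := by
  refine le_antisymm hι.topologicalKrullDim_le ?_
  have key : ∀ C : IrreducibleCloseds Y, closure (ι '' (ι ⁻¹' C)) = C := fun C => by
    refine subset_antisymm (closure_minimal (Set.image_preimage_subset _ _) C.isClosed) ?_
    have h1 := JacobsonSpace.closure_inter_closedPoints_eq_closure C.isClosed.isLocallyClosed
    rw [C.isClosed.closure_eq] at h1
    conv_lhs => rw [← h1]
    rw [Set.image_preimage_eq_inter_range]
    exact closure_mono (Set.inter_subset_inter_right _ hr)
  have hirr : ∀ C : IrreducibleCloseds Y, IsIrreducible (ι ⁻¹' (C : Set Y)) := fun C => by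
    have h1 : IsIrreducible (ι '' (ι ⁻¹' (C : Set Y))) := by
      rw [← isIrreducible_iff_closure, key]
      exact C.isIrreducible
    refine ⟨Set.image_nonempty.1 h1.1, ?_⟩
    rintro u v hu hv ⟨x, hxC, hxu⟩ ⟨y, hyC, hyv⟩
    obtain ⟨u, hu', rfl⟩ := hι.isOpen_iff.1 hu
    obtain ⟨v, hv', rfl⟩ := hι.isOpen_iff.1 hv
    obtain ⟨_, ⟨z, hz, rfl⟩, hzuv⟩ :=
      h1.2 u v hu' hv' ⟨ι x, ⟨x, hxC, rfl⟩, hxu⟩ ⟨ι y, ⟨y, hyC, rfl⟩, hyv⟩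
    exact ⟨z, hz, hzuv⟩
  let F : IrreducibleCloseds Y → IrreducibleCloseds Z := fun C =>
    ⟨ι ⁻¹' C, hirr C, C.isClosed.preimage hι.continuous⟩
  have hmono : Monotone F := fun C D (h : (C : Set Y) ⊆ D) =>
    show ι ⁻¹' (C : Set Y) ⊆ ι ⁻¹' (D : Set Y) from Set.preimage_mono h
  have hinj : Function.Injective F := fun C D h => by
    have h1 : ι ⁻¹' (C : Set Y) = ι ⁻¹' (D : Set Y) := congrArg IrreducibleCloseds.carrier h
    refine SetLike.coe_injective ?_
    rw [← key C, ← key D, h1]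
  exact Order.krullDim_le_of_strictMono F (hmono.strictMono_of_injective hinj)

theorem topologicalKrullDim_eq_of_openEmbeddings {Y : Type*} [TopologicalSpace Y] [Nonempty Y]
    (n : WithBot ℕ∞)
    (h : ∀ y : Y, ∃ (Z : Type) (_ : TopologicalSpace Z) (j : Z → Y),
      Topology.IsOpenEmbedding j ∧ y ∈ Set.range j ∧ topologicalKrullDim Z = n) :
    topologicalKrullDim Y = n := by
  refine le_antisymm ?_ ?_
  · rw [topologicalKrullDim, Order.krullDim_eq_iSup_coheight]
    refine iSup_le fun C => ?_
    obtain ⟨y, hy⟩ := C.isIrreducible.nonempty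
    obtain ⟨Z, _, j, hj, ⟨z, rfl⟩, rfl⟩ := h y
    let D := (IrreducibleCloseds.orderIsoOfIsOpenEmbedding j hj).symm ⟨C, ⟨z, hy⟩⟩
    have hD : IrreducibleCloseds.map j hj.continuous D = C := congrArg Subtype.val
      ((IrreducibleCloseds.orderIsoOfIsOpenEmbedding j hj).apply_symm_apply ⟨C, ⟨z, hy⟩⟩)
    rw [← hD, hj.coheight_map]
    exact Order.coheight_le_krullDim D
  · obtain ⟨y⟩ := ‹Nonempty Y›
    obtain ⟨Z, _, j, hj, -, hn⟩ := h y
    exact hn ▸ hj.isInducing.topologicalKrullDim_le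

end KrullDimension

section ZeroLocus

open MvPolynomial

variable {σ ρ : Type}

/-- The prime ideal of polynomials vanishing at a point of affine space. -/
def toSpec (x : σ → ℂ) : PrimeSpectrum (MvPolynomial σ ℂ) :=
  ⟨RingHom.ker (eval x), RingHom.ker_isPrime _⟩

/-- The common zeros of a family of polynomials. -/
def ZeroSet (f : ρ → MvPolynomial σ ℂ) : Type := {x : σ → ℂ // ∀ r, eval x (f r) = 0}

instance (f : ρ → MvPolynomial σ ℂ) : TopologicalSpace (ZeroSet f) :=
  TopologicalSpace.induced Subtype.val (zariski σ)

theorem isInducing_toSpec_zeroSet (f : ρ → MvPolynomial σ ℂ) :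
    Topology.IsInducing fun x : ZeroSet f => toSpec x.1 :=
  ⟨induced_compose⟩

theorem topologicalKrullDim_zeroSet [Finite σ] (f : ρ → MvPolynomial σ ℂ) :
    topologicalKrullDim (ZeroSet f) =
      ringKrullDim (MvPolynomial σ ℂ ⧸ Ideal.span (Set.range f)) := by
  set I := Ideal.span (Set.range f) with hI
  have hle : ∀ x : ZeroSet f, I ≤ RingHom.ker (eval x.1) := fun x => by
    rw [hI, Ideal.span_le]
    rintro _ ⟨r, rfl⟩
    exact x.2 r
  let ι : ZeroSet f → PrimeSpectrum (MvPolynomial σ ℂ ⧸ I) := fun x =>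
    ⟨RingHom.ker (Ideal.Quotient.lift I (eval x.1) (hle x)), RingHom.ker_isPrime _⟩
  have hcomp : PrimeSpectrum.comap (Ideal.Quotient.mk I) ∘ ι = fun x => toSpec x.1 := by
    funext x
    refine PrimeSpectrum.ext (Ideal.ext fun g => ?_)
    rfl
  have hmk := PrimeSpectrum.isClosedEmbedding_comap_of_surjective _ (Ideal.Quotient.mk I)
    Ideal.Quotient.mk_surjective
  have hι : Topology.IsInducing ι := by
    rw [← hmk.isInducing.of_comp_iff, hcomp]
    exact isInducing_toSpec_zeroSet f
  rw [hι.topologicalKrullDim_eq_of_closedPoints,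
    PrimeSpectrum.topologicalKrullDim_eq_ringKrullDim]
  intro m hm
  have hm' : m.asIdeal.IsMaximal := (PrimeSpectrum.isClosed_singleton_iff_isMaximal m).1 hm
  have hmax := Ideal.comap_isMaximal_of_surjective (Ideal.Quotient.mk I)
    Ideal.Quotient.mk_surjective (K := m.asIdeal)
  obtain ⟨p, hp⟩ := exists_eq_pointIdeal (m.asIdeal.comap (Ideal.Quotient.mk I))
  have hpf : ∀ r, eval p (f r) = 0 := fun r => by
    have h2 : f r ∈ m.asIdeal.comap (Ideal.Quotient.mk I) := by
      rw [Ideal.mem_comap,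
        Ideal.Quotient.eq_zero_iff_mem.2 (Ideal.subset_span (Set.mem_range_self r))]
      exact m.asIdeal.zero_mem
    rwa [hp] at h2
  refine ⟨⟨p, hpf⟩, hmk.injective ?_⟩
  exact (congrFun hcomp ⟨p, hpf⟩).trans (PrimeSpectrum.ext hp.symm)

/-- A map to affine space is continuous for the Zariski topology as soon as its coordinates are
quotients of polynomials with nonvanishing denominators. -/
theorem continuous_toSpec_of_rational {τ : Type} {U : Type*} [TopologicalSpace U]
    (u : U → τ → ℂ) (hu : Continuous fun x => toSpec (u x)) (r : U → σ → ℂ)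
    (h : ∀ i, ∃ a b : MvPolynomial τ ℂ, ∀ x,
      eval (u x) b ≠ 0 ∧ r x i * eval (u x) b = eval (u x) a) :
    Continuous fun x => toSpec (r x) := by
  have key : ∀ q : MvPolynomial σ ℂ, ∃ a b : MvPolynomial τ ℂ, ∀ x,
      eval (u x) b ≠ 0 ∧ eval (r x) q * eval (u x) b = eval (u x) a := fun q => by
    induction q using MvPolynomial.induction_on with
    | C c => exact ⟨C c, 1, fun x => by simp⟩
    | add p q hp hq =>
      obtain ⟨a, b, hab⟩ := hp
      obtain ⟨a', b', hab'⟩ := hq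
      refine ⟨a * b' + a' * b, b * b', fun x => ⟨?_, ?_⟩⟩
      · simpa using ⟨(hab x).1, (hab' x).1⟩
      · simp only [map_add, map_mul, ← (hab x).2, ← (hab' x).2]
        ring
    | mul_X p i hp =>
      obtain ⟨a, b, hab⟩ := hp
      obtain ⟨a', b', hab'⟩ := h i
      refine ⟨a * a', b * b', fun x => ⟨?_, ?_⟩⟩
      · simpa using ⟨(hab x).1, (hab' x).1⟩
      · simp only [map_mul, eval_X, ← (hab x).2, ← (hab' x).2]
        ring
  refine PrimeSpectrum.isTopologicalBasis_basic_opens.continuous_iff.2 ?_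
  rintro _ ⟨q, rfl⟩
  obtain ⟨a, b, hab⟩ := key q
  convert (PrimeSpectrum.isOpen_basicOpen (a := a)).preimage hu using 1
  ext x
  change ¬ (eval (r x) q = 0) ↔ ¬ (eval (u x) a = 0)
  rw [← (hab x).2, mul_eq_zero, or_iff_left (hab x).1]

end ZeroLocus

section PolynomialMatrices

open MvPolynomial

variable {l m n : Type} {σ : Type}

/-- A scalar matrix, viewed as a matrix of constant polynomials. -/
def constMat (σ : Type) (B : Matrix m n ℂ) : Matrix m n (MvPolynomial σ ℂ) := fun i j => C (B i j)

/-- The value of a matrix of polynomials at a point. -/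
def evalMat (p : σ → ℂ) (B : Matrix m n (MvPolynomial σ ℂ)) : Matrix m n ℂ :=
  fun i j => eval p (B i j)

/-- The derivative of a matrix of polynomials at a point in the direction of a tangent vector. -/
def derivMat (p v : σ → ℂ) (B : Matrix m n (MvPolynomial σ ℂ)) : Matrix m n ℂ :=
  fun i j => dirDeriv p v (B i j)

theorem evalMat_constMat (p : σ → ℂ) (B : Matrix m n ℂ) : evalMat p (constMat σ B) = B :=
  Matrix.ext fun _ _ => eval_C _

theorem evalMat_add (p : σ → ℂ) (B D : Matrix m n (MvPolynomial σ ℂ)) :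
    evalMat p (B + D) = evalMat p B + evalMat p D :=
  Matrix.ext fun _ _ => map_add _ _ _

theorem evalMat_sub (p : σ → ℂ) (B D : Matrix m n (MvPolynomial σ ℂ)) :
    evalMat p (B - D) = evalMat p B - evalMat p D :=
  Matrix.ext fun _ _ => map_sub _ _ _

theorem evalMat_mul [Fintype m] (p : σ → ℂ) (B : Matrix l m (MvPolynomial σ ℂ))
    (D : Matrix m n (MvPolynomial σ ℂ)) : evalMat p (B * D) = evalMat p B * evalMat p D :=
  Matrix.ext fun i j => by simp [evalMat, Matrix.mul_apply]

theorem derivMat_constMat (p v : σ → ℂ) (B : Matrix m n ℂ) : derivMat p v (constMat σ B) = 0 :=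
  Matrix.ext fun _ _ => dirDeriv_C _ _ _

theorem derivMat_add (p v : σ → ℂ) (B D : Matrix m n (MvPolynomial σ ℂ)) :
    derivMat p v (B + D) = derivMat p v B + derivMat p v D :=
  Matrix.ext fun _ _ => dirDeriv_add _ _ _ _

theorem derivMat_sub (p v : σ → ℂ) (B D : Matrix m n (MvPolynomial σ ℂ)) :
    derivMat p v (B - D) = derivMat p v B - derivMat p v D :=
  Matrix.ext fun i j => by simp [derivMat, dirDeriv]

theorem derivMat_mul [Fintype m] (p v : σ → ℂ) (B : Matrix l m (MvPolynomial σ ℂ))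
    (D : Matrix m n (MvPolynomial σ ℂ)) :
    derivMat p v (B * D) = evalMat p B * derivMat p v D + derivMat p v B * evalMat p D :=
  Matrix.ext fun i j => by
    simp [derivMat, evalMat, dirDeriv, Matrix.mul_apply, Finset.sum_add_distrib, mul_comm]

end PolynomialMatrices

/-- Mutually inverse identifications `ℂ^d = ℂ^e ⊕ ℂ^c`, one at each vertex: `P` and `R` are the
inclusions of the summands, `S` and `K` the projections. -/
structure Splitting (d e c : V → ℕ) where
  P : ∀ i, Matrix (Fin (d i)) (Fin (e i)) ℂ
  R : ∀ i, Matrix (Fin (d i)) (Fin (c i)) ℂ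
  S : ∀ i, Matrix (Fin (e i)) (Fin (d i)) ℂ
  K : ∀ i, Matrix (Fin (c i)) (Fin (d i)) ℂ
  S_mul_P : ∀ i, S i * P i = 1
  S_mul_R : ∀ i, S i * R i = 0
  K_mul_P : ∀ i, K i * P i = 0
  K_mul_R : ∀ i, K i * R i = 1
  P_mul_S_add : ∀ i, P i * S i + R i * K i = 1

namespace Splitting

open MvPolynomial

variable {d e c : V → ℕ} (G : Splitting d e c)

/-- The index type of the coordinates of a tuple of `(c i) × (e i)` matrices. -/
abbrev CoordIndex (c e : V → ℕ) : Type := Σ i : V, Fin (c i) × Fin (e i)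

/-- The inclusion of the graph of `φ`. -/
def inc (φ : Coord c e) (i : V) : Matrix (Fin (d i)) (Fin (e i)) ℂ := G.P i + G.R i * matOf φ i

/-- The projection whose kernel is the graph of `φ`. -/
def proj (φ : Coord c e) (i : V) : Matrix (Fin (c i)) (Fin (d i)) ℂ := G.K i - matOf φ i * G.S i

theorem S_mul_inc (φ : Coord c e) (i : V) : G.S i * G.inc φ i = 1 := by
  rw [inc, Matrix.mul_add, ← Matrix.mul_assoc, G.S_mul_P, G.S_mul_R, Matrix.zero_mul, add_zero]

theorem K_mul_inc (φ : Coord c e) (i : V) : G.K i * G.inc φ i = matOf φ i := by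
  rw [inc, Matrix.mul_add, ← Matrix.mul_assoc, G.K_mul_P, G.K_mul_R, Matrix.one_mul, zero_add]

theorem proj_mul_R (φ : Coord c e) (i : V) : G.proj φ i * G.R i = 1 := by
  rw [proj, Matrix.sub_mul, Matrix.mul_assoc, G.S_mul_R, G.K_mul_R, Matrix.mul_zero, sub_zero]

theorem proj_mul_inc (φ ψ : Coord c e) (i : V) :
    G.proj φ i * G.inc ψ i = matOf ψ i - matOf φ i := by
  rw [proj, Matrix.sub_mul, Matrix.mul_assoc, S_mul_inc, K_mul_inc, Matrix.mul_one]

theorem inc_mul_S_add (φ : Coord c e) (i : V) :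
    G.inc φ i * G.S i + G.R i * G.proj φ i = 1 := by
  rw [inc, proj, Matrix.add_mul, Matrix.mul_sub, Matrix.mul_assoc, ← G.P_mul_S_add]
  abel

theorem range_inc (φ : Coord c e) (i : V) :
    LinearMap.range (G.inc φ i).mulVecLin = LinearMap.ker (G.proj φ i).mulVecLin := by
  ext x
  refine ⟨?_, fun h => ?_⟩
  · rintro ⟨u, rfl⟩
    rw [LinearMap.mem_ker, mulVecLin_apply, mulVecLin_apply, mulVec_mulVec, proj_mul_inc, sub_self,
      zero_mulVec]
  · rw [LinearMap.mem_ker, mulVecLin_apply] at h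
    refine ⟨G.S i *ᵥ x, ?_⟩
    have h1 := congrArg (fun B => B *ᵥ x) (G.inc_mul_S_add φ i)
    simp only [add_mulVec, ← mulVec_mulVec, h, mulVec_zero, add_zero, one_mulVec] at h1
    exact h1

theorem injective_inc (φ : Coord c e) (i : V) : Function.Injective (G.inc φ i).mulVecLin :=
  Function.LeftInverse.injective (g := (G.S i).mulVecLin) fun u => by
    rw [mulVecLin_apply, mulVecLin_apply, mulVec_mulVec, S_mul_inc, one_mulVec]

/-- The matrices with polynomial entries whose values are the `matOf φ i`. -/
def genMat (c e : V → ℕ) (i : V) :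
    Matrix (Fin (c i)) (Fin (e i)) (MvPolynomial (CoordIndex c e) ℂ) :=
  fun p q => X ⟨i, (p, q)⟩

theorem evalMat_genMat (φ : Coord c e) (i : V) : evalMat φ (genMat c e i) = matOf φ i :=
  Matrix.ext fun _ _ => eval_X _

theorem derivMat_genMat (φ ψ : Coord c e) (i : V) : derivMat φ ψ (genMat c e i) = matOf ψ i :=
  Matrix.ext fun _ _ => dirDeriv_X φ ψ _

variable {s t : A → V}

/-- The matrices with polynomial entries whose values are the `inc φ i`. -/
def genInc (i : V) :
    Matrix (Fin (d i)) (Fin (e i)) (MvPolynomial (CoordIndex c e) ℂ) :=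
  constMat (CoordIndex c e) (G.P i) + constMat (CoordIndex c e) (G.R i) * genMat c e i

/-- The matrices with polynomial entries whose values are the `proj φ i`. -/
def genProj (i : V) :
    Matrix (Fin (c i)) (Fin (d i)) (MvPolynomial (CoordIndex c e) ℂ) :=
  constMat (CoordIndex c e) (G.K i) - genMat c e i * constMat (CoordIndex c e) (G.S i)

theorem evalMat_genInc (φ : Coord c e) (i : V) : evalMat φ (G.genInc i) = G.inc φ i := by
  simp only [genInc, evalMat_mul, evalMat_add, evalMat_constMat, evalMat_genMat, inc]

theorem evalMat_genProj (φ : Coord c e) (i : V) : evalMat φ (G.genProj i) = G.proj φ i := by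
  simp only [genProj, evalMat_mul, evalMat_sub, evalMat_constMat, evalMat_genMat, proj]

theorem derivMat_genInc (φ ψ : Coord c e) (i : V) :
    derivMat φ ψ (G.genInc i) = G.R i * matOf ψ i := by
  simp only [genInc, derivMat_mul, derivMat_add, derivMat_constMat, derivMat_genMat,
    evalMat_constMat, Matrix.zero_mul, zero_add, add_zero]

theorem derivMat_genProj (φ ψ : Coord c e) (i : V) :
    derivMat φ ψ (G.genProj i) = -(matOf ψ i * G.S i) := by
  simp only [genProj, derivMat_mul, derivMat_sub, derivMat_constMat, derivMat_genMat,
    evalMat_constMat, Matrix.mul_zero, zero_add, zero_sub]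

/-- The matrices of equations in `φ` expressing that its graph is a subrepresentation. -/
def eqnMat (M : QRep s t d) (a : A) : Matrix (Fin (c (t a))) (Fin (e (s a)))
    (MvPolynomial (CoordIndex c e) ℂ) :=
  G.genProj (t a) * constMat (CoordIndex c e) (M a) * G.genInc (s a)

theorem evalMat_eqnMat (M : QRep s t d) (φ : Coord c e) (a : A) :
    evalMat φ (G.eqnMat M a) = G.proj φ (t a) * M a * G.inc φ (s a) := by
  rw [eqnMat, evalMat_mul, evalMat_mul, evalMat_constMat, evalMat_genProj, evalMat_genInc]

theorem derivMat_eqnMat (M : QRep s t d) (φ ψ : Coord c e) (a : A) :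
    derivMat φ ψ (G.eqnMat M a) = G.proj φ (t a) * M a * (G.R (s a) * matOf ψ (s a)) -
      matOf ψ (t a) * G.S (t a) * M a * G.inc φ (s a) := by
  rw [eqnMat, derivMat_mul, derivMat_mul, evalMat_mul, evalMat_constMat, derivMat_constMat,
    evalMat_genProj, evalMat_genInc, derivMat_genProj, derivMat_genInc, Matrix.mul_zero, zero_add,
    Matrix.neg_mul, Matrix.neg_mul, sub_eq_add_neg]

/-- The equations in `φ` expressing that its graph is a subrepresentation. -/
def eqn (M : QRep s t d) (r : Σ a : A, Fin (c (t a)) × Fin (e (s a))) :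
    MvPolynomial (CoordIndex c e) ℂ := G.eqnMat M r.1 r.2.1 r.2.2

theorem eval_eqn_eq_zero_iff {M : QRep s t d} {φ : Coord c e} :
    (∀ r, eval φ (G.eqn M r) = 0) ↔ ∀ a, G.proj φ (t a) * M a * G.inc φ (s a) = 0 := by
  refine ⟨fun h a => ?_, fun h ⟨a, k, l⟩ => ?_⟩
  · rw [← evalMat_eqnMat]
    exact Matrix.ext fun k l => h ⟨a, (k, l)⟩
  · have h1 := congrFun (congrFun ((G.evalMat_eqnMat M φ a).trans (h a)) k) l
    exact h1

end Splitting

instance (s t : A → V) {d : V → ℕ} (M : QRep s t d) (e : V → ℕ) :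
    TopologicalSpace (StQ s t M e) :=
  TopologicalSpace.induced Subtype.val (zariski _)

theorem isInducing_toSpec_stQ (s t : A → V) {d : V → ℕ} (M : QRep s t d) (e : V → ℕ) :
    Topology.IsInducing fun F : StQ s t M e => toSpec F.1 :=
  ⟨induced_compose⟩

theorem continuous_toSub (s t : A → V) {d : V → ℕ} (M : QRep s t d) (e : V → ℕ) :
    Continuous (toSub s t M e) :=
  continuous_coinduced_rng

namespace Splitting

open MvPolynomial

variable {d e c : V → ℕ} (G : Splitting d e c) {s t : A → V} (M : QRep s t d)

theorem eval_eqn_eq_zero_iff_range {M : QRep s t d} {φ : Coord c e} :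
    (∀ r, eval φ (G.eqn M r) = 0) ↔
      ∀ a, (LinearMap.range (G.inc φ (s a)).mulVecLin).map (M a).mulVecLin ≤
        LinearMap.range (G.inc φ (t a)).mulVecLin := by
  rw [eval_eqn_eq_zero_iff]
  refine forall_congr' fun a => ?_
  rw [range_inc G φ (t a), ← LinearMap.range_comp, LinearMap.range_le_ker_iff, ← mulVecLin_mul,
    ← mulVecLin_mul, ← Matrix.mul_assoc]
  refine ⟨fun h => by rw [h, mulVecLin_zero], fun h => ?_⟩
  exact Matrix.toLin'.injective (h.trans (map_zero Matrix.toLin').symm)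

/-- The basis of the graph of `φ` given by the splitting. -/
def lift (φ : ZeroSet (G.eqn M)) : StQ s t M e :=
  ⟨fun r => G.inc φ.1 r.1 r.2.1 r.2.2, fun i => G.injective_inc φ.1 i,
    G.eval_eqn_eq_zero_iff_range.mp φ.2⟩

/-- The affine chart of the quiver Grassmannian consisting of graphs. -/
def chart (φ : ZeroSet (G.eqn M)) : SubRep s t M e := toSub s t M e (G.lift M φ)

theorem continuous_chart : Continuous (G.chart M) := by
  refine (continuous_toSub s t M e).comp ((isInducing_toSpec_stQ s t M e).continuous_iff.mpr ?_)
  refine continuous_toSpec_of_rational (fun φ : ZeroSet (G.eqn M) => φ.1)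
    (isInducing_toSpec_zeroSet (G.eqn M)).continuous _ fun r =>
      ⟨G.genInc r.1 r.2.1 r.2.2, 1, fun φ => ⟨?_, ?_⟩⟩
  · rw [map_one]
    exact one_ne_zero
  · rw [map_one, mul_one]
    exact (congrFun (congrFun (G.evalMat_genInc φ.1 r.1) r.2.1) r.2.2).symm

/-- The coordinates of the range of `F` in the chart. -/
def coords (F : Coord d e) : Coord c e := fun r =>
  (G.K r.1 * matOf F r.1 * (G.S r.1 * matOf F r.1)⁻¹) r.2.1 r.2.2

theorem matOf_coords (F : Coord d e) (i : V) :
    matOf (G.coords F) i = G.K i * matOf F i * (G.S i * matOf F i)⁻¹ := rfl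

theorem inc_coords_mul {F : Coord d e} {i : V} (h : (G.S i * matOf F i).det ≠ 0) :
    G.inc (G.coords F) i * (G.S i * matOf F i) = matOf F i := by
  rw [inc, matOf_coords, Matrix.add_mul, Matrix.mul_assoc (G.R i), Matrix.mul_assoc (G.K i * _),
    nonsing_inv_mul _ (isUnit_iff_ne_zero.mpr h), Matrix.mul_one, ← Matrix.mul_assoc,
    ← Matrix.mul_assoc, ← Matrix.add_mul, G.P_mul_S_add, Matrix.one_mul]

theorem range_inc_coords {F : Coord d e} {i : V} (h : (G.S i * matOf F i).det ≠ 0) :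
    LinearMap.range (G.inc (G.coords F) i).mulVecLin =
      LinearMap.range (matOf F i).mulVecLin := by
  have h1 := G.inc_coords_mul h
  have h2 : matOf F i * (G.S i * matOf F i)⁻¹ = G.inc (G.coords F) i := by
    conv_lhs => rw [← h1]
    rw [Matrix.mul_assoc, h1, mul_nonsing_inv _ (isUnit_iff_ne_zero.mpr h), Matrix.mul_one]
  refine le_antisymm ?_ ?_
  · rw [← h2, mulVecLin_mul]
    exact LinearMap.range_comp_le_range _ _
  · conv_lhs => rw [← h1, mulVecLin_mul]
    exact LinearMap.range_comp_le_range _ _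

theorem det_ne_zero_of_range_eq {F : Coord d e} {φ : Coord c e} {i : V}
    (hF : Function.Injective (matOf F i).mulVecLin)
    (h : LinearMap.range (matOf F i).mulVecLin = LinearMap.range (G.inc φ i).mulVecLin) :
    (G.S i * matOf F i).det ≠ 0 := by
  rw [← isUnit_iff_ne_zero, ← Matrix.isUnit_iff_isUnit_det, ← mulVec_injective_iff_isUnit]
  change Function.Injective (G.S i * matOf F i).mulVecLin
  rw [← LinearMap.ker_eq_bot, LinearMap.ker_eq_bot']
  intro u hu
  obtain ⟨w, hw⟩ : (matOf F i).mulVecLin u ∈ LinearMap.range (G.inc φ i).mulVecLin :=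
    h ▸ LinearMap.mem_range_self _ u
  have hw0 : w = 0 := by
    rw [mulVecLin_mul, LinearMap.comp_apply, ← hw, mulVecLin_apply, mulVecLin_apply, mulVec_mulVec,
      S_mul_inc, one_mulVec] at hu
    exact hu
  rw [hw0, map_zero] at hw
  exact hF (hw.symm.trans (map_zero _).symm)

theorem matOf_eq_of_range_eq {F : Coord d e} {φ : Coord c e} {i : V}
    (hF : Function.Injective (matOf F i).mulVecLin)
    (h : LinearMap.range (matOf F i).mulVecLin = LinearMap.range (G.inc φ i).mulVecLin) :
    matOf (G.coords F) i = matOf φ i := by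
  have h1 : G.proj φ i * matOf F i = 0 := by
    refine Matrix.toLin'.injective (Eq.trans ?_ (map_zero Matrix.toLin').symm)
    change (G.proj φ i * matOf F i).mulVecLin = 0
    rw [mulVecLin_mul, ← LinearMap.range_le_ker_iff, h, range_inc]
  rw [proj, Matrix.sub_mul, sub_eq_zero, Matrix.mul_assoc] at h1
  rw [matOf_coords, h1, Matrix.mul_assoc, mul_nonsing_inv _
    (isUnit_iff_ne_zero.mpr (G.det_ne_zero_of_range_eq hF h)), Matrix.mul_one]

/-- The bases of subrepresentations in the image of the chart. -/
def domain : Set (StQ s t M e) := {F | ∀ i, (G.S i * matOf F.1 i).det ≠ 0}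

/-- The matrices with polynomial entries whose values are the `S i * matOf F i`. -/
def genMinor (i : V) : Matrix (Fin (e i)) (Fin (e i)) (MvPolynomial (CoordIndex d e) ℂ) :=
  constMat (CoordIndex d e) (G.S i) * genMat d e i

theorem evalMat_genMinor (F : Coord d e) (i : V) :
    evalMat F (G.genMinor i) = G.S i * matOf F i := by
  rw [genMinor, evalMat_mul, evalMat_constMat, evalMat_genMat]

theorem eval_det_genMinor (F : Coord d e) (i : V) :
    eval F (G.genMinor i).det = (G.S i * matOf F i).det := by
  rw [RingHom.map_det, ← evalMat_genMinor]
  rfl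

theorem evalMat_adjugate_genMinor (F : Coord d e) (i : V) :
    evalMat F (G.genMinor i).adjugate = (G.S i * matOf F i).adjugate := by
  rw [← evalMat_genMinor]
  exact RingHom.map_adjugate (eval F) _

theorem isOpen_domain [Finite V] : IsOpen (G.domain M) := by
  rw [domain, Set.ofPred_forall]
  refine isOpen_iInter_of_finite fun i => ?_
  have h := (PrimeSpectrum.isOpen_basicOpen (a := (G.genMinor i).det)).preimage
    (isInducing_toSpec_stQ s t M e).continuous
  refine (congrArg IsOpen (Set.ext fun F => ?_)).mp h
  exact not_congr (Eq.congr_left (G.eval_det_genMinor F.1 i))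

/-- The coordinates of a basis in the domain of the chart. -/
def retract (F : G.domain M) : ZeroSet (G.eqn M) :=
  ⟨G.coords F.1.1, G.eval_eqn_eq_zero_iff_range.mpr fun a => by
    rw [G.range_inc_coords (F.2 _), G.range_inc_coords (F.2 _)]
    exact F.1.2.2 a⟩

theorem continuous_retract : Continuous (G.retract M) := by
  refine (isInducing_toSpec_zeroSet (G.eqn M)).continuous_iff.mpr ?_
  refine continuous_toSpec_of_rational (fun F : G.domain M => F.1.1)
    ((isInducing_toSpec_stQ s t M e).continuous.comp continuous_subtype_val) _ fun r =>
      ⟨(constMat (CoordIndex d e) (G.K r.1) * genMat d e r.1 * (G.genMinor r.1).adjugate)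
        r.2.1 r.2.2, (G.genMinor r.1).det, fun F => ?_⟩
  have h1 : evalMat F.1.1
      (constMat (CoordIndex d e) (G.K r.1) * genMat d e r.1 * (G.genMinor r.1).adjugate) =
      G.K r.1 * matOf F.1.1 r.1 * (G.S r.1 * matOf F.1.1 r.1).adjugate := by
    rw [evalMat_mul, evalMat_mul, evalMat_constMat, evalMat_genMat, evalMat_adjugate_genMinor]
  replace h1 := congrFun (congrFun h1 r.2.1) r.2.2
  have h0 := F.2 r.1
  refine ⟨(G.eval_det_genMinor F.1.1 r.1).trans_ne h0, Eq.trans ?_ h1.symm⟩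
  change (G.K r.1 * matOf F.1.1 r.1 * (G.S r.1 * matOf F.1.1 r.1)⁻¹) r.2.1 r.2.2 * _ = _
  rw [eval_det_genMinor, Matrix.inv_def, Matrix.mul_smul, Matrix.smul_apply, Ring.inverse_eq_inv',
    smul_eq_mul, mul_right_comm, inv_mul_cancel₀ h0, one_mul]

theorem toSub_eq_chart_iff {F : StQ s t M e} {φ : ZeroSet (G.eqn M)} :
    toSub s t M e F = G.chart M φ ↔ ∃ h : F ∈ G.domain M, G.retract M ⟨F, h⟩ = φ := by
  refine ⟨fun h => ?_, ?_⟩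
  · have h1 : ∀ i, LinearMap.range (matOf F.1 i).mulVecLin =
        LinearMap.range (G.inc φ.1 i).mulVecLin := fun i => congrFun (congrArg Subtype.val h) i
    refine ⟨fun i => G.det_ne_zero_of_range_eq (F.2.1 i) (h1 i), Subtype.ext (funext fun r => ?_)⟩
    exact congrFun (congrFun (G.matOf_eq_of_range_eq (F.2.1 r.1) (h1 r.1)) r.2.1) r.2.2
  · rintro ⟨h, rfl⟩
    exact Subtype.ext (funext fun i => (G.range_inc_coords (h i)).symm)

theorem isOpenEmbedding_chart [Finite V] : Topology.IsOpenEmbedding (G.chart M) := by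
  refine .of_continuous_injective_isOpenMap (G.continuous_chart M) (fun φ ψ h => ?_)
    fun W hW => ?_
  · obtain ⟨_, h1⟩ := (G.toSub_eq_chart_iff M).mp h
    obtain ⟨_, h2⟩ := (G.toSub_eq_chart_iff M (F := G.lift M φ) (φ := φ)).mp rfl
    exact h2.symm.trans h1
  · have h : toSub s t M e ⁻¹' (G.chart M '' W) = Subtype.val '' (G.retract M ⁻¹' W) := by
      ext F
      constructor
      · rintro ⟨φ, hφ, h⟩
        obtain ⟨h1, rfl⟩ := (G.toSub_eq_chart_iff M).mp h.symm
        exact ⟨⟨F, h1⟩, hφ, rfl⟩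
      · rintro ⟨⟨F, h1⟩, hφ, rfl⟩
        exact ⟨_, hφ, ((G.toSub_eq_chart_iff M).mpr ⟨h1, rfl⟩).symm⟩
    refine isOpen_coinduced.mpr ((congrArg IsOpen h).mpr ?_)
    exact (G.isOpen_domain M).isOpenMap_subtype_val _ (hW.preimage (G.continuous_retract M))

end Splitting

theorem Submodule.exists_matrix_splitting {d e : ℕ} (N : Submodule ℂ (Fin d → ℂ))
    (hN : Module.finrank ℂ N = e) :
    ∃ (P : Matrix (Fin d) (Fin e) ℂ) (R : Matrix (Fin d) (Fin (d - e)) ℂ)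
      (S : Matrix (Fin e) (Fin d) ℂ) (K : Matrix (Fin (d - e)) (Fin d) ℂ),
      (S * P = 1 ∧ S * R = 0 ∧ K * P = 0 ∧ K * R = 1 ∧ P * S + R * K = 1) ∧
        LinearMap.range P.mulVecLin = N := by
  obtain ⟨W, hW⟩ := N.exists_isCompl
  have hd : Module.finrank ℂ W = d - e := by
    have h1 := Submodule.finrank_add_eq_of_isCompl hW
    rw [hN, Module.finrank_fin_fun] at h1
    omega
  let f : N ≃ₗ[ℂ] (Fin e → ℂ) := LinearEquiv.ofFinrankEq _ _ (by rw [hN, Module.finrank_fin_fun])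
  let g : W ≃ₗ[ℂ] (Fin (d - e) → ℂ) :=
    LinearEquiv.ofFinrankEq _ _ (by rw [hd, Module.finrank_fin_fun])
  let Φ : ((Fin e → ℂ) × (Fin (d - e) → ℂ)) ≃ₗ[ℂ] (Fin d → ℂ) :=
    (f.prodCongr g).symm.trans (N.prodEquivOfIsCompl W hW)
  refine ⟨LinearMap.toMatrix' (Φ.toLinearMap ∘ₗ LinearMap.inl ℂ _ _),
    LinearMap.toMatrix' (Φ.toLinearMap ∘ₗ LinearMap.inr ℂ _ _),
    LinearMap.toMatrix' (LinearMap.fst ℂ _ _ ∘ₗ Φ.symm.toLinearMap),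
    LinearMap.toMatrix' (LinearMap.snd ℂ _ _ ∘ₗ Φ.symm.toLinearMap), ⟨?_, ?_, ?_, ?_, ?_⟩, ?_⟩
  · rw [← LinearMap.toMatrix'_comp, ← LinearMap.toMatrix'_id]
    exact congrArg _ (LinearMap.ext fun x => by simp)
  · rw [← LinearMap.toMatrix'_comp, ← map_zero LinearMap.toMatrix']
    exact congrArg _ (LinearMap.ext fun x => by simp)
  · rw [← LinearMap.toMatrix'_comp, ← map_zero LinearMap.toMatrix']
    exact congrArg _ (LinearMap.ext fun x => by simp)
  · rw [← LinearMap.toMatrix'_comp, ← LinearMap.toMatrix'_id]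
    exact congrArg _ (LinearMap.ext fun x => by simp)
  · rw [← LinearMap.toMatrix'_comp, ← LinearMap.toMatrix'_comp, ← map_add,
      ← LinearMap.toMatrix'_id]
    refine congrArg _ (LinearMap.ext fun x => ?_)
    change Φ ((Φ.symm x).1, 0) + Φ (0, (Φ.symm x).2) = x
    rw [← map_add, Prod.mk_add_mk, add_zero, zero_add, Prod.mk.eta, LinearEquiv.apply_symm_apply]
  · rw [← Matrix.toLin'_apply', Matrix.toLin'_toMatrix']
    ext x
    refine ⟨?_, fun hx => ⟨f ⟨x, hx⟩, ?_⟩⟩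
    · rintro ⟨u, rfl⟩
      simp [Φ]
    · simp [Φ]

namespace Splitting

open MvPolynomial

variable {d e c : V → ℕ} {s t : A → V}

theorem exists_range_eq (N : ∀ i : V, Submodule ℂ (Fin (d i) → ℂ))
    (hN : ∀ i, Module.finrank ℂ (N i) = e i) :
    ∃ G : Splitting d e fun i => d i - e i, ∀ i, LinearMap.range (G.P i).mulVecLin = N i := by
  choose P R S K h hP using fun i => (N i).exists_matrix_splitting (hN i)
  exact ⟨⟨P, R, S, K, fun i => (h i).1, fun i => (h i).2.1, fun i => (h i).2.2.1,
    fun i => (h i).2.2.2.1, fun i => (h i).2.2.2.2⟩, hP⟩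

theorem exists_mem_range_chart {M : QRep s t d} (x : SubRep s t M e) :
    ∃ G : Splitting d e fun i => d i - e i, x ∈ Set.range (G.chart M) := by
  obtain ⟨N, hN, hM⟩ := x
  obtain ⟨G, hG⟩ := exists_range_eq N hN
  have h0 : ∀ i, LinearMap.range (G.inc 0 i).mulVecLin = N i := fun i => by
    rw [← hG, inc]
    have : matOf (0 : Coord (fun i => d i - e i) e) i = 0 := rfl
    rw [this, Matrix.mul_zero, add_zero]
  exact ⟨G, ⟨0, G.eval_eqn_eq_zero_iff_range.mpr fun a => by rw [h0, h0]; exact hM a⟩,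
    Subtype.ext (funext h0)⟩

theorem surjective_dirDeriv_eqn (G : Splitting d e c) (M : QRep s t d) {φ : Coord c e}
    (hN : ∀ a, (LinearMap.range (G.inc φ (s a)).mulVecLin).map (M a).mulVecLin ≤
      LinearMap.range (G.inc φ (t a)).mulVecLin)
    (hext : QuiverRep.ExtZero
      (QuiverRep.subOf (X := M) (N := fun i => LinearMap.range (G.inc φ i).mulVecLin) hN)
      (QuiverRep.quotOf (X := M) (N := fun i => LinearMap.range (G.inc φ i).mulVecLin) hN)) :
    Function.Surjective fun (v : Coord c e) r => dirDeriv φ v (G.eqn M r) := by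
  intro η
  let η' (a : A) : Matrix (Fin (c (t a))) (Fin (e (s a))) ℂ := fun k l => η ⟨a, (k, l)⟩
  obtain ⟨h, hh⟩ := hext fun a =>
    (LinearMap.range (G.inc φ (t a)).mulVecLin).mkQ ∘ₗ
      (G.R (t a) * η' a * G.S (s a)).mulVecLin ∘ₗ
        (LinearMap.range (G.inc φ (s a)).mulVecLin).subtype
  let κ (i : V) : ((Fin (d i) → ℂ) ⧸ LinearMap.range (G.inc φ i).mulVecLin) →ₗ[ℂ] (Fin (c i) → ℂ) :=
    (LinearMap.range (G.inc φ i).mulVecLin).liftQ (G.proj φ i).mulVecLin (G.range_inc φ i).le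
  let ψ (i : V) : (Fin (e i) → ℂ) →ₗ[ℂ] (Fin (c i) → ℂ) :=
    κ i ∘ₗ h i ∘ₗ (G.inc φ i).mulVecLin.rangeRestrict
  have h0 := G.eval_eqn_eq_zero_iff.mp (G.eval_eqn_eq_zero_iff_range.mpr hN)
  let v : Coord c e := fun r => LinearMap.toMatrix' (ψ r.1) r.2.1 r.2.2
  have hv (i : V) : (matOf v i).mulVecLin = ψ i := Matrix.toLin'_toMatrix' (ψ i)
  have key (a : A) : derivMat φ v (G.eqnMat M a) = η' a := by
    rw [derivMat_eqnMat]
    refine Matrix.toLin'.injective (LinearMap.ext fun u => ?_)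
    simp only [Matrix.toLin'_apply, sub_mulVec, ← mulVec_mulVec]
    rw [← mulVecLin_apply (matOf v _), ← mulVecLin_apply (matOf v _), hv, hv]
    have hu := (congrArg (κ (t a)) (hh a ⟨G.inc φ (s a) *ᵥ u, u, rfl⟩)).trans
      (map_sub (κ (t a)) _ _)
    have h1 : κ (t a) ((LinearMap.range (G.inc φ (t a)).mulVecLin).mkQ
        ((G.R (t a) * η' a * G.S (s a)) *ᵥ (G.inc φ (s a) *ᵥ u))) = η' a *ᵥ u := by
      change G.proj φ (t a) *ᵥ _ = _
      rw [mulVec_mulVec, mulVec_mulVec, Matrix.mul_assoc (G.proj φ _),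
        Matrix.mul_assoc (G.R _ * η' a), S_mul_inc, Matrix.mul_one, ← Matrix.mul_assoc, proj_mul_R,
        Matrix.one_mul]
    refine Eq.trans ?_ (hu.symm.trans h1)
    refine congrArg₂ (· - ·) ?_ ?_
    · obtain ⟨z, hz⟩ := Submodule.mkQ_surjective _ (h (s a) ⟨G.inc φ (s a) *ᵥ u, u, rfl⟩)
      have h2 : ψ (s a) u = G.proj φ (s a) *ᵥ z := (congrArg (κ (s a)) hz).symm
      have h3 : G.R (s a) *ᵥ (G.proj φ (s a) *ᵥ z) =
          z - G.inc φ (s a) *ᵥ (G.S (s a) *ᵥ z) := by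
        rw [mulVec_mulVec, mulVec_mulVec, eq_sub_iff_add_eq', ← add_mulVec, inc_mul_S_add,
          one_mulVec]
      have h4 : G.proj φ (t a) *ᵥ (M a *ᵥ (G.inc φ (s a) *ᵥ (G.S (s a) *ᵥ z))) = 0 := by
        rw [mulVec_mulVec, mulVec_mulVec, h0 a, zero_mulVec]
      rw [h2, h3, mulVec_sub, mulVec_sub, h4, sub_zero, ← hz]
      rfl
    · refine congrArg (fun y => κ (t a) (h (t a) y)) (Subtype.ext ?_)
      change G.inc φ (t a) *ᵥ (G.S (t a) *ᵥ (M a *ᵥ (G.inc φ (s a) *ᵥ u))) =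
        M a *ᵥ (G.inc φ (s a) *ᵥ u)
      have h5 : G.proj φ (t a) *ᵥ (M a *ᵥ (G.inc φ (s a) *ᵥ u)) = 0 := by
        rw [mulVec_mulVec, mulVec_mulVec, h0 a, zero_mulVec]
      have h6 := congrArg (fun B => B *ᵥ (M a *ᵥ (G.inc φ (s a) *ᵥ u))) (G.inc_mul_S_add φ (t a))
      simp only [add_mulVec, one_mulVec] at h6
      rw [← mulVec_mulVec, ← mulVec_mulVec, h5, mulVec_zero, add_zero] at h6
      exact h6
  refine ⟨v, funext fun r => ?_⟩
  exact congrFun (congrFun (key r.1) r.2.1) r.2.2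

end Splitting

theorem WithBot.eq_of_add_natCast_eq {x y : WithBot ℕ∞} (n : ℕ)
    (h : x + (n : WithBot ℕ∞) = y + (n : WithBot ℕ∞)) : x = y := by
  induction x with
  | bot => induction y with
    | bot => rfl
    | coe y => exact absurd h (WithBot.coe_ne_bot (a := y + (n : ℕ∞))).symm
  | coe x => induction y with
    | bot => exact absurd h (WithBot.coe_ne_bot (a := x + (n : ℕ∞)))
    | coe y =>
      have h1 : x + (n : ℕ∞) = y + (n : ℕ∞) := WithBot.coe_injective h
      exact congrArg _ (ENat.add_left_injective_of_ne_top (ENat.natCast_ne_top n) h1)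

theorem Splitting.topologicalKrullDim_zeroSet_eqn_add [Fintype V] [Fintype A] {d e c : V → ℕ}
    {s t : A → V} (G : Splitting d e c) (M : QRep s t d)
    (h : ∀ x : SubRep s t M e, QuiverRep.ExtZero (QuiverRep.subOf x.2.2) (QuiverRep.quotOf x.2.2))
    (hne : Nonempty (ZeroSet (G.eqn M))) :
    topologicalKrullDim (ZeroSet (G.eqn M)) + ((∑ a, e (s a) * c (t a) : ℕ) : WithBot ℕ∞) =
      ((∑ i, e i * c i : ℕ) : WithBot ℕ∞) := by
  have h1 := ringKrullDim_quotient_add_card (G.eqn M) (hne.elim fun φ => ⟨φ.1, φ.2⟩)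
    fun φ hφ => G.surjective_dirDeriv_eqn M (G.eval_eqn_eq_zero_iff_range.mp hφ)
      (h (G.chart M ⟨φ, hφ⟩))
  rw [topologicalKrullDim_zeroSet]
  simpa only [Fintype.card_sigma, Fintype.card_prod, Fintype.card_fin, mul_comm] using h1

/-- A quiver Grassmannian without obstructions has the expected dimension. -/
theorem topologicalKrullDim_subRep_add [Fintype V] [Fintype A] {d e : V → ℕ} {s t : A → V}
    (M : QRep s t d)
    (h : ∀ x : SubRep s t M e, QuiverRep.ExtZero (QuiverRep.subOf x.2.2) (QuiverRep.quotOf x.2.2))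
    (hne : Nonempty (SubRep s t M e)) :
    topologicalKrullDim (SubRep s t M e) +
        ((∑ a, e (s a) * (d (t a) - e (t a)) : ℕ) : WithBot ℕ∞) =
      ((∑ i, e i * (d i - e i) : ℕ) : WithBot ℕ∞) := by
  have hchart : ∀ x : SubRep s t M e, ∃ G : Splitting d e fun i => d i - e i,
      x ∈ Set.range (G.chart M) ∧ topologicalKrullDim (ZeroSet (G.eqn M)) +
        ((∑ a, e (s a) * (d (t a) - e (t a)) : ℕ) : WithBot ℕ∞) =
          ((∑ i, e i * (d i - e i) : ℕ) : WithBot ℕ∞) := fun x => by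
    obtain ⟨G, hG⟩ := Splitting.exists_mem_range_chart x
    exact ⟨G, hG, G.topologicalKrullDim_zeroSet_eqn_add M h ⟨hG.choose⟩⟩
  obtain ⟨G₀, -, h₀⟩ := hchart hne.some
  rw [topologicalKrullDim_eq_of_openEmbeddings (topologicalKrullDim (ZeroSet (G₀.eqn M))), h₀]
  intro x
  obtain ⟨G, hG, h₁⟩ := hchart x
  exact ⟨_, _, G.chart M, G.isOpenEmbedding_chart M, hG,
    WithBot.eq_of_add_natCast_eq _ (h₁.trans h₀.symm)⟩

/-- `Gr_e(M ⊕ τM)` is smooth of dimension `⟨e, d−e⟩` for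
`e ≠ dim M`. -/
theorem subRep_dsum_tau_smooth [Fintype V] [Fintype A] (s t : A → V)
    (hQ : IsDynkin s t) (dT dE dM : V → ℕ)
    (T : QRep s t dT) (E : QRep s t dE) (M : QRep s t dM)
    (f : RHom s t T E) (g : RHom s t E M) (has : IsAlmostSplit s t f g)
    (e : V → ℕ) (hne : e ≠ dM)
    (hnonempty : Nonempty (SubRep s t (dsum s t M T) e)) :
    (∀ x : SubRep s t (dsum s t M T) e,
      Module.finrank ℂ (TangentSp s t (dsum s t M T) x) +
          ∑ a : A, e (s a) * ((dM (t a) + dT (t a)) - e (t a)) =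
        ∑ i : V, e i * ((dM i + dT i) - e i)) ∧
    topologicalKrullDim (SubRep s t (dsum s t M T) e) +
        (((∑ a : A, e (s a) * ((dM (t a) + dT (t a)) - e (t a)) : ℕ) : ℕ∞) : WithBot ℕ∞) =
      (((∑ i : V, e i * ((dM i + dT i) - e i) : ℕ) : ℕ∞) : WithBot ℕ∞) := by
  have hext : ∀ x : SubRep s t (dsum s t M T) e,
      QuiverRep.ExtZero (QuiverRep.subOf x.2.2) (QuiverRep.quotOf x.2.2) := fun x =>
    QuiverRep.extZero_subOf_quotOf hQ has x.2.2 fun h =>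
      hne ((funext fun i => (x.2.1 i).symm).trans h)
  exact ⟨fun x => QuiverRep.finrank_tangentSp_add x (hext x),
    topologicalKrullDim_subRep_add (dsum s t M T) hext hnonempty⟩

end
end

section
/- Let M be an indecomposable non-projective representation of a Dynkin quiver Q with Auslander–Reiten translate τM. Then g_M + g_{τM} + B·(dim M) = 0, where B = H − Hᵗ is the exchange matrix of Q and g_X = −H·dim X is the g-vector. -/
/-!
STATEMENT 19: Let M be an indecomposable non-projective representation of a Dynkin
quiver Q over ℂ with Auslander–Reiten translate τM (i.e. there is an almost split
sequence `0 → τM → E → M → 0`).  Then `g_M + g_{τM} + B · (dim M) = 0`, where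
`B = H − Hᵗ` is the exchange matrix of Q, H is the Euler matrix
(`H i i = 1`, `H i j = −#{arrows i→j}`), and `g_X = −H · dim X` is the g-vector.

A quiver is Dynkin iff its Tits form is positive definite.
-/

noncomputable section
open Matrix

variable {V A : Type}

/-- The Euler matrix of the quiver: `H i i = 1`, `H i j = −#{arrows i → j}`
off the diagonal (a Dynkin quiver has no loops). -/
def eulerMat [Fintype V] [Fintype A] [DecidableEq V] (s t : A → V) : Matrix V V ℤ :=
  Matrix.of fun i j =>
    (if i = j then 1 else 0) - (Fintype.card {a : A // s a = i ∧ t a = j} : ℤ)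

/-- The exchange matrix `B = H − Hᵗ` of the quiver. -/
def exchMat [Fintype V] [Fintype A] [DecidableEq V] (s t : A → V) : Matrix V V ℤ :=
  eulerMat s t - (eulerMat s t)ᵀ

/-- The g-vector `g_X = −H · dim X` of a representation of dimension vector `x`. -/
def gvec [Fintype V] [Fintype A] [DecidableEq V] (s t : A → V) (x : V → ℕ) : V → ℤ :=
  -((eulerMat s t).mulVec fun k => (x k : ℤ))

section LinearAlgebra

variable {k U D M X T : Type*} [Field k] [AddCommGroup U] [Module k U]
  [AddCommGroup D] [Module k D] [AddCommGroup M] [Module k M]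
  [AddCommGroup X] [Module k X] [AddCommGroup T] [Module k T]

/-- Two subspaces which are each other's orthogonal complement in the sense of the hypotheses
have complementary dimensions. -/
theorem finrank_add_finrank_eq_of_nondegenerate [FiniteDimensional k U] [FiniteDimensional k D]
    (β : U →ₗ[k] D →ₗ[k] k) (K : Submodule k U) (R : Submodule k D)
    (hKR : ∀ u ∈ K, ∀ d ∈ R, β u d = 0)
    (hK : ∀ u ∈ K, u ≠ 0 → ∃ d, β u d ≠ 0)
    (hR : ∀ d ∉ R, ∃ u ∈ K, β u d ≠ 0) :
    Module.finrank k K + Module.finrank k R = Module.finrank k D := by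
  let γ : K →ₗ[k] D →ₗ[k] k := β ∘ₗ K.subtype
  have hinj : Function.Injective γ := by
    rw [injective_iff_map_eq_zero]
    intro u hu
    by_contra hne
    obtain ⟨d, hd⟩ := hK u u.2 (by simpa using hne)
    exact hd (LinearMap.congr_fun hu d)
  have hsurj : Function.Surjective γ.flip := LinearMap.flip_surjective_iff₁.mpr hinj
  have hker : LinearMap.ker γ.flip = R := by
    ext d
    refine ⟨fun hd => ?_, fun hd => ?_⟩
    · by_contra hdR
      obtain ⟨u, hu, hne⟩ := hR d hdR
      exact hne (LinearMap.congr_fun (LinearMap.mem_ker.mp hd) ⟨u, hu⟩)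
    · exact LinearMap.mem_ker.mpr (LinearMap.ext fun u => hKR u u.2 d hd)
  have hrank := γ.flip.finrank_range_add_finrank_ker
  rw [hker, LinearMap.range_eq_top.mpr hsurj, finrank_top] at hrank
  rwa [← Subspace.dual_finrank_eq (K := k) (V := K)]

theorem LinearMap.exists_comp_eq_of_ker_le_s19 (h : M →ₗ[k] X) (q : M →ₗ[k] T)
    (hq : ∀ v, h v = 0 → q v = 0) : ∃ d : X →ₗ[k] T, ∀ v, d (h v) = q v := by
  obtain ⟨r, hr⟩ := h.rangeRestrict.exists_rightInverse_of_surjective h.range_rangeRestrict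
  obtain ⟨d, hd⟩ := LinearMap.exists_extend (q ∘ₗ r)
  refine ⟨d, fun v => ?_⟩
  have h₁ : d (h v) = q (r (h.rangeRestrict v)) := LinearMap.congr_fun hd (h.rangeRestrict v)
  have h₂ : h (r (h.rangeRestrict v)) = h v :=
    congrArg Subtype.val (LinearMap.congr_fun hr (h.rangeRestrict v))
  rw [h₁, ← sub_eq_zero, ← map_sub]
  exact hq _ (by rw [map_sub, h₂, sub_self])

theorem LinearMap.exists_comp_eq_of_range_le (f : X →ₗ[k] M) (q : T →ₗ[k] M)
    (hq : ∀ v, ∃ x, f x = q v) : ∃ w : T →ₗ[k] X, ∀ v, f (w v) = q v := by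
  obtain ⟨r, hr⟩ := f.rangeRestrict.exists_rightInverse_of_surjective f.range_rangeRestrict
  exact ⟨r ∘ₗ q.codRestrict (LinearMap.range f) hq,
    fun v => congrArg Subtype.val (LinearMap.congr_fun hr ⟨q v, hq v⟩)⟩

end LinearAlgebra

section Extensions

variable {k : Type} [Field k] (s t : A → V)
  {M : V → Type} [∀ i, AddCommGroup (M i)] [∀ i, Module k (M i)]
  {T : V → Type} [∀ i, AddCommGroup (T i)] [∀ i, Module k (T i)]
  {X : V → Type} [∀ i, AddCommGroup (X i)] [∀ i, Module k (X i)]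
  {Y : V → Type} [∀ i, AddCommGroup (Y i)] [∀ i, Module k (Y i)]

/-- The differential of the standard complex of two representations of the quiver: its kernel is
`Hom(X, Y)` and its cokernel is `Ext¹(X, Y)`. -/
def extDiff (x : ∀ a, X (s a) →ₗ[k] X (t a)) (y : ∀ a, Y (s a) →ₗ[k] Y (t a)) :
    (∀ i, X i →ₗ[k] Y i) →ₗ[k] (∀ a, X (s a) →ₗ[k] Y (t a)) where
  toFun f a := y a ∘ₗ f (s a) - f (t a) ∘ₗ x a
  map_add' f g := by
    ext a v
    simp only [Pi.add_apply, LinearMap.sub_apply, LinearMap.comp_apply, LinearMap.add_apply,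
      map_add]
    abel
  map_smul' r f := by
    ext a v
    simp [smul_sub]

variable {s t}

theorem mem_ker_extDiff {x : ∀ a, X (s a) →ₗ[k] X (t a)} {y : ∀ a, Y (s a) →ₗ[k] Y (t a)}
    {f : ∀ i, X i →ₗ[k] Y i} :
    f ∈ LinearMap.ker (extDiff s t x y) ↔ ∀ a v, y a (f (s a) v) = f (t a) (x a v) := by
  simp [extDiff, funext_iff, LinearMap.ext_iff, sub_eq_zero]

theorem mem_range_extDiff {x : ∀ a, X (s a) →ₗ[k] X (t a)} {y : ∀ a, Y (s a) →ₗ[k] Y (t a)}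
    {d : ∀ a, X (s a) →ₗ[k] Y (t a)} :
    d ∈ LinearMap.range (extDiff s t x y) ↔
      ∃ f : ∀ i, X i →ₗ[k] Y i, ∀ a v, y a (f (s a) v) - f (t a) (x a v) = d a v := by
  simp [extDiff, funext_iff, LinearMap.ext_iff]

/-- Pulling back a cocycle along a family of linear maps. -/
def pullback (s : A → V) (t : A → V) : (∀ i, M i →ₗ[k] X i) →ₗ[k]
    (∀ a, X (s a) →ₗ[k] T (t a)) →ₗ[k] (∀ a, M (s a) →ₗ[k] T (t a)) :=
  LinearMap.mk₂ k (fun h d a => d a ∘ₗ h (s a))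
    (fun _ _ _ => by ext; simp) (fun _ _ _ => by ext; simp)
    (fun _ _ _ => by ext; simp) (fun _ _ _ => by ext; simp)

/-- Pushing out a cocycle along a family of linear maps. -/
def pushout (s : A → V) (t : A → V) : (∀ i, X i →ₗ[k] T i) →ₗ[k]
    (∀ a, M (s a) →ₗ[k] X (t a)) →ₗ[k] (∀ a, M (s a) →ₗ[k] T (t a)) :=
  LinearMap.mk₂ k (fun h d a => h (t a) ∘ₗ d a)
    (fun _ _ _ => by ext; simp) (fun _ _ _ => by ext; simp)
    (fun _ _ _ => by ext; simp) (fun _ _ _ => by ext; simp)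

@[simp]
theorem pullback_apply (h : ∀ i, M i →ₗ[k] X i) (d : ∀ a, X (s a) →ₗ[k] T (t a)) (a : A)
    (v : M (s a)) : pullback s t h d a v = d a (h (s a) v) := rfl

@[simp]
theorem pushout_apply (h : ∀ i, X i →ₗ[k] T i) (d : ∀ a, M (s a) →ₗ[k] X (t a)) (a : A)
    (v : M (s a)) : pushout s t h d a v = h (t a) (d a v) := rfl

/-- The extension of `M` by `X` described by a cocycle. -/
def extRep (x : ∀ a, X (s a) →ₗ[k] X (t a)) (m : ∀ a, M (s a) →ₗ[k] M (t a))
    (d : ∀ a, M (s a) →ₗ[k] X (t a)) (a : A) : X (s a) × M (s a) →ₗ[k] X (t a) × M (t a) :=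
  (x a ∘ₗ LinearMap.fst k _ _ + d a ∘ₗ LinearMap.snd k _ _).prod (m a ∘ₗ LinearMap.snd k _ _)

@[simp]
theorem extRep_apply (x : ∀ a, X (s a) →ₗ[k] X (t a)) (m : ∀ a, M (s a) →ₗ[k] M (t a))
    (d : ∀ a, M (s a) →ₗ[k] X (t a)) (a : A) (v : X (s a) × M (s a)) :
    extRep x m d a v = (x a v.1 + d a v.2, m a v.2) := rfl

variable (m : ∀ a, M (s a) →ₗ[k] M (t a)) (τ : ∀ a, T (s a) →ₗ[k] T (t a))

/-- The cocycle `c` describes an extension of `M` by `T` which is nonsplit and right almost split,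
and every endomorphism of `T` is nilpotent or injective. -/
structure IsAlmostSplitCocycle (c : ∀ a, M (s a) →ₗ[k] T (t a)) : Prop where
  notMem : c ∉ LinearMap.range (extDiff s t m τ)
  pullback_mem : ∀ (X : V → Type) [∀ i, AddCommGroup (X i)] [∀ i, Module k (X i)]
    [∀ i, FiniteDimensional k (X i)] (x : ∀ a, X (s a) →ₗ[k] X (t a)),
    ∀ h ∈ LinearMap.ker (extDiff s t x m),
      (¬ ∃ r ∈ LinearMap.ker (extDiff s t m x), ∀ i v, h i (r i v) = v) →
        pullback s t h c ∈ LinearMap.range (extDiff s t x τ)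
  nilpotent_or_injective : ∀ θ ∈ LinearMap.ker (extDiff s t τ τ),
    (∃ n : ℕ, ∀ i, (θ i) ^ n = 0) ∨ ∀ i, Function.Injective (θ i)

namespace IsAlmostSplitCocycle

variable {m τ} {c : ∀ a, M (s a) →ₗ[k] T (t a)} {x : ∀ a, X (s a) →ₗ[k] X (t a)}

theorem exists_pullback_sub_mem_of_ne_zero
    [∀ i, FiniteDimensional k (M i)]
    (hc : IsAlmostSplitCocycle m τ c)
    {h : ∀ i, M i →ₗ[k] X i} (hh : h ∈ LinearMap.ker (extDiff s t m x)) (hne : h ≠ 0) :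
    ∃ d, pullback s t h d - c ∈ LinearMap.range (extDiff s t m τ) := by
  rw [mem_ker_extDiff] at hh
  have hm : ∀ a, ∀ v ∈ LinearMap.ker (h (s a)), m a v ∈ LinearMap.ker (h (t a)) := by
    intro a v hv
    rw [LinearMap.mem_ker] at hv ⊢
    rw [← hh, hv, map_zero]
  obtain ⟨f, hf⟩ := mem_range_extDiff.mp <|
    hc.pullback_mem (fun i => LinearMap.ker (h i)) (fun a => (m a).restrict (hm a))
      (fun i => (LinearMap.ker (h i)).subtype) (mem_ker_extDiff.mpr fun a v => rfl) (by
        rintro ⟨r, -, hr⟩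
        refine hne (funext fun i => LinearMap.ext fun v => ?_)
        rw [← hr i v]
        exact (r i v).2)
  choose f' hf' using fun i => LinearMap.exists_extend (f i)
  have hf'' : ∀ i (v : M i) (hv : v ∈ LinearMap.ker (h i)), f' i v = f i ⟨v, hv⟩ :=
    fun i v hv => LinearMap.congr_fun (hf' i) ⟨v, hv⟩
  choose d hd using fun a =>
    LinearMap.exists_comp_eq_of_ker_le_s19 (h (s a)) (c a - extDiff s t m τ f' a) (by
      intro v hv
      have := hf a ⟨v, hv⟩
      simp only [extDiff, LinearMap.coe_mk, AddHom.coe_mk, LinearMap.sub_apply,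
        LinearMap.comp_apply, hf'' _ v hv, hf'' _ (m a v) (hm a v hv)]
      rw [sub_eq_zero]
      exact this.symm)
  refine ⟨d, -f', ?_⟩
  ext a v
  simp [hd]

theorem exists_pushout_sub_mem_of_notMem
    [∀ i, FiniteDimensional k (M i)] [∀ i, FiniteDimensional k (X i)]
    (hc : IsAlmostSplitCocycle m τ c)
    {d : ∀ a, M (s a) →ₗ[k] X (t a)} (hd : d ∉ LinearMap.range (extDiff s t m x)) :
    ∃ h ∈ LinearMap.ker (extDiff s t x τ),
      pushout s t h d - c ∈ LinearMap.range (extDiff s t m τ) := by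
  obtain ⟨f, hf⟩ := mem_range_extDiff.mp <|
    hc.pullback_mem (fun i => X i × M i) (extRep x m d) (fun i => LinearMap.snd k (X i) (M i))
      (mem_ker_extDiff.mpr fun a v => rfl) (by
        rintro ⟨r, hr, hr'⟩
        refine hd (mem_range_extDiff.mpr ⟨fun i => -(LinearMap.fst k _ _ ∘ₗ r i), fun a v => ?_⟩)
        have h₁ := congrArg Prod.fst (mem_ker_extDiff.mp hr a v)
        have h₂ : (r (s a) v).2 = v := hr' _ v
        simp only [extRep_apply, h₂] at h₁
        simp only [LinearMap.neg_apply, LinearMap.comp_apply, LinearMap.fst_apply, map_neg, ← h₁]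
        abel)
  refine ⟨fun i => -(f i ∘ₗ LinearMap.inl k _ _), mem_ker_extDiff.mpr fun a v => ?_,
    mem_range_extDiff.mpr ⟨fun i => -(f i ∘ₗ LinearMap.inr k _ _), fun a v => ?_⟩⟩
  · have := hf a (v, 0)
    simp only [pullback_apply, extRep_apply, LinearMap.snd_apply, map_zero, add_zero,
      sub_eq_zero] at this
    simp [this]
  · have := hf a (0, v)
    simp only [pullback_apply, extRep_apply, LinearMap.snd_apply, map_zero, zero_add] at this
    have h₂ : f (t a) (d a v, m a v) = f (t a) (d a v, 0) + f (t a) (0, m a v) := by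
      rw [← map_add]; simp
    simp only [LinearMap.neg_apply, LinearMap.comp_apply, LinearMap.inr_apply,
      LinearMap.inl_apply, map_neg, Pi.sub_apply, pushout_apply, LinearMap.sub_apply, ← this, h₂]
    abel

theorem injective_of_pushout_sub_mem (hc : IsAlmostSplitCocycle m τ c)
    {θ : ∀ i, T i →ₗ[k] T i} (hθ : θ ∈ LinearMap.ker (extDiff s t τ τ))
    (h : pushout s t θ c - c ∈ LinearMap.range (extDiff s t m τ)) (i : V) :
    Function.Injective (θ i) := by
  refine (hc.nilpotent_or_injective θ hθ).resolve_left ?_ i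
  rintro ⟨n, hn⟩
  have key : ∀ n : ℕ, pushout s t (fun i => θ i ^ n) c - c ∈
      LinearMap.range (extDiff s t m τ) := by
    intro n
    induction n with
    | zero =>
      convert Submodule.zero_mem _
      ext a v
      simp
    | succ n ih =>
      obtain ⟨f, hf⟩ := mem_range_extDiff.mp ih
      have : pushout s t θ (pushout s t (fun i => θ i ^ n) c - c) ∈
          LinearMap.range (extDiff s t m τ) := by
        refine mem_range_extDiff.mpr ⟨fun i => θ i ∘ₗ f i, fun a v => ?_⟩
        simp only [LinearMap.comp_apply]
        rw [mem_ker_extDiff.mp hθ, ← map_sub, hf]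
        rfl
      convert Submodule.add_mem _ this h using 1
      ext a v
      simp [pow_succ']
  refine hc.notMem ?_
  have := key n
  convert Submodule.neg_mem _ this
  ext a v
  simp [hn]

theorem exists_pushout_sub_mem_of_ne_zero
    [∀ i, FiniteDimensional k (M i)] [∀ i, FiniteDimensional k (T i)]
    (hc : IsAlmostSplitCocycle m τ c)
    {h : ∀ i, X i →ₗ[k] T i} (hh : h ∈ LinearMap.ker (extDiff s t x τ)) (hne : h ≠ 0) :
    ∃ d, pushout s t h d - c ∈ LinearMap.range (extDiff s t m τ) := by
  rw [mem_ker_extDiff] at hh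
  have hτ : ∀ a, LinearMap.range (h (s a)) ≤ (LinearMap.range (h (t a))).comap (τ a) := by
    rintro a _ ⟨v, rfl⟩
    exact ⟨x a v, (hh a v).symm⟩
  let π : ∀ i, T i →ₗ[k] T i ⧸ LinearMap.range (h i) := fun i => (LinearMap.range (h i)).mkQ
  let q : ∀ a, (T (s a) ⧸ LinearMap.range (h (s a))) →ₗ[k]
    (T (t a) ⧸ LinearMap.range (h (t a))) := fun a => Submodule.mapQ _ _ (τ a) (hτ a)
  have hq : ∀ a v, q a (π (s a) v) = π (t a) (τ a v) := fun a v => rfl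
  by_cases hmem : pushout s t π c ∈ LinearMap.range
      (extDiff (Y := fun i => T i ⧸ LinearMap.range (h i)) s t m q)
  · obtain ⟨f, hf⟩ := mem_range_extDiff.mp hmem
    choose f' hf' using fun i => LinearMap.exists_comp_eq_of_range_le (π i) (f i)
      (fun v => Submodule.mkQ_surjective _ _)
    choose d hd using fun a => LinearMap.exists_comp_eq_of_range_le (h (t a))
      (c a - extDiff s t m τ f' a) (fun v => by
        rw [← LinearMap.mem_range, ← Submodule.Quotient.mk_eq_zero]
        change π (t a) (c a v - (τ a (f' (s a) v) - f' (t a) (m a v))) = 0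
        have := hf a v
        rw [pushout_apply] at this
        rw [map_sub, map_sub, ← hq, hf', hf', this, sub_self])
    refine ⟨d, -f', ?_⟩
    ext a v
    simp [hd]
  · obtain ⟨l, hl, hmem'⟩ := hc.exists_pushout_sub_mem_of_notMem hmem
    have hinj := hc.injective_of_pushout_sub_mem (θ := fun i => l i ∘ₗ π i)
      (mem_ker_extDiff.mpr fun a v => by
        simp only [LinearMap.comp_apply]
        rw [mem_ker_extDiff.mp hl, hq]) hmem'
    refine absurd (funext fun i => LinearMap.ext fun v => hinj i ?_) hne
    have : π i (h i v) = 0 := (Submodule.Quotient.mk_eq_zero _).mpr ⟨v, rfl⟩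
    simp [this]

theorem exists_pullback_sub_mem_of_notMem
    [∀ i, FiniteDimensional k (M i)] [∀ i, FiniteDimensional k (T i)] [∀ i, FiniteDimensional k (X i)]
    (hc : IsAlmostSplitCocycle m τ c)
    {d : ∀ a, X (s a) →ₗ[k] T (t a)} (hd : d ∉ LinearMap.range (extDiff s t x τ)) :
    ∃ h ∈ LinearMap.ker (extDiff s t m x),
      pullback s t h d - c ∈ LinearMap.range (extDiff s t m τ) := by
  let ι : ∀ i, T i →ₗ[k] T i × X i := fun i => LinearMap.inl k _ _
  by_cases hmem : pushout s t ι c ∈ LinearMap.range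
      (extDiff (Y := fun i => T i × X i) s t m (extRep τ x d))
  · obtain ⟨f, hf⟩ := mem_range_extDiff.mp hmem
    refine ⟨fun i => LinearMap.snd k _ _ ∘ₗ f i, mem_ker_extDiff.mpr fun a v => ?_,
      mem_range_extDiff.mpr ⟨fun i => -(LinearMap.fst k _ _ ∘ₗ f i), fun a v => ?_⟩⟩
    · have := congrArg Prod.snd (hf a v)
      simpa [ι, sub_eq_zero] using this
    · have := congrArg Prod.fst (hf a v)
      simp only [ι, pushout_apply, extRep_apply, Prod.fst_sub, LinearMap.inl_apply] at this
      simp only [LinearMap.neg_apply, LinearMap.comp_apply, LinearMap.fst_apply, map_neg,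
        Pi.sub_apply, LinearMap.sub_apply, pullback_apply, LinearMap.snd_apply, ← this]
      abel
  · obtain ⟨l, hl, hmem'⟩ := hc.exists_pushout_sub_mem_of_notMem hmem
    rw [mem_ker_extDiff] at hl
    have hl₁ : ∀ a v, τ a (l (s a) (v, 0)) = l (t a) (τ a v, 0) := fun a v => by
      simpa using hl a (v, 0)
    have hinj := hc.injective_of_pushout_sub_mem (θ := fun i => l i ∘ₗ ι i)
      (mem_ker_extDiff.mpr hl₁) hmem'
    choose r hr using fun i =>
      LinearMap.exists_leftInverse_of_injective (l i ∘ₗ ι i) (LinearMap.ker_eq_bot.mpr (hinj i))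
    have hr₁ : ∀ i v, r i (l i (v, 0)) = v := fun i v => LinearMap.congr_fun (hr i) v
    have hr₂ : ∀ i v, l i (r i v, 0) = v := fun i v => by
      obtain ⟨u, rfl⟩ := LinearMap.injective_iff_surjective.mp (hinj i) v
      exact congrArg (fun z => l i (z, 0)) (hr₁ i u)
    have hr₃ : ∀ a v, τ a (r (s a) v) = r (t a) (τ a v) := fun a v => by
      rw [← hr₁ (t a) (τ a (r (s a) v)), ← hl₁, hr₂]
    refine absurd (mem_range_extDiff.mpr
      ⟨fun i => r i ∘ₗ l i ∘ₗ LinearMap.inr k _ _, fun a v => ?_⟩) hd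
    have h₁ : τ a (l (s a) (0, v)) = l (t a) (d a v, x a v) := by simpa using hl a (0, v)
    have h₂ : l (t a) (d a v, x a v) = l (t a) (d a v, 0) + l (t a) (0, x a v) := by
      rw [← map_add]; simp
    simp only [LinearMap.comp_apply, LinearMap.inr_apply]
    rw [hr₃, h₁, h₂, map_add, hr₁, add_sub_cancel_right]

variable [Fintype V] [Fintype A] [∀ i, FiniteDimensional k (M i)]
  [∀ i, FiniteDimensional k (T i)] [∀ i, FiniteDimensional k (X i)]

/-- The Auslander–Reiten formula `dim Hom(M, X) = dim Ext¹(X, T)`. -/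
theorem finrank_hom_add_finrank_range (hc : IsAlmostSplitCocycle m τ c)
    (x : ∀ a, X (s a) →ₗ[k] X (t a)) :
    Module.finrank k (LinearMap.ker (extDiff s t m x)) +
        Module.finrank k (LinearMap.range (extDiff s t x τ)) =
      Module.finrank k (∀ a, X (s a) →ₗ[k] T (t a)) := by
  obtain ⟨φ, hφc, hφ⟩ := Submodule.exists_le_ker_of_notMem hc.notMem
  have hφ' : ∀ z, z - c ∈ LinearMap.range (extDiff s t m τ) → φ z ≠ 0 := fun z hz => by
    have := hφ hz
    rw [LinearMap.mem_ker, map_sub, sub_eq_zero] at this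
    rwa [this]
  refine finrank_add_finrank_eq_of_nondegenerate ((pullback s t).compr₂ φ) _ _ ?_ ?_ ?_
  · intro h hh d hd
    obtain ⟨f, hf⟩ := mem_range_extDiff.mp hd
    refine hφ (mem_range_extDiff.mpr ⟨fun i => f i ∘ₗ h i, fun a v => ?_⟩)
    simp [← hf, mem_ker_extDiff.mp hh]
  · intro h hh hne
    obtain ⟨d, hd⟩ := hc.exists_pullback_sub_mem_of_ne_zero hh hne
    exact ⟨d, hφ' _ hd⟩
  · intro d hd
    obtain ⟨h, hh, hd⟩ := hc.exists_pullback_sub_mem_of_notMem hd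
    exact ⟨h, hh, hφ' _ hd⟩

/-- The Auslander–Reiten formula `dim Hom(X, T) = dim Ext¹(M, X)`. -/
theorem finrank_hom_add_finrank_range' (hc : IsAlmostSplitCocycle m τ c)
    (x : ∀ a, X (s a) →ₗ[k] X (t a)) :
    Module.finrank k (LinearMap.ker (extDiff s t x τ)) +
        Module.finrank k (LinearMap.range (extDiff s t m x)) =
      Module.finrank k (∀ a, M (s a) →ₗ[k] X (t a)) := by
  obtain ⟨φ, hφc, hφ⟩ := Submodule.exists_le_ker_of_notMem hc.notMem
  have hφ' : ∀ z, z - c ∈ LinearMap.range (extDiff s t m τ) → φ z ≠ 0 := fun z hz => by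
    have := hφ hz
    rw [LinearMap.mem_ker, map_sub, sub_eq_zero] at this
    rwa [this]
  refine finrank_add_finrank_eq_of_nondegenerate ((pushout s t).compr₂ φ) _ _ ?_ ?_ ?_
  · intro h hh d hd
    obtain ⟨f, hf⟩ := mem_range_extDiff.mp hd
    refine hφ (mem_range_extDiff.mpr ⟨fun i => h i ∘ₗ f i, fun a v => ?_⟩)
    simp [← hf, mem_ker_extDiff.mp hh]
  · intro h hh hne
    obtain ⟨d, hd⟩ := hc.exists_pushout_sub_mem_of_ne_zero hh hne
    exact ⟨d, hφ' _ hd⟩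
  · intro d hd
    obtain ⟨h, hh, hd⟩ := hc.exists_pushout_sub_mem_of_notMem hd
    exact ⟨h, hh, hφ' _ hd⟩

/-- The Euler form satisfies `⟨X, T⟩ = -⟨M, X⟩`, where `0 → T → E → M → 0` is almost split. -/
theorem eulerForm_eq_neg (hc : IsAlmostSplitCocycle m τ c)
    (x : ∀ a, X (s a) →ₗ[k] X (t a)) :
    eulerForm s t (fun i => (Module.finrank k (X i) : ℤ)) (fun i => (Module.finrank k (T i) : ℤ)) =
      -eulerForm s t (fun i => (Module.finrank k (M i) : ℤ))
        (fun i => (Module.finrank k (X i) : ℤ)) := by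
  have h₁ := hc.finrank_hom_add_finrank_range x
  have h₂ := hc.finrank_hom_add_finrank_range' x
  have h₃ := (extDiff s t m x).finrank_range_add_finrank_ker
  have h₄ := (extDiff s t x τ).finrank_range_add_finrank_ker
  simp only [Module.finrank_pi_fintype, Module.finrank_linearMap] at h₁ h₂ h₃ h₄
  simp only [eulerForm]
  zify at h₁ h₂ h₃ h₄
  linarith

end IsAlmostSplitCocycle

end Extensions

section Matrices

variable {s t : A → V} {dX dY dM dT dE : V → ℕ}

/-- The linear maps underlying a representation given by matrices. -/
def QRep.toLin (X : QRep s t dX) (a : A) : (Fin (dX (s a)) → ℂ) →ₗ[ℂ] (Fin (dX (t a)) → ℂ) :=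
  (X a).mulVecLin

@[simp]
theorem QRep.toLin_apply (X : QRep s t dX) (a : A) (v : Fin (dX (s a)) → ℂ) :
    X.toLin a v = X a *ᵥ v := rfl

/-- The linear maps underlying a morphism given by matrices. -/
def RHom.toLin {X : QRep s t dX} {Y : QRep s t dY} (φ : RHom s t X Y) (i : V) :
    (Fin (dX i) → ℂ) →ₗ[ℂ] (Fin (dY i) → ℂ) :=
  (φ.1 i).mulVecLin

theorem RHom.toLin_mem_ker {X : QRep s t dX} {Y : QRep s t dY} (φ : RHom s t X Y) :
    φ.toLin ∈ LinearMap.ker (extDiff (X := fun i => Fin (dX i) → ℂ)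
      (Y := fun i => Fin (dY i) → ℂ) s t X.toLin Y.toLin) :=
  mem_ker_extDiff.mpr fun a v => by simp [RHom.toLin, φ.2 a]

theorem RHom.exists_toLin_eq {X : QRep s t dX} {Y : QRep s t dY}
    {f : ∀ i, (Fin (dX i) → ℂ) →ₗ[ℂ] (Fin (dY i) → ℂ)}
    (hf : f ∈ LinearMap.ker (extDiff (X := fun i => Fin (dX i) → ℂ)
      (Y := fun i => Fin (dY i) → ℂ) s t X.toLin Y.toLin)) :
    ∃ φ : RHom s t X Y, φ.toLin = f := by
  refine ⟨⟨fun i => LinearMap.toMatrix' (f i), fun a => ?_⟩, funext fun i => ?_⟩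
  · apply Matrix.toLin'.injective
    refine LinearMap.ext fun v => ?_
    simpa [Matrix.toLin'_mul] using mem_ker_extDiff.mp hf a _
  · simp [RHom.toLin, ← Matrix.toLin'_apply']

theorem isSplitEpi_of_toLin {X : QRep s t dX} {Y : QRep s t dY} {h : RHom s t X Y}
    {r : RHom s t Y X} (hr : ∀ i v, h.toLin i (r.toLin i v) = v) : IsSplitEpi s t h := by
  refine ⟨r, fun i => Matrix.toLin'.injective (LinearMap.ext fun v => ?_)⟩
  simpa [RHom.toLin] using hr i v

theorem RHom.toLin_apply_of_mul_eq {X : QRep s t dX} {Y : QRep s t dY} {M : QRep s t dM}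
    {g : RHom s t Y M} {u : RHom s t X Y} {h : RHom s t X M} {i : V}
    (hu : g.1 i * u.1 i = h.1 i) (v : Fin (dX i) → ℂ) :
    g.toLin i (u.toLin i v) = h.toLin i v := by
  simp [RHom.toLin, hu]

/-- Fitting's lemma: every endomorphism of an indecomposable representation of a finite quiver is
nilpotent or injective. -/
theorem Indec.nilpotent_or_injective [Finite V] {T : QRep s t dT} (hT : Indec s t T)
    {θ : ∀ i, (Fin (dT i) → ℂ) →ₗ[ℂ] (Fin (dT i) → ℂ)}
    (hθ : θ ∈ LinearMap.ker (extDiff (X := fun i => Fin (dT i) → ℂ)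
      (Y := fun i => Fin (dT i) → ℂ) s t T.toLin T.toLin)) :
    (∃ n : ℕ, ∀ i, (θ i) ^ n = 0) ∨ ∀ i, Function.Injective (θ i) := by
  rw [mem_ker_extDiff] at hθ
  obtain ⟨n, hn, hn₀⟩ := ((Filter.eventually_all.mpr fun i =>
    LinearMap.eventually_isCompl_ker_pow_range_pow (θ i)).and
      (Filter.eventually_ne_atTop 0)).exists
  have hθn : ∀ a v, T.toLin a ((θ (s a) ^ n) v) = (θ (t a) ^ n) (T.toLin a v) := by
    clear hn hn₀
    intro a
    induction n with
    | zero => simp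
    | succ n ih =>
      intro v
      rw [pow_succ, pow_succ, Module.End.mul_apply, Module.End.mul_apply, ih, hθ]
  let e : ∀ i, (Fin (dT i) → ℂ) →ₗ[ℂ] (Fin (dT i) → ℂ) := fun i =>
    (LinearMap.range (θ i ^ n)).projection (LinearMap.ker (θ i ^ n)) (hn i).symm
  have he : e ∈ LinearMap.ker (extDiff (X := fun i => Fin (dT i) → ℂ)
      (Y := fun i => Fin (dT i) → ℂ) s t T.toLin T.toLin) := by
    refine mem_ker_extDiff.mpr fun a v => ?_
    obtain ⟨y, hy, z, hz, rfl⟩ := Submodule.mem_sup.mp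
      ((hn (s a)).sup_eq_top ▸ Submodule.mem_top : v ∈ _)
    have hy' : T.toLin a y ∈ LinearMap.ker (θ (t a) ^ n) := by
      rw [LinearMap.mem_ker] at hy ⊢
      rw [← hθn, hy, map_zero]
    have hz' : T.toLin a z ∈ LinearMap.range (θ (t a) ^ n) := by
      obtain ⟨w, rfl⟩ := hz
      exact ⟨T.toLin a w, (hθn a w).symm⟩
    simp only [e, map_add]
    rw [(Submodule.projection_apply_eq_zero_iff _).mpr hy,
      (Submodule.projection_apply_eq_zero_iff _).mpr hy',
      Submodule.projection_apply_of_mem_left _ hz, Submodule.projection_apply_of_mem_left _ hz',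
      map_zero]
  obtain ⟨φ, hφ⟩ := RHom.exists_toLin_eq he
  have hφe : ∀ i v, φ.1 i *ᵥ v = e i v := fun i v => by rw [← hφ]; rfl
  rcases hT.2 φ (fun i => Matrix.toLin'.injective (LinearMap.ext fun v => by
    simp only [Matrix.toLin'_apply, ← Matrix.mulVec_mulVec, hφe]
    exact Submodule.projection_apply_of_mem_left _ (Submodule.projection_apply_mem _ _))) with h | h
  · refine Or.inl ⟨n, fun i => LinearMap.ext fun v => ?_⟩
    rw [LinearMap.zero_apply, ← Submodule.projection_apply_of_mem_left (hn i).symm ⟨v, rfl⟩]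
    change e i _ = 0
    rw [← hφe, h, Matrix.zero_mulVec]
  · refine Or.inr fun i => ?_
    rw [← LinearMap.ker_eq_bot, eq_bot_iff]
    intro v hv
    have hv' : v ∈ LinearMap.ker (θ i ^ n) := by
      obtain ⟨l, rfl⟩ := Nat.exists_eq_succ_of_ne_zero hn₀
      rw [LinearMap.mem_ker] at hv ⊢
      rw [pow_succ, Module.End.mul_apply, hv, map_zero]
    have : e i v = 0 := (Submodule.projection_apply_eq_zero_iff _).mpr hv'
    rwa [← hφe, h, Matrix.one_mulVec] at this

/-- The factorization property of an almost split sequence for arbitrary finite-dimensional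
representations. -/
theorem IsAlmostSplit.exists_factor {T : QRep s t dT} {E : QRep s t dE} {M : QRep s t dM}
    {f : RHom s t T E} {g : RHom s t E M} (has : IsAlmostSplit s t f g)
    {X : V → Type} [∀ i, AddCommGroup (X i)] [∀ i, Module ℂ (X i)]
    [∀ i, FiniteDimensional ℂ (X i)] {x : ∀ a, X (s a) →ₗ[ℂ] X (t a)}
    {h : ∀ i, X i →ₗ[ℂ] (Fin (dM i) → ℂ)}
    (hh : h ∈ LinearMap.ker (extDiff (Y := fun i => Fin (dM i) → ℂ) s t x M.toLin))
    (hsplit : ¬ ∃ r ∈ LinearMap.ker (extDiff (X := fun i => Fin (dM i) → ℂ) s t M.toLin x),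
      ∀ i v, h i (r i v) = v) :
    ∃ u ∈ LinearMap.ker (extDiff (Y := fun i => Fin (dE i) → ℂ) s t x E.toLin),
      ∀ i v, g.toLin i (u i v) = h i v := by
  rw [mem_ker_extDiff] at hh
  let b : ∀ i, X i ≃ₗ[ℂ] (Fin (Module.finrank ℂ (X i)) → ℂ) := fun i =>
    (Module.finBasis ℂ (X i)).equivFun
  let X' : QRep s t (fun i => Module.finrank ℂ (X i)) := fun a =>
    LinearMap.toMatrix' ((b (t a)).toLinearMap ∘ₗ x a ∘ₗ (b (s a)).symm.toLinearMap)
  have hX' : ∀ a v, X'.toLin a v = b (t a) (x a ((b (s a)).symm v)) := fun a v => by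
    simp [X', LinearMap.toMatrix'_mulVec]
  obtain ⟨h', hh'⟩ := RHom.exists_toLin_eq (X := X') (Y := M)
    (f := fun i => h i ∘ₗ (b i).symm.toLinearMap) (mem_ker_extDiff.mpr fun a v => by
      simp [-QRep.toLin_apply, hX', hh])
  have hh'' : ∀ i v, h'.toLin i v = h i ((b i).symm v) := fun i v => by rw [hh']; rfl
  obtain ⟨u, hu⟩ := has.2.2.2.2 _ X' h' (by
    rintro ⟨r, hr⟩
    refine hsplit ⟨fun i => (b i).symm.toLinearMap ∘ₗ r.toLin i,
      mem_ker_extDiff.mpr fun a v => (b (t a)).injective ?_, fun i v => ?_⟩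
    · have := mem_ker_extDiff.mp r.toLin_mem_ker a v
      rw [hX'] at this
      simpa using this
    · have := hh'' i (r.toLin i v)
      simp only [RHom.toLin, Matrix.mulVecLin_apply, Matrix.mulVec_mulVec, hr i,
        Matrix.one_mulVec] at this
      exact this.symm)
  refine ⟨fun i => u.toLin i ∘ₗ (b i).toLinearMap, mem_ker_extDiff.mpr fun a v => ?_,
    fun i v => ?_⟩
  · have := mem_ker_extDiff.mp u.toLin_mem_ker a (b _ v)
    rw [hX'] at this
    simpa using this
  · have := RHom.toLin_apply_of_mul_eq (hu i) (b i v)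
    rw [hh''] at this
    simpa using this

theorem IsAlmostSplit.exists_cocycle [Finite V] {T : QRep s t dT} {E : QRep s t dE}
    {M : QRep s t dM} {f : RHom s t T E} {g : RHom s t E M} (has : IsAlmostSplit s t f g) :
    ∃ c, IsAlmostSplitCocycle (M := fun i => Fin (dM i) → ℂ) (T := fun i => Fin (dT i) → ℂ)
      M.toLin T.toLin c := by
  have hinj : ∀ i, Function.Injective (f.toLin i) := has.1.1
  have hex : ∀ i v, g.toLin i v = 0 → ∃ w, f.toLin i w = v := fun i v hv => by
    have : v ∈ LinearMap.range (f.toLin i) := by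
      rw [RHom.toLin, has.1.2.2 i]
      exact hv
    exact this
  have hgf : ∀ i w, g.toLin i (f.toLin i w) = 0 := fun i w => by
    have : f.toLin i w ∈ LinearMap.ker (g.1 i).mulVecLin := has.1.2.2 i ▸ ⟨w, rfl⟩
    exact this
  have hf := mem_ker_extDiff.mp f.toLin_mem_ker
  have hg := mem_ker_extDiff.mp g.toLin_mem_ker
  choose σ hσ using fun i => LinearMap.exists_comp_eq_of_range_le (g.toLin i) LinearMap.id
    (has.1.2.1 i)
  simp only [LinearMap.id_apply] at hσ
  choose c hc using fun a => LinearMap.exists_comp_eq_of_range_le (f.toLin (t a))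
    (extDiff (X := fun i => Fin (dM i) → ℂ) (Y := fun i => Fin (dE i) → ℂ) s t M.toLin E.toLin σ a)
    (fun v => hex _ _ (by
      change g.toLin (t a) (E.toLin a (σ (s a) v) - σ (t a) (M.toLin a v)) = 0
      rw [map_sub, ← hg, hσ, hσ, sub_self]))
  replace hc : ∀ a v, f.toLin (t a) (c a v) = E.toLin a (σ (s a) v) - σ (t a) (M.toLin a v) := hc
  refine ⟨c, ⟨fun hmem => ?_, fun X _ _ _ x h hh hsplit => ?_,
    fun θ hθ => has.2.2.1.nilpotent_or_injective hθ⟩⟩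
  · obtain ⟨F, hF⟩ := mem_range_extDiff.mp hmem
    obtain ⟨r, hr⟩ := RHom.exists_toLin_eq (X := M) (Y := E)
      (f := fun i => σ i - f.toLin i ∘ₗ F i) (mem_ker_extDiff.mpr fun a v => by
        simp only [LinearMap.sub_apply, LinearMap.comp_apply, map_sub]
        rw [hf, sub_eq_sub_iff_sub_eq_sub, ← hc, ← hF, map_sub])
    refine has.2.1 (isSplitEpi_of_toLin (r := r) fun i v => ?_)
    rw [hr]
    simp only [LinearMap.sub_apply, LinearMap.comp_apply, map_sub]
    rw [hσ, hgf, sub_zero]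
  · obtain ⟨u, hu, hgu⟩ := has.exists_factor hh hsplit
    rw [mem_ker_extDiff] at hh hu
    choose w hw using fun i => LinearMap.exists_comp_eq_of_range_le (f.toLin i)
      (u i - σ i ∘ₗ h i) (fun v => hex _ _ (by
        simp only [LinearMap.sub_apply, LinearMap.comp_apply, map_sub]
        rw [hgu, hσ, sub_self]))
    refine mem_range_extDiff.mpr ⟨-w, fun a v => hinj _ ?_⟩
    simp only [Pi.neg_apply, LinearMap.neg_apply, map_neg, map_sub, pullback_apply]
    rw [← hf, hw, hw, hc, hh]
    simp only [LinearMap.sub_apply, LinearMap.comp_apply, map_sub]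
    rw [hu]
    abel

end Matrices

section EulerForm

variable [Fintype V] [Fintype A] [DecidableEq V] (s t : A → V)

theorem eulerForm_eq_dotProduct (x y : V → ℤ) :
    eulerForm s t x y = x ⬝ᵥ eulerMat s t *ᵥ y := by
  have key : ∀ i j, (Fintype.card {a : A // s a = i ∧ t a = j} : ℤ) =
      ∑ a, (if s a = i then 1 else 0) * (if t a = j then 1 else 0) := fun i j => by
    simp [Fintype.card_subtype, ← ite_and, and_comm]
  simp only [eulerForm, dotProduct, mulVec, eulerMat, Matrix.of_apply, key, sub_mul,
    Finset.sum_sub_distrib, mul_sub, ite_mul, one_mul, zero_mul, Finset.sum_ite_eq,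
    Finset.mem_univ, if_true, Finset.sum_mul, Finset.mul_sum]
  congr 1
  simp_rw [Finset.sum_comm (s := Finset.univ (α := V)) (t := Finset.univ (α := A))]
  simp

end EulerForm

/-- For an indecomposable non-projective M with AR translate τM,
`g_M + g_{τM} + B · dim M = 0`. -/
theorem gvec_tau_exchange [Fintype V] [Fintype A] [DecidableEq V] (s t : A → V)
    (hQ : IsDynkin s t) (dT dE dM : V → ℕ)
    (T : QRep s t dT) (E : QRep s t dE) (M : QRep s t dM)
    (f : RHom s t T E) (g : RHom s t E M) (has : IsAlmostSplit s t f g) :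
    gvec s t dM + gvec s t dT +
        (exchMat s t).mulVec (fun k => (dM k : ℤ)) = 0 := by
  obtain ⟨c, hc⟩ := has.exists_cocycle
  have key : ∀ i, (eulerMat s t *ᵥ fun k => (dT k : ℤ)) i =
      -((eulerMat s t)ᵀ *ᵥ fun k => (dM k : ℤ)) i := fun i => by
    have h := hc.eulerForm_eq_neg
      (X := fun j => Fin (if j = i then 1 else 0) → ℂ) (fun _ => 0)
    have hX : (fun j => ((if j = i then 1 else 0 : ℕ) : ℤ)) = Pi.single i 1 := by
      ext j
      simp [Pi.single_apply]
    simp only [Module.finrank_fin_fun, hX, eulerForm_eq_dotProduct] at h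
    rw [single_one_dotProduct, dotProduct_mulVec, dotProduct_single_one] at h
    rwa [mulVec_transpose]
  ext i
  simp only [gvec, exchMat, sub_mulVec, Pi.add_apply, Pi.neg_apply, Pi.sub_apply, Pi.zero_apply,
    key]
  ring

end
end
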